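/- Let n ≥ 1, let Ω ⊂ ℝ^n be open, and let f ∈ BV(Ω). Then there exists a sequence {f_i}_{i=1}^∞ ⊂ SBV(Ω) such that f_i − f → 0 in L^∞(Ω), limsup_{i→∞} |D^a f_i|(Ω) ≤ |D^a f|(Ω) + |D^c f|(Ω), and limsup_{i→∞} |D^j f_i|(Ω) ≤ |D^j f|(Ω). -/

import Mathlib

open MeasureTheory Filter Topology Metric
open scoped ENNReal RealInnerProductSpace Classical

noncomputable section

/-- An open cube in `ℝⁿ` with side length `ε` and arbitrary orientation. -/
def IsCube (n : ℕ) (ε : ℝ) (Q : Set (EuclideanSpace ℝ (Fin n))) : Prop :=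
  ∃ (T : EuclideanSpace ℝ (Fin n) ≃ₗᵢ[ℝ] EuclideanSpace ℝ (Fin n))
    (x : EuclideanSpace ℝ (Fin n)),
    Q = (fun y => x + T y) '' {y : EuclideanSpace ℝ (Fin n) | ∀ i, |y i| < ε / 2}

/-- The BMO-type functional `κ_ε(f, Ω)`. -/
def kappa (n : ℕ) (ε : ℝ) (f : EuclideanSpace ℝ (Fin n) → ℝ)
    (Ω : Set (EuclideanSpace ℝ (Fin n))) : ℝ≥0∞ :=
  ENNReal.ofReal (ε ^ (n - 1)) *
    ⨆ (F : Set (Set (EuclideanSpace ℝ (Fin n))))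
      (_ : ∀ Q ∈ F, IsCube n ε Q ∧ Q ⊆ Ω) (_ : F.Pairwise Disjoint),
      ∑' Q : F, ENNReal.ofReal
        (⨍ x in (Q : Set (EuclideanSpace ℝ (Fin n))),
          |f x - ⨍ y in (Q : Set (EuclideanSpace ℝ (Fin n))), f y ∂volume| ∂volume)

/-- The divergence of a vector field on `ℝⁿ`. -/
def vdiv (n : ℕ) (Φ : EuclideanSpace ℝ (Fin n) → EuclideanSpace ℝ (Fin n))
    (x : EuclideanSpace ℝ (Fin n)) : ℝ :=
  ∑ i : Fin n, fderiv ℝ Φ x (EuclideanSpace.single i 1) i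

/-- The variation `Var(f, Ω)`. -/
def variation (n : ℕ) (f : EuclideanSpace ℝ (Fin n) → ℝ)
    (Ω : Set (EuclideanSpace ℝ (Fin n))) : ℝ≥0∞ :=
  ⨆ (Φ : EuclideanSpace ℝ (Fin n) → EuclideanSpace ℝ (Fin n))
    (_ : ContDiff ℝ 1 Φ) (_ : HasCompactSupport Φ) (_ : tsupport Φ ⊆ Ω)
    (_ : ∀ x, ‖Φ x‖ ≤ 1),
    ENNReal.ofReal (∫ x in Ω, f x * vdiv n Φ x)

/-- The approximate jump set `J_f`. -/
def jumpSet (n : ℕ) (f : EuclideanSpace ℝ (Fin n) → ℝ) : Set (EuclideanSpace ℝ (Fin n)) :=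
  {x | ∃ ν : EuclideanSpace ℝ (Fin n), ‖ν‖ = 1 ∧ ∃ a b : ℝ, a ≠ b ∧
    Tendsto (fun r : ℝ =>
        ⨍ y in {y ∈ ball x r | 0 < ⟪y - x, ν⟫}, |f y - a| ∂volume)
      (𝓝[>] 0) (𝓝 0) ∧
    Tendsto (fun r : ℝ =>
        ⨍ y in {y ∈ ball x r | ⟪y - x, ν⟫ < 0}, |f y - b| ∂volume)
      (𝓝[>] 0) (𝓝 0)}

/-- The approximate discontinuity set `S_f` (the set of non-Lebesgue points). -/
def approxDiscontSet (n : ℕ) (f : EuclideanSpace ℝ (Fin n) → ℝ) :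
    Set (EuclideanSpace ℝ (Fin n)) :=
  {x | ¬ ∃ c : ℝ,
    Tendsto (fun r : ℝ => ⨍ y in ball x r, |f y - c| ∂volume) (𝓝[>] 0) (𝓝 0)}

/-- `(μ, σ)` is the polar decomposition `Df = σ |Df|` of the gradient measure of `f` on `Ω`:
`μ` plays the role of the total variation measure `|Df|` and `σ` of the polar vector field. -/
def IsVariationPair (n : ℕ) (f : EuclideanSpace ℝ (Fin n) → ℝ)
    (Ω : Set (EuclideanSpace ℝ (Fin n))) (μ : Measure (EuclideanSpace ℝ (Fin n)))
    (σ : EuclideanSpace ℝ (Fin n) → EuclideanSpace ℝ (Fin n)) : Prop :=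
  IsFiniteMeasure μ ∧ μ Ωᶜ = 0 ∧ AEStronglyMeasurable σ μ ∧ (∀ᵐ x ∂μ, ‖σ x‖ = 1) ∧
  ∀ Φ : EuclideanSpace ℝ (Fin n) → EuclideanSpace ℝ (Fin n),
    ContDiff ℝ 1 Φ → HasCompactSupport Φ → tsupport Φ ⊆ Ω →
    ∫ x in Ω, f x * vdiv n Φ x = - ∫ x, ⟪Φ x, σ x⟫ ∂μ

/-- `|D^a f|(Ω)`, the total variation of the absolutely continuous part of `Df`,
with the convention that it is `∞` if `f` is not of bounded variation in `Ω`. -/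
def absVar (n : ℕ) (f : EuclideanSpace ℝ (Fin n) → ℝ)
    (Ω : Set (EuclideanSpace ℝ (Fin n))) : ℝ≥0∞ :=
  if h : ∃ p : Measure (EuclideanSpace ℝ (Fin n)) ×
      (EuclideanSpace ℝ (Fin n) → EuclideanSpace ℝ (Fin n)),
      IsVariationPair n f Ω p.1 p.2 then
    volume.withDensity ((h.choose.1).rnDeriv volume) Ω
  else ⊤

/-- `|D^c f|(Ω)`, the total variation of the Cantor part of `Df`,
with the convention that it is `∞` if `f` is not of bounded variation in `Ω`. -/
def cantorVar (n : ℕ) (f : EuclideanSpace ℝ (Fin n) → ℝ)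
    (Ω : Set (EuclideanSpace ℝ (Fin n))) : ℝ≥0∞ :=
  if h : ∃ p : Measure (EuclideanSpace ℝ (Fin n)) ×
      (EuclideanSpace ℝ (Fin n) → EuclideanSpace ℝ (Fin n)),
      IsVariationPair n f Ω p.1 p.2 then
    (h.choose.1.singularPart volume) (Ω \ approxDiscontSet n f)
  else ⊤

/-- `|D^j f|(Ω)`, the total variation of the jump part of `Df`,
with the convention that it is `∞` if `f` is not of bounded variation in `Ω`. -/
def jumpVar (n : ℕ) (f : EuclideanSpace ℝ (Fin n) → ℝ)
    (Ω : Set (EuclideanSpace ℝ (Fin n))) : ℝ≥0∞ :=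
  if h : ∃ p : Measure (EuclideanSpace ℝ (Fin n)) ×
      (EuclideanSpace ℝ (Fin n) → EuclideanSpace ℝ (Fin n)),
      IsVariationPair n f Ω p.1 p.2 then
    (h.choose.1.singularPart volume) (jumpSet n f ∩ Ω)
  else ⊤

/-- `g` is the weak (distributional) gradient of `u` on `Ω`. -/
def HasWeakGradientOn (n : ℕ) (u : EuclideanSpace ℝ (Fin n) → ℝ)
    (g : EuclideanSpace ℝ (Fin n) → EuclideanSpace ℝ (Fin n))
    (Ω : Set (EuclideanSpace ℝ (Fin n))) : Prop :=
  ∀ φ : EuclideanSpace ℝ (Fin n) → ℝ,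
    ContDiff ℝ 1 φ → HasCompactSupport φ → tsupport φ ⊆ Ω →
    ∀ k : Fin n,
      ∫ x in Ω, u x * fderiv ℝ φ x (EuclideanSpace.single k 1) =
        - ∫ x in Ω, φ x * g x k

/-- `f ∈ BV(Ω)`: `f` is integrable on `Ω` and has finite variation in `Ω`. -/
def IsBVOn (n : ℕ) (f : EuclideanSpace ℝ (Fin n) → ℝ)
    (Ω : Set (EuclideanSpace ℝ (Fin n))) : Prop :=
  IntegrableOn f Ω volume ∧ variation n f Ω < ⊤

/-- `f ∈ SBV(Ω)`: `f ∈ BV(Ω)` and the Cantor part of `Df` vanishes. -/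
def IsSBVOn (n : ℕ) (f : EuclideanSpace ℝ (Fin n) → ℝ)
    (Ω : Set (EuclideanSpace ℝ (Fin n))) : Prop :=
  IsBVOn n f Ω ∧ cantorVar n f Ω = 0

/-- The vector measure `τ m` is the distributional gradient of `f` on `Ω`. -/
def HasGradMeasure (n : ℕ) (f : EuclideanSpace ℝ (Fin n) → ℝ)
    (Ω : Set (EuclideanSpace ℝ (Fin n))) (m : Measure (EuclideanSpace ℝ (Fin n)))
    (τ : EuclideanSpace ℝ (Fin n) → EuclideanSpace ℝ (Fin n)) : Prop :=
  ∀ Φ : EuclideanSpace ℝ (Fin n) → EuclideanSpace ℝ (Fin n),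
    ContDiff ℝ 1 Φ → HasCompactSupport Φ → tsupport Φ ⊆ Ω →
    ∫ x in Ω, f x * vdiv n Φ x = - ∫ x, ⟪Φ x, τ x⟫ ∂m

/-- The total variation measure of the vector measure `τ m`. -/
def normMeasure {n : ℕ} (m : Measure (EuclideanSpace ℝ (Fin n)))
    (τ : EuclideanSpace ℝ (Fin n) → EuclideanSpace ℝ (Fin n)) :
    Measure (EuclideanSpace ℝ (Fin n)) :=
  m.withDensity (fun x => (‖τ x‖₊ : ℝ≥0∞))

theorem HasGradMeasure.isVariationPair {n : ℕ} {f : EuclideanSpace ℝ (Fin n) → ℝ}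
    {Ω : Set (EuclideanSpace ℝ (Fin n))} {m : Measure (EuclideanSpace ℝ (Fin n))}
    {τ : EuclideanSpace ℝ (Fin n) → EuclideanSpace ℝ (Fin n)}
    (h : HasGradMeasure n f Ω m τ) (hm : m Ωᶜ = 0) (hτ : Integrable τ m) :
    IsVariationPair n f Ω (normMeasure m τ) (fun x => ‖τ x‖⁻¹ • τ x) := by
  have hae : AEMeasurable (fun x => ‖τ x‖₊) m := hτ.1.nnnorm.aemeasurable
  have hac : normMeasure m τ ≪ m := withDensity_absolutelyContinuous _ _
  refine ⟨?_, hac hm, ?_, ?_, ?_⟩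
  · exact isFiniteMeasure_withDensity hτ.2.ne
  · exact ((hτ.1.norm.aemeasurable.inv.aestronglyMeasurable).smul hτ.1).mono_ac hac
  · unfold normMeasure
    rw [ae_withDensity_iff' hae.coe_nnreal_ennreal]
    filter_upwards with x hx
    have : τ x ≠ 0 := by simpa using hx
    rw [norm_smul, norm_inv, norm_norm, inv_mul_cancel₀ (norm_ne_zero_iff.2 this)]
  · intro Φ h1 h2 h3
    rw [h Φ h1 h2 h3]
    unfold normMeasure
    rw [integral_withDensity_eq_integral_smul₀ hae]
    congr 1
    refine integral_congr_ae (Eventually.of_forall fun x => ?_)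
    simp only [inner_smul_right]
    by_cases h0 : τ x = 0
    · simp [h0]
    · rw [NNReal.smul_def, coe_nnnorm, smul_eq_mul, ← mul_assoc,
        mul_inv_cancel₀ (norm_ne_zero_iff.2 h0), one_mul]

theorem IsVariationPair.measure_eq {n : ℕ} {f : EuclideanSpace ℝ (Fin n) → ℝ}
    {Ω : Set (EuclideanSpace ℝ (Fin n))} (hΩ : IsOpen Ω)
    {μ₁ μ₂ : Measure (EuclideanSpace ℝ (Fin n))}
    {σ₁ σ₂ : EuclideanSpace ℝ (Fin n) → EuclideanSpace ℝ (Fin n)}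
    (h₁ : IsVariationPair n f Ω μ₁ σ₁) (h₂ : IsVariationPair n f Ω μ₂ σ₂) : μ₁ = μ₂ := by
  obtain ⟨f1, z1, m1, n1, e1⟩ := h₁
  obtain ⟨f2, z2, m2, n2, e2⟩ := h₂
  set M := μ₁ + μ₂ with hM
  have fM : IsFiniteMeasure M := by rw [hM]; infer_instance
  have d1 : μ₁.HaveLebesgueDecomposition M := Measure.haveLebesgueDecomposition_of_finiteMeasure
  have d2 : μ₂.HaveLebesgueDecomposition M := Measure.haveLebesgueDecomposition_of_finiteMeasure
  have a1 : μ₁ ≪ M := Measure.AbsolutelyContinuous.rfl.add_right μ₂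
  have a2 : μ₂ ≪ M := by
    rw [hM, add_comm]; exact Measure.AbsolutelyContinuous.rfl.add_right μ₁
  have i1 : Integrable σ₁ μ₁ :=
    (integrable_const (1:ℝ)).mono' m1 (n1.mono fun x hx => by simp [hx])
  have i2 : Integrable σ₂ μ₂ :=
    (integrable_const (1:ℝ)).mono' m2 (n2.mono fun x hx => by simp [hx])
  have j1 : Integrable (fun x => (μ₁.rnDeriv M x).toReal • σ₁ x) M :=
    (integrable_rnDeriv_smul_iff a1).2 i1
  have j2 : Integrable (fun x => (μ₂.rnDeriv M x).toReal • σ₂ x) M :=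
    (integrable_rnDeriv_smul_iff a2).2 i2
  have key : ∀ i : Fin n, ∀ᵐ x ∂M, x ∈ Ω →
      ((μ₁.rnDeriv M x).toReal • σ₁ x - (μ₂.rnDeriv M x).toReal • σ₂ x) i = 0 := by
    intro i
    have h_int : Integrable (fun x =>
        ((μ₁.rnDeriv M x).toReal • σ₁ x - (μ₂.rnDeriv M x).toReal • σ₂ x) i) M :=
      (EuclideanSpace.proj (𝕜 := ℝ) i).integrable_comp (j1.sub j2)
    refine hΩ.ae_eq_zero_of_integral_contDiff_smul_eq_zero
      (h_int.locallyIntegrable.locallyIntegrableOn _) ?_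
    intro g g1 g2 g3
    have hb : ∃ C, ∀ x, ‖g x‖ ≤ C := g1.continuous.bounded_above_of_compact_support g2
    obtain ⟨C, hC⟩ := hb
    have hΦ1 : ContDiff ℝ 1 (fun x => g x • (EuclideanSpace.single i (1:ℝ))) :=
      (g1.of_le (by exact_mod_cast le_top)).smul contDiff_const
    have hΦ2 : HasCompactSupport (fun x => g x • (EuclideanSpace.single i (1:ℝ))) :=
      g2.smul_right
    have hΦ3 : tsupport (fun x => g x • (EuclideanSpace.single i (1:ℝ))) ⊆ Ω :=
      (tsupport_smul_subset_left _ _).trans g3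
    have E := (e1 _ hΦ1 hΦ2 hΦ3).symm.trans (e2 _ hΦ1 hΦ2 hΦ3)
    rw [neg_inj] at E
    have k1 := integral_rnDeriv_smul (f := fun x => ⟪g x • EuclideanSpace.single i (1:ℝ), σ₁ x⟫) a1
    have k2 := integral_rnDeriv_smul (f := fun x => ⟪g x • EuclideanSpace.single i (1:ℝ), σ₂ x⟫) a2
    have b1 : Integrable (fun x => (μ₁.rnDeriv M x).toReal •
        ⟪g x • EuclideanSpace.single i (1:ℝ), σ₁ x⟫) M := by
      have := ((EuclideanSpace.proj (𝕜 := ℝ) i).integrable_comp j1).bdd_mul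
        g1.continuous.aestronglyMeasurable (Eventually.of_forall hC)
      refine this.congr (Eventually.of_forall fun x => ?_)
      simp [real_inner_smul_left, EuclideanSpace.inner_single_left]; ring
    have b2 : Integrable (fun x => (μ₂.rnDeriv M x).toReal •
        ⟪g x • EuclideanSpace.single i (1:ℝ), σ₂ x⟫) M := by
      have := ((EuclideanSpace.proj (𝕜 := ℝ) i).integrable_comp j2).bdd_mul
        g1.continuous.aestronglyMeasurable (Eventually.of_forall hC)
      refine this.congr (Eventually.of_forall fun x => ?_)
      simp [real_inner_smul_left, EuclideanSpace.inner_single_left]; ring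
    rw [← k1, ← k2, ← sub_eq_zero, ← integral_sub b1 b2] at E
    rw [← E]
    refine integral_congr_ae (Eventually.of_forall fun x => ?_)
    simp [real_inner_smul_left, EuclideanSpace.inner_single_left]; ring
  have w1 := Measure.withDensity_rnDeriv_eq μ₁ M a1
  have w2 := Measure.withDensity_rnDeriv_eq μ₂ M a2
  have q1 : ∀ᵐ x ∂M, μ₁.rnDeriv M x ≠ 0 → ‖σ₁ x‖ = 1 := by
    rw [← ae_withDensity_iff (Measure.measurable_rnDeriv _ _), w1]; exact n1
  have q2 : ∀ᵐ x ∂M, μ₂.rnDeriv M x ≠ 0 → ‖σ₂ x‖ = 1 := by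
    rw [← ae_withDensity_iff (Measure.measurable_rnDeriv _ _), w2]; exact n2
  have hz : ∀ᵐ x ∂M, x ∈ Ω := by
    rw [ae_iff]; simp only [hM, Measure.add_apply]
    have : {a | a ∉ Ω} = Ωᶜ := rfl
    rw [this, z1, z2, add_zero]
  rw [← w1, ← w2]
  refine withDensity_congr_ae ?_
  filter_upwards [q1, q2, hz, ae_all_iff.2 key, Measure.rnDeriv_lt_top μ₁ M,
    Measure.rnDeriv_lt_top μ₂ M] with x x1 x2 x3 x4 x5 x6
  have hv : (μ₁.rnDeriv M x).toReal • σ₁ x = (μ₂.rnDeriv M x).toReal • σ₂ x := by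
    rw [← sub_eq_zero]; ext i; simpa using x4 i x3
  have l1 : ‖(μ₁.rnDeriv M x).toReal • σ₁ x‖ = (μ₁.rnDeriv M x).toReal := by
    by_cases h0 : μ₁.rnDeriv M x = 0
    · simp [h0]
    · simp [norm_smul, x1 h0]
  have l2 : ‖(μ₂.rnDeriv M x).toReal • σ₂ x‖ = (μ₂.rnDeriv M x).toReal := by
    by_cases h0 : μ₂.rnDeriv M x = 0
    · simp [h0]
    · simp [norm_smul, x2 h0]
  rw [← ENNReal.toReal_eq_toReal_iff' x5.ne x6.ne, ← l1, ← l2, hv]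

section

variable {n : ℕ} {f : EuclideanSpace ℝ (Fin n) → ℝ} {Ω : Set (EuclideanSpace ℝ (Fin n))}
  {μ : Measure (EuclideanSpace ℝ (Fin n))}
  {σ : EuclideanSpace ℝ (Fin n) → EuclideanSpace ℝ (Fin n)}

theorem IsVariationPair.absVar_eq (hΩ : IsOpen Ω) (h : IsVariationPair n f Ω μ σ) :
    absVar n f Ω = volume.withDensity (μ.rnDeriv volume) Ω := by
  have hex : ∃ p : Measure (EuclideanSpace ℝ (Fin n)) ×
      (EuclideanSpace ℝ (Fin n) → EuclideanSpace ℝ (Fin n)),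
      IsVariationPair n f Ω p.1 p.2 := ⟨(μ, σ), h⟩
  rw [absVar, dif_pos hex, hex.choose_spec.measure_eq hΩ h]

theorem IsVariationPair.cantorVar_eq (hΩ : IsOpen Ω) (h : IsVariationPair n f Ω μ σ) :
    cantorVar n f Ω = μ.singularPart volume (Ω \ approxDiscontSet n f) := by
  have hex : ∃ p : Measure (EuclideanSpace ℝ (Fin n)) ×
      (EuclideanSpace ℝ (Fin n) → EuclideanSpace ℝ (Fin n)),
      IsVariationPair n f Ω p.1 p.2 := ⟨(μ, σ), h⟩
  rw [cantorVar, dif_pos hex, hex.choose_spec.measure_eq hΩ h]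

theorem IsVariationPair.jumpVar_eq (hΩ : IsOpen Ω) (h : IsVariationPair n f Ω μ σ) :
    jumpVar n f Ω = μ.singularPart volume (jumpSet n f ∩ Ω) := by
  have hex : ∃ p : Measure (EuclideanSpace ℝ (Fin n)) ×
      (EuclideanSpace ℝ (Fin n) → EuclideanSpace ℝ (Fin n)),
      IsVariationPair n f Ω p.1 p.2 := ⟨(μ, σ), h⟩
  rw [jumpVar, dif_pos hex, hex.choose_spec.measure_eq hΩ h]

theorem IsVariationPair.hasGradMeasure (h : IsVariationPair n f Ω μ σ) :
    HasGradMeasure n f Ω μ σ := h.2.2.2.2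

theorem IsVariationPair.integrable (h : IsVariationPair n f Ω μ σ) : Integrable σ μ :=
  haveI := h.1
  (integrable_const (1:ℝ)).mono' h.2.2.1 (h.2.2.2.1.mono fun x hx => by simp [hx])

end

section RieszDecomposition

open scoped CompactlySupported NNReal

variable {X : Type*} [TopologicalSpace X]

/-- The positive part of a linear functional on compactly supported functions. -/
def posPartFunctional (Λ : C_c(X, ℝ) →ₗ[ℝ] ℝ) (h : C_c(X, ℝ)) : ℝ :=
  sSup (Λ '' {φ | 0 ≤ φ ∧ φ ≤ h})

theorem bddAbove_posPart {Λ : C_c(X, ℝ) →ₗ[ℝ] ℝ} {C : ℝ}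
    (hΛ : ∀ φ : C_c(X, ℝ), ∀ M : ℝ, (∀ x, |φ x| ≤ M) → Λ φ ≤ C * M) (h : C_c(X, ℝ)) :
    BddAbove (Λ '' {φ | 0 ≤ φ ∧ φ ≤ h}) := by
  obtain ⟨M, hM⟩ := h.continuous.bounded_above_of_compact_support h.hasCompactSupport
  refine ⟨C * M, ?_⟩
  rintro _ ⟨φ, ⟨h0, h1⟩, rfl⟩
  refine hΛ φ M fun x => ?_
  rw [abs_of_nonneg (h0 x)]
  exact (h1 x).trans ((le_abs_self _).trans (hM x))

theorem le_posPartFunctional {Λ : C_c(X, ℝ) →ₗ[ℝ] ℝ} {C : ℝ}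
    (hΛ : ∀ φ : C_c(X, ℝ), ∀ M : ℝ, (∀ x, |φ x| ≤ M) → Λ φ ≤ C * M) {h φ : C_c(X, ℝ)}
    (h0 : 0 ≤ φ) (h1 : φ ≤ h) : Λ φ ≤ posPartFunctional Λ h :=
  le_csSup (bddAbove_posPart hΛ h) ⟨φ, ⟨h0, h1⟩, rfl⟩

theorem posPartFunctional_le {Λ : C_c(X, ℝ) →ₗ[ℝ] ℝ} {h : C_c(X, ℝ)} (h0 : 0 ≤ h) {a : ℝ}
    (H : ∀ φ : C_c(X, ℝ), 0 ≤ φ → φ ≤ h → Λ φ ≤ a) : posPartFunctional Λ h ≤ a := by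
  refine csSup_le ⟨Λ 0, 0, ⟨le_rfl, h0⟩, rfl⟩ ?_
  rintro _ ⟨φ, ⟨h0, h1⟩, rfl⟩
  exact H φ h0 h1

theorem posPartFunctional_nonneg {Λ : C_c(X, ℝ) →ₗ[ℝ] ℝ} {C : ℝ}
    (hΛ : ∀ φ : C_c(X, ℝ), ∀ M : ℝ, (∀ x, |φ x| ≤ M) → Λ φ ≤ C * M) {h : C_c(X, ℝ)}
    (h0 : 0 ≤ h) : 0 ≤ posPartFunctional Λ h := by
  simpa using le_posPartFunctional hΛ le_rfl h0

theorem posPartFunctional_add {Λ : C_c(X, ℝ) →ₗ[ℝ] ℝ} {C : ℝ}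
    (hΛ : ∀ φ : C_c(X, ℝ), ∀ M : ℝ, (∀ x, |φ x| ≤ M) → Λ φ ≤ C * M) {h k : C_c(X, ℝ)}
    (h0 : 0 ≤ h) (k0 : 0 ≤ k) :
    posPartFunctional Λ (h + k) = posPartFunctional Λ h + posPartFunctional Λ k := by
  have hk : 0 ≤ h + k := fun x => add_nonneg (h0 x) (k0 x)
  apply le_antisymm
  · refine posPartFunctional_le hk fun φ p0 p1 => ?_
    have e : φ = (φ ⊓ h) + (φ - φ ⊓ h) := by ext x; simp
    rw [e, map_add]
    refine add_le_add (le_posPartFunctional hΛ ?_ inf_le_right) (le_posPartFunctional hΛ ?_ ?_)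
    · exact le_inf p0 h0
    · intro x; simp
    · intro x
      have p1x : φ x ≤ h x + k x := p1 x
      have k0x : 0 ≤ k x := k0 x
      simp only [CompactlySupportedContinuousMap.coe_sub, Pi.sub_apply,
        CompactlySupportedContinuousMap.inf_apply]
      rcases le_total (φ x) (h x) with H | H
      · rw [inf_eq_left.2 H]; linarith
      · rw [inf_eq_right.2 H]; linarith
  · rw [← le_sub_iff_add_le]
    refine posPartFunctional_le h0 fun φ p0 p1 => ?_
    rw [le_sub_comm]
    refine posPartFunctional_le k0 fun ψ q0 q1 => ?_
    rw [le_sub_iff_add_le, ← map_add]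
    exact le_posPartFunctional hΛ (fun x => add_nonneg (q0 x) (p0 x))
      (fun x => by
        have a := q1 x
        have b := p1 x
        show ψ x + φ x ≤ h x + k x
        linarith)

theorem posPartFunctional_smul {Λ : C_c(X, ℝ) →ₗ[ℝ] ℝ} {C : ℝ}
    (hΛ : ∀ φ : C_c(X, ℝ), ∀ M : ℝ, (∀ x, |φ x| ≤ M) → Λ φ ≤ C * M) {h : C_c(X, ℝ)}
    (h0 : 0 ≤ h) {c : ℝ} (hc : 0 ≤ c) :
    posPartFunctional Λ (c • h) = c * posPartFunctional Λ h := by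
  have key : ∀ {c : ℝ} {h : C_c(X, ℝ)}, 0 ≤ h → 0 < c →
      posPartFunctional Λ (c • h) ≤ c * posPartFunctional Λ h := by
    intro c h h0 hc
    refine posPartFunctional_le (fun x => mul_nonneg hc.le (h0 x)) fun φ p0 p1 => ?_
    have : Λ (c⁻¹ • φ) ≤ posPartFunctional Λ h := by
      refine le_posPartFunctional hΛ (fun x => mul_nonneg (inv_nonneg.2 hc.le) (p0 x)) fun x => ?_
      have := p1 x
      simp only [CompactlySupportedContinuousMap.coe_smul, Pi.smul_apply, smul_eq_mul] at this ⊢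
      rwa [inv_mul_le_iff₀ hc]
    rwa [map_smul, smul_eq_mul, inv_mul_le_iff₀ hc] at this
  rcases hc.eq_or_lt with rfl | hc
  · rw [zero_smul, zero_mul]
    apply le_antisymm
    · refine posPartFunctional_le le_rfl fun φ p0 p1 => ?_
      rw [le_antisymm p1 p0]; simp
    · exact posPartFunctional_nonneg hΛ le_rfl
  · refine le_antisymm (key h0 hc) ?_
    have := key (c := c⁻¹) (h := c • h) (fun x => mul_nonneg hc.le (h0 x)) (inv_pos.2 hc)
    rw [smul_smul, inv_mul_cancel₀ hc.ne', one_smul] at this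
    rwa [← le_inv_mul_iff₀ hc]

/-- The linear functional on nonnegative functions associated with an additive, positively
homogeneous and nonnegative function. -/
def nnrealFunctional (q : C_c(X, ℝ) → ℝ) (h0 : ∀ h, 0 ≤ h → 0 ≤ q h)
    (hadd : ∀ h k, 0 ≤ h → 0 ≤ k → q (h + k) = q h + q k)
    (hsmul : ∀ (c : ℝ) h, 0 ≤ c → 0 ≤ h → q (c • h) = c * q h) : C_c(X, ℝ≥0) →ₗ[ℝ≥0] ℝ≥0 where
  toFun h := ⟨q h.toReal, h0 _ CompactlySupportedContinuousMap.toReal_nonneg⟩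
  map_add' h k := by
    ext
    simp only [CompactlySupportedContinuousMap.toReal_add]
    exact hadd _ _ CompactlySupportedContinuousMap.toReal_nonneg
      CompactlySupportedContinuousMap.toReal_nonneg
  map_smul' c h := by
    ext
    simp only [CompactlySupportedContinuousMap.toReal_smul]
    exact hsmul c _ c.2 CompactlySupportedContinuousMap.toReal_nonneg

variable [T2Space X] [LocallyCompactSpace X] [MeasurableSpace X] [BorelSpace X]

theorem rieszMeasure_univ_le (Θ : C_c(X, ℝ≥0) →ₗ[ℝ≥0] ℝ≥0) {C : ℝ≥0}
    (hΘ : ∀ h : C_c(X, ℝ≥0), (∀ x, h x ≤ 1) → Θ h ≤ C) :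
    NNRealRMK.rieszMeasure Θ Set.univ ≤ C := by
  rw [isOpen_univ.measure_eq_iSup_isCompact]
  refine iSup_le fun K => iSup_le fun _ => iSup_le fun hK => ?_
  obtain ⟨f, f1, -, f3, f4⟩ := exists_continuous_one_zero_of_isCompact hK isClosed_empty
    (Set.disjoint_empty K)
  let φ : C_c(X, ℝ) := ⟨f, f3⟩
  have hle : ∀ x, φ.nnrealPart x ≤ 1 := fun x => by
    show Real.toNNReal (f x) ≤ 1
    simpa using (f4 x).2
  calc NNRealRMK.rieszMeasure Θ K = ∫⁻ x in K, 1 ∂(NNRealRMK.rieszMeasure Θ) := by simp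
    _ ≤ ∫⁻ x in K, (φ.nnrealPart x : ℝ≥0∞) ∂(NNRealRMK.rieszMeasure Θ) := by
        refine setLIntegral_mono' hK.measurableSet fun x hx => ?_
        have : f x = 1 := f1 hx
        show (1 : ℝ≥0∞) ≤ ((Real.toNNReal (f x) : ℝ≥0) : ℝ≥0∞)
        simp [this]
    _ ≤ ∫⁻ x, (φ.nnrealPart x : ℝ≥0∞) ∂(NNRealRMK.rieszMeasure Θ) := setLIntegral_le_lintegral _ _
    _ = Θ φ.nnrealPart := NNRealRMK.lintegral_rieszMeasure _ _
    _ ≤ C := by exact_mod_cast hΘ _ hle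

theorem exists_measure_sub_measure {Λ : C_c(X, ℝ) →ₗ[ℝ] ℝ} {C : ℝ} (hC : 0 ≤ C)
    (hΛ : ∀ φ : C_c(X, ℝ), ∀ M : ℝ, (∀ x, |φ x| ≤ M) → Λ φ ≤ C * M) :
    ∃ P N : Measure X, P Set.univ ≤ ENNReal.ofReal C ∧ N Set.univ ≤ ENNReal.ofReal (2 * C) ∧
      ∀ φ : C_c(X, ℝ), Λ φ = ∫ x, φ x ∂P - ∫ x, φ x ∂N := by
  let ΘP := nnrealFunctional (posPartFunctional Λ) (fun h h0 => posPartFunctional_nonneg hΛ h0)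
    (fun h k h0 k0 => posPartFunctional_add hΛ h0 k0)
    (fun c h hc h0 => posPartFunctional_smul hΛ h0 hc)
  let ΘN := nnrealFunctional (fun h => posPartFunctional Λ h - Λ h)
    (fun h h0 => sub_nonneg.2 (le_posPartFunctional hΛ h0 le_rfl))
    (fun h k h0 k0 => by rw [posPartFunctional_add hΛ h0 k0, map_add]; ring)
    (fun c h hc h0 => by rw [posPartFunctional_smul hΛ h0 hc, map_smul, smul_eq_mul]; ring)
  have bP : ∀ h : C_c(X, ℝ≥0), (∀ x, h x ≤ 1) → posPartFunctional Λ h.toReal ≤ C := by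
    intro h h1
    refine posPartFunctional_le CompactlySupportedContinuousMap.toReal_nonneg fun φ p0 p1 => ?_
    have := hΛ φ 1 fun x => by
      rw [abs_of_nonneg (p0 x)]
      refine (p1 x).trans ?_
      simpa using h1 x
    simpa using this
  refine ⟨NNRealRMK.rieszMeasure ΘP, NNRealRMK.rieszMeasure ΘN, ?_, ?_, ?_⟩
  · refine rieszMeasure_univ_le ΘP (C := C.toNNReal) fun h h1 => ?_
    rw [← NNReal.coe_le_coe, Real.coe_toNNReal _ hC]
    exact bP h h1
  · refine rieszMeasure_univ_le ΘN (C := (2 * C).toNNReal) fun h h1 => ?_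
    rw [← NNReal.coe_le_coe, Real.coe_toNNReal _ (by positivity)]
    show posPartFunctional Λ h.toReal - Λ h.toReal ≤ 2 * C
    have h2 := hΛ (-h.toReal) 1 fun x => by simpa using h1 x
    rw [map_neg] at h2
    linarith [bP h h1]
  · have key : ∀ h : C_c(X, ℝ≥0), Λ h.toReal = ∫ x, (h x : ℝ) ∂(NNRealRMK.rieszMeasure ΘP) -
        ∫ x, (h x : ℝ) ∂(NNRealRMK.rieszMeasure ΘN) := by
      intro h
      rw [NNRealRMK.integral_rieszMeasure, NNRealRMK.integral_rieszMeasure]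
      show Λ h.toReal = posPartFunctional Λ h.toReal - (posPartFunctional Λ h.toReal - Λ h.toReal)
      ring
    intro φ
    have e := φ.nnrealPart_sub_nnrealPart_neg
    have hi : ∀ h : C_c(X, ℝ≥0), ∀ ν : Measure X, ν.Regular →
        Integrable (fun x => (h x : ℝ)) ν := fun h ν _ =>
      h.toReal.integrable.congr (Eventually.of_forall fun x => by simp)
    have e' : ∀ x, φ x = (φ.nnrealPart x : ℝ) - ((-φ).nnrealPart x : ℝ) := fun x => by
      conv_lhs => rw [← e]
      simp
    have i2 : ∀ ν : Measure X, ν.Regular → ∫ x, φ x ∂ν =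
        ∫ x, (φ.nnrealPart x : ℝ) ∂ν - ∫ x, ((-φ).nnrealPart x : ℝ) ∂ν := by
      intro ν hν
      rw [← integral_sub (hi _ ν hν) (hi _ ν hν)]
      exact integral_congr_ae (Eventually.of_forall e')
    rw [i2 _ inferInstance, i2 _ inferInstance]
    conv_lhs => rw [← e, map_sub, key, key]
    ring

end RieszDecomposition

section RieszVector

open scoped CompactlySupported NNReal BoundedContinuousFunction

variable {n : ℕ}

theorem vdiv_smul_single {φ : EuclideanSpace ℝ (Fin n) → ℝ} (hφ : ContDiff ℝ 1 φ) (i : Fin n)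
    (x : EuclideanSpace ℝ (Fin n)) :
    vdiv n (fun y => φ y • EuclideanSpace.single i (1:ℝ)) x =
      fderiv ℝ φ x (EuclideanSpace.single i 1) := by
  have h : fderiv ℝ (fun y => φ y • EuclideanSpace.single i (1:ℝ)) x =
      (fderiv ℝ φ x).smulRight (EuclideanSpace.single i (1:ℝ)) :=
    ((hφ.differentiable one_ne_zero x).hasFDerivAt.smul_const _).fderiv
  unfold vdiv
  rw [h, Finset.sum_eq_single i]
  · simp
  · intro j _ hj
    simp [hj]
  · simp

theorem vdiv_eq_sum {Φ : EuclideanSpace ℝ (Fin n) → EuclideanSpace ℝ (Fin n)}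
    {x : EuclideanSpace ℝ (Fin n)} (hΦ : DifferentiableAt ℝ Φ x) :
    vdiv n Φ x = ∑ i, fderiv ℝ (fun y => Φ y i) x (EuclideanSpace.single i 1) := by
  unfold vdiv
  refine Finset.sum_congr rfl fun i _ => ?_
  have h : fderiv ℝ (fun y => Φ y i) x = (EuclideanSpace.proj (𝕜 := ℝ) i).comp (fderiv ℝ Φ x) :=
    ((EuclideanSpace.proj i : EuclideanSpace ℝ (Fin n) →L[ℝ] ℝ).hasFDerivAt.comp x
      hΦ.hasFDerivAt).fderiv
  rw [h]; rfl

theorem integrableOn_mul_fderiv {f φ : EuclideanSpace ℝ (Fin n) → ℝ}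
    {Ω : Set (EuclideanSpace ℝ (Fin n))} (hf : IntegrableOn f Ω) (h1 : ContDiff ℝ 1 φ)
    (h2 : HasCompactSupport φ) (v : EuclideanSpace ℝ (Fin n)) :
    IntegrableOn (fun x => f x * fderiv ℝ φ x v) Ω := by
  have hc : Continuous (fun x => fderiv ℝ φ x v) :=
    (h1.continuous_fderiv one_ne_zero).clm_apply continuous_const
  obtain ⟨C, hC⟩ := hc.bounded_above_of_compact_support (h2.fderiv_apply (𝕜 := ℝ) v)
  exact Integrable.mul_bdd hf hc.aestronglyMeasurable (Eventually.of_forall hC)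

/-- The space of `C¹` functions with compact support in `Ω`. -/
def testSubmodule (Ω : Set (EuclideanSpace ℝ (Fin n))) :
    Submodule ℝ (EuclideanSpace ℝ (Fin n) →ᵇ ℝ) where
  carrier := {φ | ContDiff ℝ 1 φ ∧ HasCompactSupport φ ∧ tsupport φ ⊆ Ω}
  add_mem' {a b} ha hb := ⟨ha.1.add hb.1, ha.2.1.add hb.2.1,
    (tsupport_add _ _).trans (Set.union_subset ha.2.2 hb.2.2)⟩
  zero_mem' := ⟨contDiff_const, HasCompactSupport.zero, by simp [tsupport]⟩
  smul_mem' c a ha := ⟨contDiff_const.smul ha.1, ha.2.1.smul_left (f := fun _ => c),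
    (tsupport_smul_subset_right (fun _ => c) _).trans ha.2.2⟩

theorem exists_measure_sub_measure_partial {f : EuclideanSpace ℝ (Fin n) → ℝ}
    {Ω : Set (EuclideanSpace ℝ (Fin n))} (hf : IntegrableOn f Ω) {V : ℝ} (hV : 0 ≤ V) (i : Fin n)
    (H : ∀ φ : EuclideanSpace ℝ (Fin n) → ℝ, ContDiff ℝ 1 φ → HasCompactSupport φ →
      tsupport φ ⊆ Ω → (∀ x, |φ x| ≤ 1) →
      ∫ x in Ω, f x * fderiv ℝ φ x (EuclideanSpace.single i 1) ≤ V) :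
    ∃ P N : Measure (EuclideanSpace ℝ (Fin n)), P Set.univ ≤ ENNReal.ofReal V ∧
      N Set.univ ≤ ENNReal.ofReal (2 * V) ∧
      ∀ φ : EuclideanSpace ℝ (Fin n) → ℝ, ContDiff ℝ 1 φ → HasCompactSupport φ →
      tsupport φ ⊆ Ω → ∫ x in Ω, f x * fderiv ℝ φ x (EuclideanSpace.single i 1) =
        ∫ x, φ x ∂P - ∫ x, φ x ∂N := by
  have hlin : ∀ (φ : EuclideanSpace ℝ (Fin n) → ℝ) (c : ℝ), ContDiff ℝ 1 φ →
      ∫ x in Ω, f x * fderiv ℝ (c • φ) x (EuclideanSpace.single i 1) =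
        c * ∫ x in Ω, f x * fderiv ℝ φ x (EuclideanSpace.single i 1) := by
    intro φ c h1
    rw [← integral_const_mul]
    congr 1; ext x
    rw [fderiv_const_smul (h1.differentiable one_ne_zero x)]
    simp; ring
  let ℓ : testSubmodule Ω →ₗ[ℝ] ℝ :=
    { toFun := fun φ => ∫ x in Ω, f x * fderiv ℝ φ x (EuclideanSpace.single i 1)
      map_add' := by
        rintro ⟨a, a1, a2, a3⟩ ⟨b, b1, b2, b3⟩
        rw [← integral_add (integrableOn_mul_fderiv hf a1 a2 _)
          (integrableOn_mul_fderiv hf b1 b2 _)]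
        congr 1; ext x
        have : fderiv ℝ (⇑(a + b)) x = fderiv ℝ a x + fderiv ℝ b x :=
          fderiv_add (a1.differentiable one_ne_zero x) (b1.differentiable one_ne_zero x)
        show f x * fderiv ℝ (⇑(a + b)) x _ = _
        rw [this]; simp; ring
      map_smul' := by
        rintro c ⟨a, a1, a2, a3⟩
        exact hlin a c a1 }
  have hℓ : ∀ φ : testSubmodule Ω, ‖ℓ φ‖ ≤ V * ‖φ‖ := by
    have key : ∀ φ : testSubmodule Ω, ℓ φ ≤ V * ‖φ‖ := by
      rintro ⟨φ, h1, h2, h3⟩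
      show ∫ x in Ω, f x * fderiv ℝ φ x (EuclideanSpace.single i 1) ≤ V * ‖φ‖
      by_cases h0 : φ = 0
      · have : (⇑φ) = fun _ => (0:ℝ) := by rw [h0]; rfl
        rw [this, h0]
        simp
      · have hp : 0 < ‖φ‖ := norm_pos_iff.2 h0
        have := H (‖φ‖⁻¹ • ⇑φ) (contDiff_const.smul h1) (h2.smul_left (f := fun _ => ‖φ‖⁻¹))
          ((tsupport_smul_subset_right (fun _ => ‖φ‖⁻¹) _).trans h3) (fun x => by
            simp only [Pi.smul_apply, smul_eq_mul, abs_mul, abs_inv, abs_norm]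
            rw [inv_mul_le_iff₀ hp, mul_one]
            exact φ.norm_coe_le_norm x)
        rw [hlin _ _ h1, inv_mul_le_iff₀ hp] at this
        linarith
    intro φ
    rw [Real.norm_eq_abs, abs_le']
    refine ⟨key φ, ?_⟩
    have e : ℓ (-φ) = -ℓ φ := ℓ.map_neg φ
    rw [← e, ← norm_neg φ]
    exact key (-φ)
  obtain ⟨L, hL1, hL2⟩ := exists_extension_norm_eq (testSubmodule Ω) (ℓ.mkContinuous V hℓ)
  have hLn : ‖L‖ ≤ V := hL2 ▸ LinearMap.mkContinuous_norm_le _ hV _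
  let Λ : C_c(EuclideanSpace ℝ (Fin n), ℝ) →ₗ[ℝ] ℝ :=
    { toFun := fun φ => L φ.toBoundedContinuousFunction
      map_add' := fun a b => by rw [← map_add]; rfl
      map_smul' := fun c a => by
        rw [RingHom.id_apply, ← map_smul]; rfl }
  obtain ⟨P, N, hP, hN, hPN⟩ := exists_measure_sub_measure (Λ := Λ) hV (fun φ M hM => by
    have hM0 : 0 ≤ M := (abs_nonneg _).trans (hM 0)
    calc Λ φ ≤ ‖L φ.toBoundedContinuousFunction‖ := le_abs_self _
      _ ≤ ‖L‖ * ‖φ.toBoundedContinuousFunction‖ := L.le_opNorm _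
      _ ≤ V * M := by
        refine mul_le_mul hLn ?_ (norm_nonneg _) hV
        exact (BoundedContinuousFunction.norm_le hM0).2 hM)
  refine ⟨P, N, hP, hN, fun φ h1 h2 h3 => ?_⟩
  let ψ : C_c(EuclideanSpace ℝ (Fin n), ℝ) := ⟨⟨φ, h1.continuous⟩, h2⟩
  rw [← show (∫ x, ψ x ∂P) - ∫ x, ψ x ∂N = ∫ x, φ x ∂P - ∫ x, φ x ∂N from rfl, ← hPN ψ]
  exact (hL1 ⟨ψ.toBoundedContinuousFunction, h1, h2, h3⟩).symm

theorem euclidean_norm_le_sum (v : EuclideanSpace ℝ (Fin n)) : ‖v‖ ≤ ∑ i, |v i| := by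
  have : v = ∑ i, v i • EuclideanSpace.single i (1:ℝ) := by
    ext j; simp [Finset.sum_apply, Pi.single_apply]
  conv_lhs => rw [this]
  refine (norm_sum_le _ _).trans (Finset.sum_le_sum fun i _ => ?_)
  simp [norm_smul]

theorem exists_isVariationPair_of_le {f : EuclideanSpace ℝ (Fin n) → ℝ}
    {Ω : Set (EuclideanSpace ℝ (Fin n))} (hΩ : IsOpen Ω) (hf : IntegrableOn f Ω) {V : ℝ}
    (hV : 0 ≤ V)
    (H : ∀ Φ : EuclideanSpace ℝ (Fin n) → EuclideanSpace ℝ (Fin n), ContDiff ℝ 1 Φ →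
      HasCompactSupport Φ → tsupport Φ ⊆ Ω → (∀ x, ‖Φ x‖ ≤ 1) →
      ∫ x in Ω, f x * vdiv n Φ x ≤ V) :
    ∃ (μ : Measure (EuclideanSpace ℝ (Fin n)))
      (σ : EuclideanSpace ℝ (Fin n) → EuclideanSpace ℝ (Fin n)),
      IsVariationPair n f Ω μ σ ∧ μ Set.univ ≤ n * ENNReal.ofReal (3 * V) := by
  have ex : ∀ i : Fin n, ∃ P N : Measure (EuclideanSpace ℝ (Fin n)),
      P Set.univ ≤ ENNReal.ofReal V ∧ N Set.univ ≤ ENNReal.ofReal (2 * V) ∧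
      ∀ φ : EuclideanSpace ℝ (Fin n) → ℝ, ContDiff ℝ 1 φ → HasCompactSupport φ →
      tsupport φ ⊆ Ω → ∫ x in Ω, f x * fderiv ℝ φ x (EuclideanSpace.single i 1) =
        ∫ x, φ x ∂P - ∫ x, φ x ∂N := by
    intro i
    refine exists_measure_sub_measure_partial hf hV i fun φ h1 h2 h3 h4 => ?_
    have := H (fun y => φ y • EuclideanSpace.single i (1:ℝ)) (h1.smul contDiff_const)
      h2.smul_right ((tsupport_smul_subset_left _ _).trans h3)
      (fun x => by simpa [norm_smul] using h4 x)
    simpa only [vdiv_smul_single h1] using this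
  choose P N hP hN hPN using ex
  have fP : ∀ i, IsFiniteMeasure (P i) := fun i => ⟨(hP i).trans_lt ENNReal.ofReal_lt_top⟩
  have fN : ∀ i, IsFiniteMeasure (N i) := fun i => ⟨(hN i).trans_lt ENNReal.ofReal_lt_top⟩
  set M : Measure (EuclideanSpace ℝ (Fin n)) := (∑ i, (P i + N i)).restrict Ω with hM
  have fM : IsFiniteMeasure M := by rw [hM]; infer_instance
  have leM : ∀ i, P i + N i ≤ ∑ i, (P i + N i) := fun i =>
    Finset.single_le_sum (f := fun i => P i + N i) (fun _ _ => Measure.zero_le _)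
      (Finset.mem_univ i)
  have aP : ∀ i, (P i).restrict Ω ≪ M := fun i => by
    refine (Measure.restrict_mono le_rfl (le_trans ?_ (leM i))).absolutelyContinuous
    exact le_add_of_nonneg_right (Measure.zero_le _)
  have aN : ∀ i, (N i).restrict Ω ≪ M := fun i => by
    refine (Measure.restrict_mono le_rfl (le_trans ?_ (leM i))).absolutelyContinuous
    exact le_add_of_nonneg_left (Measure.zero_le _)
  have dP : ∀ i, ((P i).restrict Ω).HaveLebesgueDecomposition M := fun i =>
    Measure.haveLebesgueDecomposition_of_finiteMeasure
  have dN : ∀ i, ((N i).restrict Ω).HaveLebesgueDecomposition M := fun i =>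
    Measure.haveLebesgueDecomposition_of_finiteMeasure
  set p : Fin n → EuclideanSpace ℝ (Fin n) → ℝ≥0∞ := fun i => ((P i).restrict Ω).rnDeriv M with hp
  set q : Fin n → EuclideanSpace ℝ (Fin n) → ℝ≥0∞ := fun i => ((N i).restrict Ω).rnDeriv M with hq
  have mp : ∀ i, Measurable (p i) := fun i => Measure.measurable_rnDeriv _ _
  have mq : ∀ i, Measurable (q i) := fun i => Measure.measurable_rnDeriv _ _
  let τ : EuclideanSpace ℝ (Fin n) → EuclideanSpace ℝ (Fin n) := fun x =>
    WithLp.toLp 2 (fun i => (q i x).toReal - (p i x).toReal)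
  have mτ : Measurable τ := by
    refine (WithLp.measurable_toLp 2 _).comp ?_
    exact measurable_pi_lambda _ fun i => (mq i).ennreal_toReal.sub (mp i).ennreal_toReal
  have lP : ∀ i, ∫⁻ x, p i x ∂M = P i Ω := fun i => by
    rw [hp]; dsimp only
    rw [Measure.lintegral_rnDeriv (aP i), Measure.restrict_apply_univ]
  have lN : ∀ i, ∫⁻ x, q i x ∂M = N i Ω := fun i => by
    rw [hq]; dsimp only
    rw [Measure.lintegral_rnDeriv (aN i), Measure.restrict_apply_univ]
  have hmass : ∫⁻ x, ‖τ x‖ₑ ∂M ≤ n * ENNReal.ofReal (3 * V) := by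
    calc ∫⁻ x, ‖τ x‖ₑ ∂M ≤ ∫⁻ x, ∑ i, (q i x + p i x) ∂M := by
          refine lintegral_mono_ae ?_
          filter_upwards [ae_all_iff.2 fun i => Measure.rnDeriv_lt_top ((P i).restrict Ω) M,
            ae_all_iff.2 fun i => Measure.rnDeriv_lt_top ((N i).restrict Ω) M] with x x1 x2
          have h1 : ‖τ x‖ ≤ ∑ i, ((q i x).toReal + (p i x).toReal) := by
            refine (euclidean_norm_le_sum _).trans (Finset.sum_le_sum fun i _ => ?_)
            show |(q i x).toReal - (p i x).toReal| ≤ _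
            have a : 0 ≤ (q i x).toReal := ENNReal.toReal_nonneg
            have b : 0 ≤ (p i x).toReal := ENNReal.toReal_nonneg
            rw [abs_le]; constructor <;> linarith
          have h2 : ∑ i, (q i x + p i x) =
              ENNReal.ofReal (∑ i, ((q i x).toReal + (p i x).toReal)) := by
            rw [ENNReal.ofReal_sum_of_nonneg (fun i _ => by positivity)]
            refine Finset.sum_congr rfl fun i _ => ?_
            rw [ENNReal.ofReal_add ENNReal.toReal_nonneg ENNReal.toReal_nonneg,
              ENNReal.ofReal_toReal (x1 i).ne, ENNReal.ofReal_toReal (x2 i).ne]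
          rw [h2, ← ofReal_norm]
          exact ENNReal.ofReal_le_ofReal h1
      _ = ∑ i, (N i Ω + P i Ω) := by
          rw [lintegral_finsetSum (f := fun i x => q i x + p i x) _ fun i _ => (mq i).add (mp i)]
          refine Finset.sum_congr rfl fun i _ => ?_
          rw [lintegral_add_left (mq i), lP, lN]
      _ ≤ ∑ _i : Fin n, ENNReal.ofReal (3 * V) := by
          refine Finset.sum_le_sum fun i _ => ?_
          calc N i Ω + P i Ω ≤ ENNReal.ofReal (2 * V) + ENNReal.ofReal V :=
                add_le_add ((measure_mono (Set.subset_univ _)).trans (hN i))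
                  ((measure_mono (Set.subset_univ _)).trans (hP i))
            _ = ENNReal.ofReal (3 * V) := by
                rw [← ENNReal.ofReal_add (by positivity) hV]; congr 1; ring
      _ = n * ENNReal.ofReal (3 * V) := by simp
  have iτ : Integrable τ M := ⟨mτ.aestronglyMeasurable, hmass.trans_lt
    (ENNReal.mul_lt_top (ENNReal.natCast_lt_top n) ENNReal.ofReal_lt_top)⟩
  have hG : HasGradMeasure n f Ω M τ := by
    intro Φ h1 h2 h3
    have c1 : ∀ i, ContDiff ℝ 1 (fun y => Φ y i) := fun i =>
      (EuclideanSpace.proj i : EuclideanSpace ℝ (Fin n) →L[ℝ] ℝ).contDiff.comp h1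
    have sub : ∀ i, Function.support (fun y => Φ y i) ⊆ Function.support Φ := fun i y hy h0 =>
      hy (by simp [h0])
    have c2 : ∀ i, HasCompactSupport (fun y => Φ y i) := fun i => h2.mono (sub i)
    have c3 : ∀ i, tsupport (fun y => Φ y i) ⊆ Ω := fun i =>
      (closure_mono (sub i)).trans h3
    have e1 : ∫ x in Ω, f x * vdiv n Φ x =
        ∑ i, ∫ x in Ω, f x * fderiv ℝ (fun y => Φ y i) x (EuclideanSpace.single i 1) := by
      rw [← integral_finsetSum _ fun i _ => integrableOn_mul_fderiv hf (c1 i) (c2 i) _]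
      congr 1; ext x
      rw [vdiv_eq_sum (h1.differentiable one_ne_zero x), Finset.mul_sum]
    have bd : ∀ i, ∃ C, ∀ x, ‖Φ x i‖ ≤ C := fun i =>
      (c1 i).continuous.bounded_above_of_compact_support (c2 i)
    have iP : ∀ i (ν : Measure (EuclideanSpace ℝ (Fin n))), IsFiniteMeasure ν →
        Integrable (fun x => Φ x i) ν := fun i ν _ =>
      ((c1 i).continuous).integrable_of_hasCompactSupport (c2 i)
    have rP : ∀ i (ν : Measure (EuclideanSpace ℝ (Fin n))),
        ∫ x, Φ x i ∂ν = ∫ x in Ω, Φ x i ∂ν := fun i ν => by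
      refine (setIntegral_eq_integral_of_forall_compl_eq_zero fun x hx => ?_).symm
      exact image_eq_zero_of_notMem_tsupport (f := fun y => Φ y i) fun h => hx (c3 i h)
    have jP : ∀ i, Integrable (fun x => (p i x).toReal • Φ x i) M := fun i =>
      (integrable_rnDeriv_smul_iff (aP i)).2 (iP i _ inferInstance)
    have jN : ∀ i, Integrable (fun x => (q i x).toReal • Φ x i) M := fun i =>
      (integrable_rnDeriv_smul_iff (aN i)).2 (iP i _ inferInstance)
    rw [e1, ← integral_neg]
    have e2 : ∀ x, -⟪Φ x, τ x⟫ =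
        ∑ i, ((p i x).toReal • Φ x i - (q i x).toReal • Φ x i) := by
      intro x
      rw [PiLp.inner_apply, ← Finset.sum_neg_distrib]
      refine Finset.sum_congr rfl fun i _ => ?_
      show -(((q i x).toReal - (p i x).toReal) * Φ x i) = _
      simp only [smul_eq_mul]; ring
    simp_rw [e2]
    rw [integral_finsetSum (f := fun i x => (p i x).toReal • Φ x i - (q i x).toReal • Φ x i) _
      fun i _ => (jP i).sub (jN i)]
    refine Finset.sum_congr rfl fun i _ => ?_
    rw [hPN i _ (c1 i) (c2 i) (c3 i), integral_sub (jP i) (jN i), rP, rP i (N i)]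
    rw [integral_rnDeriv_smul (aP i), integral_rnDeriv_smul (aN i)]
  refine ⟨_, _, hG.isVariationPair ?_ iτ, ?_⟩
  · rw [hM, Measure.restrict_apply hΩ.measurableSet.compl]; simp
  · unfold normMeasure
    rw [withDensity_apply _ MeasurableSet.univ, Measure.restrict_univ]
    exact hmass

theorem IsBVOn.exists_isVariationPair {f : EuclideanSpace ℝ (Fin n) → ℝ}
    {Ω : Set (EuclideanSpace ℝ (Fin n))} (hΩ : IsOpen Ω) (hf : IsBVOn n f Ω) :
    ∃ (μ : Measure (EuclideanSpace ℝ (Fin n)))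
      (σ : EuclideanSpace ℝ (Fin n) → EuclideanSpace ℝ (Fin n)), IsVariationPair n f Ω μ σ := by
  obtain ⟨μ, σ, h, -⟩ := exists_isVariationPair_of_le hΩ hf.1 (V := (variation n f Ω).toReal)
    ENNReal.toReal_nonneg fun Φ h1 h2 h3 h4 => by
      rw [← ENNReal.ofReal_le_iff_le_toReal hf.2.ne]
      exact le_iSup_of_le Φ (le_iSup_of_le h1 (le_iSup_of_le h2 (le_iSup_of_le h3
        (le_iSup_of_le h4 le_rfl))))
  exact ⟨μ, σ, h⟩

theorem IsVariationPair.isBVOn {f : EuclideanSpace ℝ (Fin n) → ℝ}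
    {Ω : Set (EuclideanSpace ℝ (Fin n))} {μ : Measure (EuclideanSpace ℝ (Fin n))}
    {σ : EuclideanSpace ℝ (Fin n) → EuclideanSpace ℝ (Fin n)} (h : IsVariationPair n f Ω μ σ)
    (hf : IntegrableOn f Ω) : IsBVOn n f Ω := by
  have := h.1
  refine ⟨hf, lt_of_le_of_lt ?_ (measure_lt_top μ Set.univ)⟩
  refine iSup_le fun Φ => iSup_le fun h1 => iSup_le fun h2 => iSup_le fun h3 => iSup_le fun h4 => ?_
  rw [h.2.2.2.2 Φ h1 h2 h3]
  refine ENNReal.ofReal_le_of_le_toReal ?_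
  refine (neg_le_abs _).trans ?_
  have := norm_integral_le_of_norm_le_const (μ := μ) (f := fun x => ⟪Φ x, σ x⟫) (C := 1)
    (h.2.2.2.1.mono fun x hx => (norm_inner_le_norm _ _).trans (by
      rw [hx, mul_one]; exact h4 x))
  simpa [Measure.real] using this

end RieszVector

/-- The Euclidean space `ℝⁿ`. -/
abbrev Eu (n : ℕ) := EuclideanSpace ℝ (Fin n)

/-- The profile `t ↦ (t⁺)²`. -/
def sqPos (t : ℝ) : ℝ := (max 0 t) ^ 2

theorem sqPos_nonneg (t : ℝ) : 0 ≤ sqPos t := sq_nonneg _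

theorem sqPos_of_nonpos {t : ℝ} (ht : t ≤ 0) : sqPos t = 0 := by simp [sqPos, max_eq_left ht]

theorem sqPos_mono : Monotone sqPos := fun a b h => by
  unfold sqPos
  have : max 0 a ≤ max 0 b := max_le_max le_rfl h
  have : 0 ≤ max 0 a := le_max_left _ _
  gcongr

theorem continuous_sqPos : Continuous sqPos := by unfold sqPos; fun_prop

theorem sqPos_le_one {t : ℝ} (ht : t ≤ 1) : sqPos t ≤ 1 := by
  have := sqPos_mono ht
  simpa [sqPos] using this

theorem hasDerivAt_sqPos (t : ℝ) : HasDerivAt sqPos (2 * max 0 t) t := by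
  rcases lt_trichotomy t 0 with h | h | h
  · have : sqPos =ᶠ[𝓝 t] fun _ => 0 := by
      filter_upwards [Iio_mem_nhds h] with s hs using sqPos_of_nonpos hs.le
    rw [max_eq_left h.le, mul_zero]
    exact (hasDerivAt_const t (0:ℝ)).congr_of_eventuallyEq this
  · subst h
    rw [max_self, mul_zero, hasDerivAt_iff_isLittleO_nhds_zero]
    have : ∀ h : ℝ, sqPos (0 + h) - sqPos 0 - h • (0:ℝ) = sqPos h := by
      intro h; simp [sqPos]
    simp_rw [this]
    have h1 : (fun h : ℝ => sqPos h) =O[𝓝 0] fun h => h ^ 2 := by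
      refine Asymptotics.isBigO_of_le _ fun h => ?_
      rw [Real.norm_eq_abs, Real.norm_eq_abs, abs_of_nonneg (sqPos_nonneg h),
        abs_of_nonneg (sq_nonneg h)]
      unfold sqPos
      rcases le_total 0 h with h0 | h0
      · rw [max_eq_right h0]
      · rw [max_eq_left h0]; nlinarith [sq_nonneg h]
    exact h1.trans_isLittleO (Asymptotics.isLittleO_pow_id one_lt_two)
  · have : sqPos =ᶠ[𝓝 t] fun s => s ^ 2 := by
      filter_upwards [Ioi_mem_nhds h] with s hs
      simp [sqPos, max_eq_right (le_of_lt (Set.mem_Ioi.1 hs))]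
    rw [max_eq_right h.le]
    simpa using (hasDerivAt_pow 2 t).congr_of_eventuallyEq this

theorem hasDerivAt_inv_pow (n : ℕ) {r : ℝ} (hr : r ≠ 0) :
    HasDerivAt (fun r : ℝ => (r ^ n)⁻¹) (-(n * r⁻¹ * (r ^ n)⁻¹)) r := by
  have h := hasDerivAt_zpow (-(n:ℤ)) r (Or.inl hr)
  have e : (fun r : ℝ => r ^ (-(n:ℤ))) = fun r => (r ^ n)⁻¹ := by
    ext r; rw [zpow_neg, zpow_natCast]
  rw [e] at h
  have e2 : -(n * r⁻¹ * (r ^ n)⁻¹) = ((-(n:ℤ) : ℤ) : ℝ) * r ^ (-(n:ℤ) - 1) := by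
    rw [zpow_sub_one₀ hr, zpow_neg, zpow_natCast]
    push_cast; ring
  rw [e2]
  exact h

section Kernel

variable {n : ℕ}

/-- The unnormalised bump function `z ↦ ((1 - |z|²)⁺)²`. -/
def bumpFun (n : ℕ) (z : Eu n) : ℝ := sqPos (1 - ‖z‖ ^ 2)

theorem continuous_bumpFun : Continuous (bumpFun n) := by
  unfold bumpFun; exact continuous_sqPos.comp (by fun_prop)

theorem bumpFun_eq_zero {z : Eu n} (hz : 1 ≤ ‖z‖) : bumpFun n z = 0 :=
  sqPos_of_nonpos (by nlinarith)

theorem hasCompactSupport_bumpFun : HasCompactSupport (bumpFun n) := by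
  refine HasCompactSupport.intro (isCompact_closedBall (0 : Eu n) 1) fun z hz => ?_
  refine bumpFun_eq_zero ?_
  simp only [mem_closedBall, dist_zero_right, not_le] at hz
  exact hz.le

/-- The normalising constant of the bump function. -/
def bumpConst (n : ℕ) : ℝ := (∫ z : Eu n, bumpFun n z)⁻¹

theorem integral_bumpFun_pos : 0 < ∫ z : Eu n, bumpFun n z :=
  continuous_bumpFun.integral_pos_of_hasCompactSupport_nonneg_nonzero hasCompactSupport_bumpFun
    (fun _ => sqPos_nonneg _) (x := 0) (by simp [bumpFun, sqPos])

theorem bumpConst_pos : 0 < bumpConst n := inv_pos.2 integral_bumpFun_pos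

/-- The mollification kernel of radius `r` centred at `x`. -/
def molKer (n : ℕ) (x : Eu n) (r : ℝ) (y : Eu n) : ℝ :=
  bumpConst n * (r ^ n)⁻¹ * sqPos (1 - ‖x - y‖ ^ 2 * (r ^ 2)⁻¹)

theorem molKer_nonneg {x : Eu n} {r : ℝ} (hr : 0 ≤ r) {y : Eu n} : 0 ≤ molKer n x r y :=
  mul_nonneg (mul_nonneg bumpConst_pos.le (by positivity)) (sqPos_nonneg _)

theorem molKer_le {x : Eu n} {r : ℝ} (hr : 0 ≤ r) {y : Eu n} :
    molKer n x r y ≤ bumpConst n * (r ^ n)⁻¹ := by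
  unfold molKer
  have : sqPos (1 - ‖x - y‖ ^ 2 * (r ^ 2)⁻¹) ≤ 1 := sqPos_le_one (by
    have : 0 ≤ ‖x - y‖ ^ 2 * (r ^ 2)⁻¹ := by positivity
    linarith)
  have h : 0 ≤ bumpConst n * (r ^ n)⁻¹ := mul_nonneg bumpConst_pos.le (by positivity)
  nlinarith

theorem one_sub_nonpos_of_le {a r : ℝ} (hr : 0 < r) (h : r ≤ a) : 1 - a ^ 2 * (r ^ 2)⁻¹ ≤ 0 := by
  rw [sub_nonpos, ← div_eq_mul_inv, one_le_div (by positivity)]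
  gcongr

theorem molKer_eq_zero {x : Eu n} {r : ℝ} (hr : 0 < r) {y : Eu n} (h : r ≤ ‖x - y‖) :
    molKer n x r y = 0 := by
  unfold molKer
  rw [sqPos_of_nonpos (one_sub_nonpos_of_le hr h), mul_zero]

theorem molKer_comm {x : Eu n} {r : ℝ} {y : Eu n} : molKer n x r y = molKer n y r x := by
  unfold molKer; rw [norm_sub_rev]

theorem molKer_eq_bump {x : Eu n} {r : ℝ} (hr : 0 < r) {y : Eu n} :
    molKer n x r y = bumpConst n * (r ^ n)⁻¹ * bumpFun n (r⁻¹ • (x - y)) := by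
  unfold molKer bumpFun
  rw [norm_smul, norm_inv, Real.norm_eq_abs, abs_of_pos hr, mul_pow, inv_pow,
    mul_comm (‖x - y‖ ^ 2)]

theorem continuous_molKer (x : Eu n) (r : ℝ) : Continuous (molKer n x r) := by
  unfold molKer
  exact continuous_const.mul (continuous_sqPos.comp (by fun_prop))

theorem measurable_molKer : Measurable fun p : Eu n × ℝ × Eu n => molKer n p.1 p.2.1 p.2.2 := by
  unfold molKer
  exact (measurable_const.mul (by fun_prop)).mul (continuous_sqPos.measurable.comp (by fun_prop))

theorem hasCompactSupport_molKer (x : Eu n) {r : ℝ} (hr : 0 < r) :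
    HasCompactSupport (molKer n x r) := by
  refine HasCompactSupport.intro (isCompact_closedBall x r) fun z hz => ?_
  refine molKer_eq_zero hr ?_
  rw [← dist_eq_norm, dist_comm]
  simp only [mem_closedBall, not_le] at hz
  exact hz.le

theorem integrable_molKer (x : Eu n) {r : ℝ} (hr : 0 < r) (ν : Measure (Eu n))
    [IsFiniteMeasureOnCompacts ν] : Integrable (molKer n x r) ν :=
  (continuous_molKer x r).integrable_of_hasCompactSupport (hasCompactSupport_molKer x hr)

theorem integral_molKer (x : Eu n) {r : ℝ} (hr : 0 < r) : ∫ y, molKer n x r y = 1 := by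
  simp_rw [molKer_eq_bump hr]
  rw [integral_const_mul, integral_sub_left_eq_self (fun z => bumpFun n (r⁻¹ • z)) volume x,
    Measure.integral_comp_smul, finrank_euclideanSpace, Fintype.card_fin, inv_pow, inv_inv,
    smul_eq_mul,
    abs_of_pos (by positivity), bumpConst]
  have := (integral_bumpFun_pos (n := n)).ne'
  field_simp

theorem lintegral_molKer (x : Eu n) {r : ℝ} (hr : 0 < r) :
    ∫⁻ y, ENNReal.ofReal (molKer n x r y) = 1 := by
  rw [← ofReal_integral_eq_lintegral_ofReal (integrable_molKer x hr volume)
    (Eventually.of_forall fun _ => molKer_nonneg hr.le), integral_molKer x hr, ENNReal.ofReal_one]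

/-- The derivative of the mollification kernel in the centre and the radius. -/
def molKerDeriv (n : ℕ) (x : Eu n) (r : ℝ) (y : Eu n) : (Eu n × ℝ) →L[ℝ] ℝ :=
  (bumpConst n * (r ^ n)⁻¹ * (2 * max 0 (1 - ‖x - y‖ ^ 2 * (r ^ 2)⁻¹)) * (-2 * (r ^ 2)⁻¹)) •
    ((innerSL ℝ (x - y)).comp (ContinuousLinearMap.fst ℝ (Eu n) ℝ)) +
  (bumpConst n * (r ^ n)⁻¹ * (2 * max 0 (1 - ‖x - y‖ ^ 2 * (r ^ 2)⁻¹) *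
      (2 * r⁻¹ * (‖x - y‖ ^ 2 * (r ^ 2)⁻¹)) -
      n * r⁻¹ * sqPos (1 - ‖x - y‖ ^ 2 * (r ^ 2)⁻¹))) • ContinuousLinearMap.snd ℝ (Eu n) ℝ

theorem hasFDerivAt_molKer {x : Eu n} {r : ℝ} (hr : r ≠ 0) (y : Eu n) :
    HasFDerivAt (fun p : Eu n × ℝ => molKer n p.1 p.2 y) (molKerDeriv n x r y) (x, r) := by
  have h1 : HasFDerivAt (fun p : Eu n × ℝ => ‖p.1 - y‖ ^ 2)
      (2 • ((innerSL ℝ (x - y)).comp (ContinuousLinearMap.fst ℝ (Eu n) ℝ))) (x, r) := by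
    exact ((hasFDerivAt_fst (𝕜 := ℝ) (E := Eu n) (F := ℝ) (p := (x, r))).sub_const y).norm_sq
  have h2 : ∀ k : ℕ, HasFDerivAt (fun p : Eu n × ℝ => (p.2 ^ k)⁻¹)
      ((-(k * r⁻¹ * (r ^ k)⁻¹)) • ContinuousLinearMap.snd ℝ (Eu n) ℝ) (x, r) := fun k =>
    HasDerivAt.comp_hasFDerivAt (h₂ := fun s : ℝ => (s ^ k)⁻¹) (x, r) (hasDerivAt_inv_pow k hr)
      (hasFDerivAt_snd (𝕜 := ℝ) (E := Eu n) (F := ℝ) (p := (x, r)))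
  have h3 := (h1.mul (h2 2)).const_sub 1
  have h4 := HasDerivAt.comp_hasFDerivAt (x, r) (hasDerivAt_sqPos _) h3
  have h5 := ((h2 n).const_mul (bumpConst n)).mul h4
  refine h5.congr_fderiv ?_
  ext p
  · simp [molKerDeriv]; ring
  · simp [molKerDeriv]; ring

theorem continuous_molKerDeriv (x : Eu n) (r : ℝ) : Continuous (molKerDeriv n x r) := by
  unfold molKerDeriv
  have := continuous_sqPos
  have h : Continuous fun y : Eu n =>
      (innerSL ℝ (x - y)).comp (ContinuousLinearMap.fst ℝ (Eu n) ℝ) :=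
    ((innerSL ℝ).continuous.comp (continuous_const.sub continuous_id)).clm_comp continuous_const
  have h' : Continuous fun y : Eu n => sqPos (1 - ‖x - y‖ ^ 2 * (r ^ 2)⁻¹) :=
    continuous_sqPos.comp (by fun_prop)
  have h1 : Continuous fun y : Eu n => bumpConst n * (r ^ n)⁻¹ *
      (2 * max 0 (1 - ‖x - y‖ ^ 2 * (r ^ 2)⁻¹)) * (-2 * (r ^ 2)⁻¹) := by fun_prop
  have h2 : Continuous fun y : Eu n => bumpConst n * (r ^ n)⁻¹ *
      (2 * max 0 (1 - ‖x - y‖ ^ 2 * (r ^ 2)⁻¹) * (2 * r⁻¹ * (‖x - y‖ ^ 2 * (r ^ 2)⁻¹)) -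
      n * r⁻¹ * sqPos (1 - ‖x - y‖ ^ 2 * (r ^ 2)⁻¹)) := by fun_prop
  exact (h1.smul h).add (h2.smul continuous_const)

theorem norm_molKerDeriv_le (x : Eu n) {r : ℝ} (hr : 0 < r) (y : Eu n) :
    ‖molKerDeriv n x r y‖ ≤ bumpConst n * (r ^ n)⁻¹ * r⁻¹ * (8 + n) := by
  have hc := bumpConst_pos (n := n)
  have hB : 0 ≤ bumpConst n * (r ^ n)⁻¹ * r⁻¹ * (8 + n) := by positivity
  by_cases h : r ≤ ‖x - y‖
  · have := one_sub_nonpos_of_le hr h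
    have e : molKerDeriv n x r y = 0 := by
      unfold molKerDeriv
      rw [sqPos_of_nonpos this, max_eq_left this]; simp
    rw [e, norm_zero]; exact hB
  push Not at h
  set t := ‖x - y‖ ^ 2 * (r ^ 2)⁻¹ with ht
  have t0 : 0 ≤ t := by positivity
  have t1 : t ≤ 1 := by
    rw [ht, ← div_eq_mul_inv, div_le_one (by positivity)]; gcongr
  have m0 : 0 ≤ max 0 (1 - t) := le_max_left _ _
  have m1 : max 0 (1 - t) ≤ 1 := max_le zero_le_one (by linarith)
  have s0 := sqPos_nonneg (1 - t)
  have s1 : sqPos (1 - t) ≤ 1 := sqPos_le_one (by linarith)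
  have n1 : ‖(innerSL ℝ (x - y)).comp (ContinuousLinearMap.fst ℝ (Eu n) ℝ)‖ ≤ r := by
    refine (ContinuousLinearMap.opNorm_comp_le _ _).trans ?_
    rw [innerSL_apply_norm]
    have := ContinuousLinearMap.norm_fst_le ℝ (Eu n) ℝ
    nlinarith [norm_nonneg (x - y)]
  have n2 := ContinuousLinearMap.norm_snd_le ℝ (Eu n) ℝ
  have k0 : 0 ≤ bumpConst n * (r ^ n)⁻¹ := by positivity
  unfold molKerDeriv
  refine (norm_add_le _ _).trans ?_
  rw [norm_smul, norm_smul, ← ht]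
  have a1 : ‖bumpConst n * (r ^ n)⁻¹ * (2 * max 0 (1 - t)) * (-2 * (r ^ 2)⁻¹)‖ ≤
      bumpConst n * (r ^ n)⁻¹ * 4 * (r⁻¹ * r⁻¹) := by
    rw [Real.norm_eq_abs, abs_mul, abs_of_nonneg (by positivity : 0 ≤ bumpConst n * (r ^ n)⁻¹ *
      (2 * max 0 (1 - t))), abs_mul, abs_of_nonneg (by positivity : 0 ≤ (r ^ 2)⁻¹)]
    have : (r ^ 2)⁻¹ = r⁻¹ * r⁻¹ := by rw [sq, mul_inv]
    rw [this]
    have : 0 ≤ bumpConst n * (r ^ n)⁻¹ * (r⁻¹ * r⁻¹) := by positivity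
    norm_num
    nlinarith
  have a2 : ‖bumpConst n * (r ^ n)⁻¹ * (2 * max 0 (1 - t) * (2 * r⁻¹ * t) -
      n * r⁻¹ * sqPos (1 - t))‖ ≤ bumpConst n * (r ^ n)⁻¹ * (r⁻¹ * (4 + n)) := by
    rw [norm_mul, Real.norm_of_nonneg k0]
    refine mul_le_mul_of_nonneg_left ?_ k0
    have r0 : 0 ≤ r⁻¹ := by positivity
    refine (norm_sub_le _ _).trans ?_
    rw [Real.norm_of_nonneg (by positivity), Real.norm_of_nonneg (by positivity)]
    have b1 : max 0 (1 - t) * t ≤ 1 := mul_le_one₀ m1 t0 t1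
    have b2 : (n:ℝ) * sqPos (1 - t) ≤ n := mul_le_of_le_one_right (by positivity) s1
    calc _ = r⁻¹ * (4 * (max 0 (1 - t) * t) + n * sqPos (1 - t)) := by ring
      _ ≤ r⁻¹ * (4 + n) := mul_le_mul_of_nonneg_left (by linarith) r0
  calc _ ≤ bumpConst n * (r ^ n)⁻¹ * 4 * (r⁻¹ * r⁻¹) * r +
        bumpConst n * (r ^ n)⁻¹ * (r⁻¹ * (4 + n)) * 1 :=
        add_le_add (mul_le_mul a1 n1 (norm_nonneg _) (by positivity))
          (mul_le_mul a2 n2 (norm_nonneg _) (by positivity))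
    _ = _ := by field_simp; ring

end Kernel

section Mollification

variable {n : ℕ}

theorem contDiff_sqPos : ContDiff ℝ 1 sqPos := by
  rw [contDiff_one_iff_deriv]
  refine ⟨fun t => (hasDerivAt_sqPos t).differentiableAt, ?_⟩
  have : deriv sqPos = fun t => 2 * max 0 t := funext fun t => (hasDerivAt_sqPos t).deriv
  rw [this]; fun_prop

/-- The mollification of `f` at the point `x` and scale `r`. -/
def mol (f : Eu n → ℝ) (x : Eu n) (r : ℝ) : ℝ := ∫ y, f y * molKer n x r y

theorem integrable_mul_molKer {f : Eu n → ℝ} (hf : Integrable f) (x : Eu n) {r : ℝ} (hr : 0 < r) :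
    Integrable fun y => f y * molKer n x r y := by
  refine hf.mul_bdd (c := bumpConst n * (r ^ n)⁻¹) (continuous_molKer x r).aestronglyMeasurable ?_
  exact Eventually.of_forall fun y => by
    rw [Real.norm_of_nonneg (molKer_nonneg hr.le)]; exact molKer_le hr.le

theorem integrable_smul_molKerDeriv {f : Eu n → ℝ} (hf : Integrable f) (x : Eu n) {r : ℝ}
    (hr : 0 < r) : Integrable fun y => f y • molKerDeriv n x r y :=
  hf.smul_bdd (bumpConst n * (r ^ n)⁻¹ * r⁻¹ * (8 + n))
    (continuous_molKerDeriv x r).aestronglyMeasurable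
    (Eventually.of_forall fun y => norm_molKerDeriv_le x hr y)

theorem hasFDerivAt_mol {f : Eu n → ℝ} (hf : Integrable f) (x : Eu n) {r : ℝ} (hr : 0 < r) :
    HasFDerivAt (fun p : Eu n × ℝ => mol f p.1 p.2) (∫ y, f y • molKerDeriv n x r y) (x, r) := by
  have hc := bumpConst_pos (n := n)
  have hs : {p : Eu n × ℝ | r / 2 < p.2} ∈ 𝓝 (x, r) :=
    (isOpen_lt continuous_const continuous_snd).mem_nhds (by simp; linarith)
  refine hasFDerivAt_integral_of_dominated_of_fderiv_le
    (F := fun (p : Eu n × ℝ) y => f y * molKer n p.1 p.2 y)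
    (F' := fun p y => f y • molKerDeriv n p.1 p.2 y) (x₀ := (x, r))
    (bound := fun y => ‖f y‖ * (bumpConst n * ((r / 2) ^ n)⁻¹ * (r / 2)⁻¹ * (8 + n))) hs
    (Eventually.of_forall fun p => hf.1.mul (continuous_molKer p.1 p.2).aestronglyMeasurable)
    (integrable_mul_molKer hf x hr) (integrable_smul_molKerDeriv hf x hr).1
    (Eventually.of_forall fun y p hp => ?_) (hf.norm.mul_const _)
    (Eventually.of_forall fun y p hp => ?_)
  · have hp : r / 2 < p.2 := hp
    have hp0 : 0 < p.2 := by linarith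
    rw [norm_smul]
    refine mul_le_mul_of_nonneg_left ((norm_molKerDeriv_le p.1 hp0 y).trans ?_) (norm_nonneg _)
    gcongr
  · have hp : r / 2 < p.2 := hp
    have := (hasFDerivAt_molKer (x := p.1) (r := p.2) (by linarith : p.2 ≠ 0) y).const_mul (f y)
    exact this

theorem contDiff_molKer (x : Eu n) (r : ℝ) : ContDiff ℝ 1 (molKer n x r) := by
  unfold molKer
  exact contDiff_const.mul (contDiff_sqPos.comp
    (contDiff_const.sub (((contDiff_const.sub contDiff_id).norm_sq ℝ).mul contDiff_const)))

theorem tsupport_molKer_subset (x : Eu n) {r : ℝ} (hr : 0 < r) :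
    tsupport (molKer n x r) ⊆ closedBall x r := by
  refine closure_minimal (fun y hy => ?_) isClosed_closedBall
  by_contra h
  refine hy (molKer_eq_zero hr ?_)
  rw [← dist_eq_norm, dist_comm]
  simp only [mem_closedBall, not_le] at h
  exact h.le

/-- The vector field whose divergence is a derivative of the mollification kernel. -/
def molField (n : ℕ) (x : Eu n) (r : ℝ) (ξ : Eu n) (s : ℝ) (y : Eu n) : Eu n :=
  molKer n x r y • (ξ - (s * r⁻¹) • (x - y))

theorem contDiff_molField (x : Eu n) (r : ℝ) (ξ : Eu n) (s : ℝ) :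
    ContDiff ℝ 1 (molField n x r ξ s) := by
  unfold molField
  have h : ContDiff ℝ 1 fun y : Eu n => ξ - (s * r⁻¹) • (x - y) := by fun_prop
  exact (contDiff_molKer x r).smul h

theorem tsupport_molField_subset (x : Eu n) {r : ℝ} (hr : 0 < r) (ξ : Eu n) (s : ℝ) :
    tsupport (molField n x r ξ s) ⊆ closedBall x r :=
  (closure_mono (Function.support_smul_subset_left _ _)).trans (tsupport_molKer_subset x hr)

theorem norm_molField_le (x : Eu n) {r : ℝ} (hr : 0 < r) (ξ : Eu n) (s : ℝ) (y : Eu n) :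
    ‖molField n x r ξ s y‖ ≤ (‖ξ‖ + |s|) * molKer n x r y := by
  unfold molField
  rw [norm_smul, Real.norm_of_nonneg (molKer_nonneg hr.le), mul_comm]
  by_cases h : r ≤ ‖x - y‖
  · rw [molKer_eq_zero hr h]; simp
  push Not at h
  refine mul_le_mul_of_nonneg_right ((norm_sub_le _ _).trans ?_) (molKer_nonneg hr.le)
  rw [norm_smul, norm_mul, Real.norm_eq_abs, Real.norm_of_nonneg (inv_nonneg.2 hr.le), mul_assoc]
  gcongr
  refine mul_le_of_le_one_right (abs_nonneg _) ?_
  rw [inv_mul_le_one₀ hr]; exact h.le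

theorem vdiv_molField (x : Eu n) {r : ℝ} (hr : 0 < r) (ξ : Eu n) (s : ℝ) (y : Eu n) :
    vdiv n (molField n x r ξ s) y = - molKerDeriv n x r y (ξ, s) := by
  have h1 : HasFDerivAt (molKer n x r)
      ((molKerDeriv n y r x).comp (ContinuousLinearMap.inl ℝ (Eu n) ℝ)) y := by
    have h0 : HasFDerivAt (fun z : Eu n => (z, r)) (ContinuousLinearMap.inl ℝ (Eu n) ℝ) y :=
      hasFDerivAt_prodMk_left y r
    have h := (hasFDerivAt_molKer (x := y) hr.ne' x).comp y h0
    have e : molKer n x r = fun z => molKer n z r x := funext fun z => molKer_comm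
    rw [e]
    exact h
  have h2 : HasFDerivAt (fun y : Eu n => ξ - (s * r⁻¹) • (x - y))
      ((s * r⁻¹) • ContinuousLinearMap.id ℝ (Eu n)) y := by
    have := (((hasFDerivAt_id (𝕜 := ℝ) y).const_sub x).const_smul (s * r⁻¹)).const_sub ξ
    refine this.congr_fderiv ?_
    ext v; simp
  have h3 := h1.smul h2
  unfold vdiv
  rw [show molField n x r ξ s = (molKer n x r) • fun y => ξ - (s * r⁻¹) • (x - y) from rfl]
  rw [h3.fderiv]
  have i1 : ∀ v w : Eu n, ⟪v, w⟫ = ∑ i, v i * w i := fun v w => by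
    rw [PiLp.inner_apply]
    exact Finset.sum_congr rfl fun i _ => by simp [mul_comm]
  have i2 : ‖x - y‖ ^ 2 = ∑ i, (x i - y i) * (x i - y i) := by
    rw [← real_inner_self_eq_norm_sq, i1]; rfl
  simp only [molKerDeriv, add_apply, smul_apply,
    ContinuousLinearMap.smulRight_apply, ContinuousLinearMap.comp_apply,
    ContinuousLinearMap.inl_apply, ContinuousLinearMap.id_apply, ContinuousLinearMap.coe_fst',
    ContinuousLinearMap.coe_snd', innerSL_apply_apply, PiLp.add_apply, PiLp.smul_apply,
    PiLp.sub_apply, smul_eq_mul, mul_zero, add_zero, norm_sub_rev y x,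
    EuclideanSpace.inner_single_right, inner_sub_left, conj_trivial, one_mul]
  unfold molKer
  generalize max 0 (1 - ‖x - y‖ ^ 2 * (r ^ 2)⁻¹) = A
  generalize sqPos (1 - ‖x - y‖ ^ 2 * (r ^ 2)⁻¹) = B
  rw [i2, i1, i1]
  have e : ∀ i : Fin n, bumpConst n * (r ^ n)⁻¹ * B *
      (s * r⁻¹ * (EuclideanSpace.single i (1:ℝ) : Eu n) i) +
      bumpConst n * (r ^ n)⁻¹ * (2 * A) * (-2 * (r ^ 2)⁻¹) * (y i - x i) *
        (ξ i - s * r⁻¹ * (x i - y i)) = bumpConst n * (r ^ n)⁻¹ * B * s * r⁻¹ +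
      (bumpConst n * (r ^ n)⁻¹ * (4 * A) * (r ^ 2)⁻¹) * (x i * ξ i) -
      (bumpConst n * (r ^ n)⁻¹ * (4 * A) * (r ^ 2)⁻¹) * (y i * ξ i) -
      (bumpConst n * (r ^ n)⁻¹ * (4 * A) * (r ^ 2)⁻¹ * s * r⁻¹) * ((x i - y i) * (x i - y i)) := by
    intro i; simp; ring
  simp_rw [e]
  rw [Finset.sum_sub_distrib, Finset.sum_sub_distrib, Finset.sum_add_distrib, Finset.sum_const,
    Finset.card_univ, Fintype.card_fin, nsmul_eq_mul, ← Finset.mul_sum, ← Finset.mul_sum,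
    ← Finset.mul_sum]
  generalize ∑ i, x i * ξ i = a
  generalize ∑ i, y i * ξ i = b
  generalize ∑ i, (x i - y i) * (x i - y i) = q
  ring

theorem integral_smul_molKerDeriv_le {f : Eu n → ℝ} (hf : Integrable f) {Ω : Set (Eu n)}
    {μ : Measure (Eu n)} {σ : Eu n → Eu n} (h : IsVariationPair n f Ω μ σ) {x : Eu n} {r : ℝ}
    (hr : 0 < r) (hx : closedBall x r ⊆ Ω) (ξ : Eu n) (s : ℝ) :
    |(∫ y, f y • molKerDeriv n x r y) (ξ, s)| ≤ (‖ξ‖ + |s|) * ∫ y, molKer n x r y ∂μ := by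
  obtain ⟨hμ, hμΩ, hσ, hσ1, hd⟩ := h
  have hcs : HasCompactSupport (molField n x r ξ s) :=
    (isCompact_closedBall x r).of_isClosed_subset isClosed_closure
      (tsupport_molField_subset x hr ξ s)
  have key := hd _ (contDiff_molField x r ξ s) hcs ((tsupport_molField_subset x hr ξ s).trans hx)
  have e1 : (∫ y, f y • molKerDeriv n x r y) (ξ, s) = ∫ y, f y * molKerDeriv n x r y (ξ, s) :=
    ContinuousLinearMap.integral_apply (integrable_smul_molKerDeriv hf x hr) _
  have e2 : ∫ y in Ω, f y * vdiv n (molField n x r ξ s) y =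
      - ∫ y, f y * molKerDeriv n x r y (ξ, s) := by
    rw [setIntegral_eq_integral_of_forall_compl_eq_zero, ← integral_neg]
    · simp_rw [vdiv_molField x hr, mul_neg]
    · intro y hy
      have hy' : y ∉ tsupport (molField n x r ξ s) :=
        fun h => hy (hx (tsupport_molField_subset x hr ξ s h))
      have : fderiv ℝ (molField n x r ξ s) y = 0 :=
        (notMem_tsupport_iff_eventuallyEq.1 hy').fderiv_eq.trans (by simp)
      simp [vdiv, this]
  have e3 : (∫ y, f y • molKerDeriv n x r y) (ξ, s) = ∫ y, ⟪molField n x r ξ s y, σ y⟫ ∂μ := by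
    rw [e1]; linarith
  rw [e3, ← Real.norm_eq_abs, ← integral_const_mul]
  refine norm_integral_le_of_norm_le ((integrable_molKer x hr μ).const_mul _) ?_
  filter_upwards [hσ1] with y hy
  refine (norm_inner_le_norm _ _).trans ?_
  rw [hy, mul_one]
  exact norm_molField_le x hr ξ s y

end Mollification

section Scale

variable {n : ℕ}

/-- A `C¹` function on `ℝⁿ`, positive exactly on `Ω`, with small derivative and fast decay towards
the complement of `Ω`. -/
structure IsScale (n : ℕ) (d : Eu n → ℝ) (Ω : Set (Eu n)) : Prop where
  contDiff : ContDiff ℝ 1 d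
  norm_fderiv_le : ∀ x, ‖fderiv ℝ d x‖ ≤ 1
  nonneg : ∀ x, 0 ≤ d x
  le_one : ∀ x, d x ≤ 1
  pos_iff : ∀ x, 0 < d x ↔ x ∈ Ω
  le_pow : ∀ x ∉ Ω, ∀ y, d y ≤ dist y x ^ (n + 1)

theorem abs_sub_le_of_norm_fderiv_le_one {d : Eu n → ℝ} (hd : Differentiable ℝ d)
    (h : ∀ x, ‖fderiv ℝ d x‖ ≤ 1) (x y : Eu n) : |d x - d y| ≤ dist x y := by
  have := convex_univ.norm_image_sub_le_of_norm_fderiv_le (f := d) (𝕜 := ℝ) (C := 1) (x := y)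
    (y := x)
    (fun z _ => hd z) (fun z _ => h z) trivial trivial
  rwa [one_mul, ← dist_eq_norm] at this

theorem IsScale.abs_sub_le {d : Eu n → ℝ} {Ω : Set (Eu n)} (h : IsScale n d Ω) (x y : Eu n) :
    |d x - d y| ≤ dist x y :=
  abs_sub_le_of_norm_fderiv_le_one (h.contDiff.differentiable one_ne_zero) h.norm_fderiv_le x y

theorem exists_contDiff_support_eq_of_bounded {V : Set (Eu n)} (hV : IsOpen V)
    (hb : Bornology.IsBounded V) : ∃ g : Eu n → ℝ, ContDiff ℝ 1 g ∧ (∀ x, 0 ≤ g x) ∧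
      (∀ x, g x ≤ 1) ∧ (∀ x, 0 < g x ↔ x ∈ V) ∧ ∀ x, ‖fderiv ℝ g x‖ ≤ 1 := by
  obtain ⟨f, hs, hc, hr⟩ := hV.exists_contDiff_support_eq (n := 1)
  have hc : ContDiff ℝ 1 f := hc
  have h0 : ∀ x, 0 ≤ f x := fun x => (hr (Set.mem_range_self x)).1
  have h1 : ∀ x, f x ≤ 1 := fun x => (hr (Set.mem_range_self x)).2
  have hK : HasCompactSupport f := by
    unfold HasCompactSupport tsupport
    rw [hs]
    exact hb.isCompact_closure
  have hbd : BddAbove (Set.range fun x => ‖fderiv ℝ f x‖) :=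
    (hc.continuous_fderiv one_ne_zero).norm.bddAbove_range_of_hasCompactSupport
      (hK.fderiv (𝕜 := ℝ)).norm
  obtain ⟨R, hR⟩ := hbd
  have hR : ∀ x, ‖fderiv ℝ f x‖ ≤ R := fun x => hR (Set.mem_range_self x)
  have hR0 : 0 ≤ R := (norm_nonneg _).trans (hR 0)
  refine ⟨fun x => (1 + R)⁻¹ * f x, contDiff_const.mul hc,
    fun x => mul_nonneg (by positivity) (h0 x),
    fun x => mul_le_one₀ (inv_le_one_of_one_le₀ (by linarith)) (h0 x) (h1 x), fun x => ?_,
    fun x => ?_⟩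
  · rw [mul_pos_iff_of_pos_left (by positivity), ← hs, Function.mem_support]
    exact (h0 x).lt_iff_ne'
  · rw [fderiv_const_mul (hc.differentiable one_ne_zero x), norm_smul,
      Real.norm_of_nonneg (by positivity), inv_mul_le_one₀ (by positivity)]
    linarith [hR x]

theorem exists_isScale {Ω : Set (Eu n)} (hΩ : IsOpen Ω) : ∃ d, IsScale n d Ω := by
  have hV : ∀ k : ℕ, IsOpen (Ω ∩ ball (0 : Eu n) k) := fun k => hΩ.inter isOpen_ball
  choose g hg h0 h1 hp hd using fun k =>
    exists_contDiff_support_eq_of_bounded (hV k) (isBounded_ball.subset Set.inter_subset_right)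
  let u : ℕ → ℝ := fun k => (1 / 2) ^ k * (1 / 2)
  have hu : HasSum u 1 := by
    have := hasSum_geometric_two.mul_right (1 / 2)
    norm_num at this
    simpa [u] using this
  have u0 : ∀ k, 0 < u k := fun k => by simp only [u]; positivity
  let f : ℕ → Eu n → ℝ := fun k x => u k * g k x
  have fd : ∀ k, Differentiable ℝ (f k) := fun k =>
    ((hg k).differentiable one_ne_zero).const_mul (u k)
  have ff : ∀ k x, fderiv ℝ (f k) x = u k • fderiv ℝ (g k) x := fun k x =>
    fderiv_const_mul ((hg k).differentiable one_ne_zero x) _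
  have fb : ∀ k x, ‖fderiv ℝ (f k) x‖ ≤ u k := fun k x => by
    rw [ff, norm_smul, Real.norm_of_nonneg (u0 k).le]
    exact mul_le_of_le_one_right (u0 k).le (hd k x)
  have fn : ∀ k x, 0 ≤ f k x := fun k x => mul_nonneg (u0 k).le (h0 k x)
  have fl : ∀ k x, ‖f k x‖ ≤ u k := fun k x => by
    rw [Real.norm_of_nonneg (fn k x)]
    exact mul_le_of_le_one_right (u0 k).le (h1 k x)
  have fs : ∀ x, Summable fun k => f k x := fun x => Summable.of_norm_bounded hu.summable (fl · x)
  let D : Eu n → ℝ := fun x => ∑' k, f k x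
  have Dd : ∀ x, HasFDerivAt D (∑' k, fderiv ℝ (f k) x) x := fun x =>
    hasFDerivAt_tsum hu.summable (fun k x => (fd k x).hasFDerivAt) fb (fs 0) x
  have Dc : ContDiff ℝ 1 D := by
    rw [contDiff_one_iff_fderiv]
    refine ⟨fun x => (Dd x).differentiableAt, ?_⟩
    rw [show fderiv ℝ D = fun x => ∑' k, fderiv ℝ (f k) x from funext fun x => (Dd x).fderiv]
    refine continuous_tsum (fun k => ?_) hu.summable fb
    exact (contDiff_const.mul (hg k)).continuous_fderiv one_ne_zero
  have D' : ∀ x, ‖fderiv ℝ D x‖ ≤ 1 := fun x => by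
    rw [(Dd x).fderiv]; exact tsum_of_norm_bounded hu (fb · x)
  have D0 : ∀ x, 0 ≤ D x := fun x => tsum_nonneg (fn · x)
  have D1 : ∀ x, D x ≤ 1 := fun x => (le_abs_self _).trans (tsum_of_norm_bounded hu (fl · x))
  have Dp : ∀ x, 0 < D x ↔ x ∈ Ω := fun x => by
    constructor
    · intro h
      by_contra hx
      have : D x = 0 := by
        simp only [D]
        rw [← tsum_zero (α := ℝ) (β := ℕ)]
        congr 1; ext k
        have : ¬ 0 < g k x := fun h => hx ((hp k x).1 h).1
        have : g k x = 0 := le_antisymm (not_lt.1 this) (h0 k x)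
        simp [f, this]
      exact h.ne' this
    · intro hx
      obtain ⟨k, hk⟩ := exists_nat_gt ‖x‖
      exact (fs x).tsum_pos (fn · x) k (mul_pos (u0 k) ((hp k x).2 ⟨hx, by simpa using hk⟩))
  have hn : (0:ℝ) < n + 1 := by positivity
  refine ⟨fun x => (n + 1 : ℝ)⁻¹ * D x ^ (n + 1), contDiff_const.mul (Dc.pow _), fun x => ?_,
    fun x => mul_nonneg (by positivity) (pow_nonneg (D0 x) _),
    fun x => mul_le_one₀ (inv_le_one_of_one_le₀ (by linarith [(Nat.cast_nonneg n : (0:ℝ) ≤ n)]))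
      (pow_nonneg (D0 x) _) (pow_le_one₀ (D0 x) (D1 x)), fun x => ?_, fun x hx y => ?_⟩
  · have h := ((Dd x).differentiableAt.hasFDerivAt.pow (n + 1)).const_mul (n + 1 : ℝ)⁻¹
    rw [HasFDerivAt.fderiv h, norm_smul, norm_smul, Real.norm_of_nonneg (by positivity)]
    simp only [Nat.add_sub_cancel, nsmul_eq_mul, norm_mul]
    rw [Real.norm_of_nonneg (pow_nonneg (D0 x) _)]
    have e : ‖((n + 1 : ℕ) : ℝ)‖ = n + 1 := by
      rw [Real.norm_of_nonneg (by positivity)]; push_cast; ring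
    rw [e, ← mul_assoc, ← mul_assoc, inv_mul_cancel₀ hn.ne', one_mul]
    exact mul_le_one₀ (pow_le_one₀ (D0 x) (D1 x)) (norm_nonneg _) (D' x)
  · rw [mul_pos_iff_of_pos_left (by positivity), ← Dp x]
    constructor
    · intro h
      refine (D0 x).lt_of_ne fun h' => ?_
      rw [← h'] at h; simp at h
    · intro h; positivity
  · have hDx : D x = 0 := le_antisymm (not_lt.1 (fun h => hx ((Dp x).1 h))) (D0 x)
    have := abs_sub_le_of_norm_fderiv_le_one (fun x => (Dd x).differentiableAt) D' y x
    rw [hDx, sub_zero, abs_of_nonneg (D0 y)] at this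
    refine (mul_le_of_le_one_left (pow_nonneg (D0 y) _)
      (inv_le_one_of_one_le₀ (by linarith [(Nat.cast_nonneg n : (0:ℝ) ≤ n)]))).trans ?_
    exact pow_le_pow_left₀ (D0 y) this _

end Scale

section ScaleMol

variable {n : ℕ}

/-- Mollification of `f` at the variable scale `ε d`. -/
def scaleMol (f : Eu n → ℝ) (d : Eu n → ℝ) (ε : ℝ) (x : Eu n) : ℝ := mol f x (ε * d x)

/-- The kernel of the mollification at the variable scale `ε d`. -/
def scaleKer (d : Eu n → ℝ) (ε : ℝ) (x y : Eu n) : ℝ≥0∞ := ENNReal.ofReal (molKer n x (ε * d x) y)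

variable {d : Eu n → ℝ} {Ω : Set (Eu n)} {f : Eu n → ℝ} {μ : Measure (Eu n)} {σ : Eu n → Eu n}

theorem measurable_scaleKer (hd : Continuous d) :
    Measurable fun p : ℝ × Eu n × Eu n => scaleKer d p.1 p.2.1 p.2.2 := by
  have h : Measurable fun p : ℝ × Eu n × Eu n => (p.2.1, p.1 * d p.2.1, p.2.2) := by
    have := hd.measurable
    fun_prop
  exact (measurable_molKer.comp h).ennreal_ofReal

theorem IsScale.continuous (h : IsScale n d Ω) : Continuous d := h.contDiff.continuous

theorem IsScale.measurableSet (h : IsScale n d Ω) : MeasurableSet Ω := by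
  have : Ω = {x | 0 < d x} := Set.ext fun x => (h.pos_iff x).symm
  rw [this]
  exact measurableSet_lt measurable_const h.continuous.measurable

theorem IsScale.isOpen (h : IsScale n d Ω) : IsOpen Ω := by
  have : Ω = {x | 0 < d x} := Set.ext fun x => (h.pos_iff x).symm
  rw [this]
  exact isOpen_lt continuous_const h.continuous

theorem IsScale.le_of_norm_le (h : IsScale n d Ω) {ε : ℝ} {x y : Eu n} (hxy : ‖x - y‖ ≤ ε * d x) :
    (1 - ε) * d x ≤ d y ∧ d y ≤ (1 + ε) * d x := by
  have := abs_le.1 ((h.abs_sub_le x y).trans_eq (dist_eq_norm x y))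
  constructor <;> linarith [this.1, this.2]

theorem IsScale.closedBall_subset (h : IsScale n d Ω) {ε : ℝ} (hε : ε < 1) {x : Eu n} (hx : x ∈ Ω) :
    closedBall x (ε * d x) ⊆ Ω := by
  intro y hy
  rw [mem_closedBall, dist_comm, dist_eq_norm] at hy
  have := (h.le_of_norm_le hy).1
  have hx := (h.pos_iff x).2 hx
  exact (h.pos_iff y).1 (by nlinarith)

theorem scaleMol_hasFDerivAt (h : IsScale n d Ω) (hf : Integrable f) {ε : ℝ} (hε : 0 < ε) {x : Eu n}
    (hx : x ∈ Ω) : HasFDerivAt (scaleMol f d ε) ((∫ y, f y • molKerDeriv n x (ε * d x) y).comp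
      ((ContinuousLinearMap.id ℝ (Eu n)).prod (ε • fderiv ℝ d x))) x := by
  have hx := (h.pos_iff x).2 hx
  have h1 : HasFDerivAt (fun x => ε * d x) (ε • fderiv ℝ d x) x :=
    (h.contDiff.differentiable one_ne_zero x).hasFDerivAt.const_mul ε
  exact (hasFDerivAt_mol hf x (mul_pos hε hx)).comp x ((hasFDerivAt_id x).prodMk h1)

theorem scaleMol_differentiableAt (h : IsScale n d Ω) (hf : Integrable f) {ε : ℝ} (hε : 0 < ε)
    {x : Eu n} (hx : x ∈ Ω) : DifferentiableAt ℝ (scaleMol f d ε) x :=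
  (scaleMol_hasFDerivAt h hf hε hx).differentiableAt

theorem ofReal_integral_molKer [IsFiniteMeasure μ] (x : Eu n) {r : ℝ} (hr : 0 < r) :
    ENNReal.ofReal (∫ y, molKer n x r y ∂μ) = ∫⁻ y, ENNReal.ofReal (molKer n x r y) ∂μ :=
  ofReal_integral_eq_lintegral_ofReal (integrable_molKer x hr μ)
    (Eventually.of_forall fun _ => molKer_nonneg hr.le)

theorem enorm_fderiv_scaleMol_le (h : IsScale n d Ω) (hf : Integrable f)
    (hv : IsVariationPair n f Ω μ σ) {ε : ℝ} (hε : 0 < ε) (hε1 : ε < 1) {x : Eu n} (hx : x ∈ Ω) :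
    ‖fderiv ℝ (scaleMol f d ε) x‖ₑ ≤ ENNReal.ofReal (1 + ε) * ∫⁻ y, scaleKer d ε x y ∂μ := by
  have := hv.1
  have hd := (h.pos_iff x).2 hx
  have hr := mul_pos hε hd
  have hb := h.closedBall_subset hε1 hx
  unfold scaleKer
  rw [← ofReal_integral_molKer x hr, ← ENNReal.ofReal_mul (by positivity), ← ofReal_norm]
  refine ENNReal.ofReal_le_ofReal ?_
  have h0 : 0 ≤ ∫ y, molKer n x (ε * d x) y ∂μ := integral_nonneg fun _ => molKer_nonneg hr.le
  refine ContinuousLinearMap.opNorm_le_bound _ (by positivity) fun ξ => ?_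
  rw [(scaleMol_hasFDerivAt h hf hε hx).fderiv, Real.norm_eq_abs]
  refine (integral_smul_molKerDeriv_le hf hv hr hb ξ (ε * fderiv ℝ d x ξ)).trans ?_
  have h1 : |ε * fderiv ℝ d x ξ| ≤ ε * ‖ξ‖ := by
    rw [abs_mul, abs_of_pos hε]
    refine mul_le_mul_of_nonneg_left ?_ hε.le
    exact ((fderiv ℝ d x).le_opNorm ξ).trans
      (mul_le_of_le_one_left (norm_nonneg _) (h.norm_fderiv_le x))
  calc _ ≤ (‖ξ‖ + ε * ‖ξ‖) * ∫ y, molKer n x (ε * d x) y ∂μ := by gcongr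
    _ = _ := by ring

theorem molKer_scale_le (h : IsScale n d Ω) {ε : ℝ} (hε : 0 < ε) (hε1 : ε < 1) {x : Eu n}
    (hx : x ∈ Ω) (y : Eu n) : molKer n x (ε * d x) y ≤
      ((1 + ε) / (1 - ε)) ^ n * molKer n y (ε * d y / (1 - ε)) x := by
  have hd := (h.pos_iff x).2 hx
  have hr := mul_pos hε hd
  have h1ε : 0 < 1 - ε := by linarith
  by_cases hxy : ε * d x ≤ ‖x - y‖
  · rw [molKer_eq_zero hr hxy]
    exact mul_nonneg (by positivity) (molKer_nonneg (by have := h.nonneg y; positivity))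
  push Not at hxy
  obtain ⟨h1, h2⟩ := h.le_of_norm_le hxy.le
  have hdy : 0 < d y := lt_of_lt_of_le (mul_pos h1ε hd) h1
  have hr1 : ε * d x ≤ ε * d y / (1 - ε) := by
    rw [le_div_iff₀ h1ε]; nlinarith
  rw [molKer_comm (x := y)]
  unfold molKer
  have hs : sqPos (1 - ‖x - y‖ ^ 2 * ((ε * d x) ^ 2)⁻¹) ≤
      sqPos (1 - ‖x - y‖ ^ 2 * ((ε * d y / (1 - ε)) ^ 2)⁻¹) := sqPos_mono (by gcongr)
  have hi : ((ε * d x) ^ n)⁻¹ ≤ ((1 + ε) / (1 - ε)) ^ n * ((ε * d y / (1 - ε)) ^ n)⁻¹ := by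
    rw [← inv_pow, ← inv_pow, ← mul_pow]
    refine pow_le_pow_left₀ (by positivity) ?_ n
    have e : (1 + ε) / (1 - ε) * (ε * d y / (1 - ε))⁻¹ = (1 + ε) / (ε * d y) := by field_simp
    rw [e, inv_eq_one_div, div_le_div_iff₀ hr (by positivity)]
    nlinarith
  have hc := bumpConst_pos (n := n)
  calc _ ≤ bumpConst n * (((1 + ε) / (1 - ε)) ^ n * ((ε * d y / (1 - ε)) ^ n)⁻¹) *
        sqPos (1 - ‖x - y‖ ^ 2 * ((ε * d y / (1 - ε)) ^ 2)⁻¹) := by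
        gcongr
        exact sqPos_nonneg _
    _ = _ := by ring

theorem lintegral_scaleKer_le (h : IsScale n d Ω) {ε : ℝ} (hε : 0 < ε) (hε1 : ε < 1) {y : Eu n}
    (hy : y ∈ Ω) :
    ∫⁻ x in Ω, scaleKer d ε x y ≤ ENNReal.ofReal (((1 + ε) / (1 - ε)) ^ n) := by
  have hdy := (h.pos_iff y).2 hy
  have h1ε : 0 < 1 - ε := by linarith
  calc ∫⁻ x in Ω, scaleKer d ε x y
      ≤ ∫⁻ x in Ω, ENNReal.ofReal (((1 + ε) / (1 - ε)) ^ n) *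
          ENNReal.ofReal (molKer n y (ε * d y / (1 - ε)) x) := by
        refine setLIntegral_mono_ae (by
          exact (measurable_const.mul
            (continuous_molKer _ _).measurable.ennreal_ofReal).aemeasurable)
          (Eventually.of_forall fun x hx => ?_)
        rw [← ENNReal.ofReal_mul (by positivity)]
        exact ENNReal.ofReal_le_ofReal (molKer_scale_le h hε hε1 hx y)
    _ ≤ ∫⁻ x, ENNReal.ofReal (((1 + ε) / (1 - ε)) ^ n) *
          ENNReal.ofReal (molKer n y (ε * d y / (1 - ε)) x) := setLIntegral_le_lintegral _ _
    _ = _ := by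
        rw [lintegral_const_mul _ (continuous_molKer _ _).measurable.ennreal_ofReal,
          lintegral_molKer _ (by positivity), mul_one]

theorem lintegral_lintegral_scaleKer_swap [SFinite μ] (h : IsScale n d Ω) {ε : ℝ} (A : Set (Eu n)) :
    ∫⁻ x in A, ∫⁻ y, scaleKer d ε x y ∂μ = ∫⁻ y, (∫⁻ x in A, scaleKer d ε x y) ∂μ := by
  refine lintegral_lintegral_swap ?_
  have hm : Measurable fun p : Eu n × Eu n => scaleKer d ε p.1 p.2 :=
    (measurable_scaleKer h.continuous).comp measurable_prodMk_left
  exact hm.aemeasurable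

theorem setLIntegral_enorm_fderiv_scaleMol_le (h : IsScale n d Ω) (hf : Integrable f)
    (hv : IsVariationPair n f Ω μ σ) {ε : ℝ} (hε : 0 < ε) (hε1 : ε < 1) {A : Set (Eu n)}
    (hA : MeasurableSet A) (hAΩ : A ⊆ Ω) :
    ∫⁻ x in A, ‖fderiv ℝ (scaleMol f d ε) x‖ₑ ≤
      ENNReal.ofReal (1 + ε) * ∫⁻ y, (∫⁻ x in A, scaleKer d ε x y) ∂μ := by
  have := hv.1
  rw [← lintegral_lintegral_scaleKer_swap h, ← lintegral_const_mul']
  · exact setLIntegral_mono' hA fun x hx => enorm_fderiv_scaleMol_le h hf hv hε hε1 (hAΩ hx)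
  · exact ENNReal.ofReal_ne_top

theorem lintegral_lintegral_scaleKer_le (h : IsScale n d Ω) (hμ : μ Ωᶜ = 0)
    {ε : ℝ} (hε : 0 < ε) (hε1 : ε < 1) :
    ∫⁻ y, (∫⁻ x in Ω, scaleKer d ε x y) ∂μ ≤ ENNReal.ofReal (((1 + ε) / (1 - ε)) ^ n) * μ Ω := by
  rw [← lintegral_add_compl _ h.measurableSet, setLIntegral_measure_zero _ _ hμ, add_zero]
  refine (setLIntegral_mono' h.measurableSet fun y hy => lintegral_scaleKer_le h hε hε1 hy).trans ?_
  rw [setLIntegral_const]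

theorem lintegral_enorm_fderiv_scaleMol_le (h : IsScale n d Ω) (hf : Integrable f)
    (hv : IsVariationPair n f Ω μ σ) {ε : ℝ} (hε : 0 < ε) (hε1 : ε < 1) :
    ∫⁻ x in Ω, ‖fderiv ℝ (scaleMol f d ε) x‖ₑ ≤
      ENNReal.ofReal ((1 + ε) * ((1 + ε) / (1 - ε)) ^ n) * μ Ω := by
  rw [ENNReal.ofReal_mul (by positivity), mul_assoc]
  refine (setLIntegral_enorm_fderiv_scaleMol_le h hf hv hε hε1 h.measurableSet subset_rfl).trans ?_
  gcongr
  exact lintegral_lintegral_scaleKer_le h hv.2.1 hε hε1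

end ScaleMol

section Oscillation

variable {n : ℕ} {f : Eu n → ℝ}

/-- The mean oscillation of `f` around the value `c` on the ball of radius `r` centred at `x`. -/
def osc (f : Eu n → ℝ) (c : ℝ) (x : Eu n) (r : ℝ) : ℝ := ⨍ z in ball x r, |f z - c|

/-- The volume of the unit ball. -/
def ballVol (n : ℕ) : ℝ := volume.real (ball (0 : Eu n) 1)

theorem ballVol_pos : 0 < ballVol n :=
  ENNReal.toReal_pos (measure_ball_pos _ _ one_pos).ne' measure_ball_lt_top.ne

theorem volume_ball_eq (x : Eu n) {r : ℝ} (hr : 0 < r) :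
    volume (ball x r) = ENNReal.ofReal (r ^ n * ballVol n) := by
  rw [Measure.addHaar_ball_of_pos volume x hr, finrank_euclideanSpace, Fintype.card_fin,
    ENNReal.ofReal_mul (by positivity), ballVol, ofReal_measureReal measure_ball_lt_top.ne]

theorem volume_real_ball_eq (x : Eu n) {r : ℝ} (hr : 0 < r) :
    volume.real (ball x r) = r ^ n * ballVol n := by
  rw [measureReal_def, volume_ball_eq x hr,
    ENNReal.toReal_ofReal (mul_nonneg (by positivity) ballVol_pos.le)]

theorem osc_eq (f : Eu n → ℝ) (c : ℝ) (x : Eu n) {r : ℝ} (hr : 0 < r) :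
    osc f c x r = (r ^ n * ballVol n)⁻¹ * ∫ z in ball x r, |f z - c| := by
  rw [osc, setAverage_eq, volume_real_ball_eq x hr, smul_eq_mul]

theorem setIntegral_ball_eq (f : Eu n → ℝ) (c : ℝ) (x : Eu n) {r : ℝ} (hr : 0 < r) :
    ∫ z in ball x r, |f z - c| = r ^ n * ballVol n * osc f c x r := by
  rw [osc_eq f c x hr, mul_inv_cancel_left₀ (mul_pos (by positivity) ballVol_pos).ne']

theorem integrableOn_abs_sub (hf : Integrable f) (c : ℝ) (x : Eu n) (r : ℝ) :
    IntegrableOn (fun z => |f z - c|) (ball x r) :=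
  ((hf.integrableOn).sub (integrableOn_const measure_ball_lt_top.ne)).abs

theorem osc_nonneg (f : Eu n → ℝ) (c : ℝ) (x : Eu n) {r : ℝ} (hr : 0 < r) : 0 ≤ osc f c x r := by
  rw [osc_eq f c x hr]
  exact mul_nonneg (inv_nonneg.2 (mul_pos (by positivity) ballVol_pos).le)
    (integral_nonneg fun _ => abs_nonneg _)

theorem osc_const (c c' : ℝ) (x : Eu n) {r : ℝ} (hr : 0 < r) :
    (r ^ n * ballVol n)⁻¹ * ∫ _ in ball x r, |c - c'| = |c - c'| := by
  rw [setIntegral_const, volume_real_ball_eq x hr, smul_eq_mul,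
    inv_mul_cancel_left₀ (mul_pos (by positivity) ballVol_pos).ne']

theorem osc_le_add (hf : Integrable f) (c c' : ℝ) (x : Eu n) {r : ℝ} (hr : 0 < r) :
    osc f c x r ≤ osc f c' x r + |c' - c| := by
  rw [osc_eq f c x hr, osc_eq f c' x hr, ← osc_const c' c x hr, ← mul_add, ← integral_add
    (integrableOn_abs_sub hf c' x r) (integrableOn_const measure_ball_lt_top.ne)]
  refine mul_le_mul_of_nonneg_left ?_ (inv_nonneg.2 (mul_pos (by positivity) ballVol_pos).le)
  refine integral_mono (integrableOn_abs_sub hf c x r) ((integrableOn_abs_sub hf c' x r).add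
    (integrableOn_const measure_ball_lt_top.ne)) fun z => ?_
  exact abs_sub_le _ _ _

theorem abs_sub_le_osc (hf : Integrable f) (c c' : ℝ) (x : Eu n) {r : ℝ} (hr : 0 < r) :
    |c - c'| ≤ osc f c x r + osc f c' x r := by
  rw [osc_eq f c x hr, osc_eq f c' x hr, ← osc_const c c' x hr, ← mul_add, ← integral_add
    (integrableOn_abs_sub hf c x r) (integrableOn_abs_sub hf c' x r)]
  refine mul_le_mul_of_nonneg_left ?_ (inv_nonneg.2 (mul_pos (by positivity) ballVol_pos).le)
  refine integral_mono (integrableOn_const measure_ball_lt_top.ne)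
    ((integrableOn_abs_sub hf c x r).add (integrableOn_abs_sub hf c' x r)) fun z => ?_
  simp only
  rw [abs_sub_comm (f z) c]
  exact abs_sub_le _ _ _

theorem osc_le_of_ball_subset (hf : Integrable f) (c : ℝ) {x y : Eu n} {r R K : ℝ} (hr : 0 < r)
    (hb : ball x r ⊆ ball y R) (hR : 0 < R) (hK : R ≤ K * r) :
    osc f c x r ≤ K ^ n * osc f c y R := by
  have hV := ballVol_pos (n := n)
  have h1 : ∫ z in ball x r, |f z - c| ≤ ∫ z in ball y R, |f z - c| :=
    setIntegral_mono_set (integrableOn_abs_sub hf c y R)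
      (Eventually.of_forall fun _ => abs_nonneg _) (LE.le.eventuallyLE hb)
  rw [setIntegral_ball_eq f c x hr, setIntegral_ball_eq f c y hR] at h1
  have h2 : R ^ n ≤ K ^ n * r ^ n := by
    rw [← mul_pow]; exact pow_le_pow_left₀ hR.le hK n
  have h3 : r ^ n * ballVol n * osc f c x r ≤ r ^ n * ballVol n * (K ^ n * osc f c y R) := by
    refine h1.trans ?_
    have := mul_le_mul_of_nonneg_right h2 (mul_nonneg hV.le (osc_nonneg f c y hR))
    linarith
  exact le_of_mul_le_mul_left h3 (by positivity)

theorem ae_tendsto_osc (hf : Integrable f) :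
    ∀ᵐ x, Tendsto (fun r => osc f (f x) x r) (𝓝[>] 0) (𝓝 0) := by
  filter_upwards [IsUnifLocDoublingMeasure.ae_tendsto_average_norm_sub volume
    hf.locallyIntegrable 1] with x hx
  have h := hx (l := 𝓝[>] (0:ℝ)) (fun _ => x) (fun r : ℝ => r) tendsto_id (by
    filter_upwards [self_mem_nhdsWithin] with r hr
    exact mem_closedBall_self (by rw [one_mul]; exact le_of_lt hr))
  refine h.congr' ?_
  filter_upwards [self_mem_nhdsWithin] with r hr
  refine (setAverage_congr ?_).symm
  have : sphere x r =ᵐ[volume] (∅ : Set (Eu n)) :=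
    ae_eq_empty.2 (Measure.addHaar_sphere_of_ne_zero volume x (ne_of_gt hr))
  rw [← ball_union_sphere]
  exact ((ae_eq_refl _).union this).trans (by rw [Set.union_empty]; exact ae_eq_refl _) |>.symm

theorem volume_approxDiscontSet (hf : Integrable f) : volume (approxDiscontSet n f) = 0 := by
  refine measure_mono_null (fun x hx h => hx ⟨f x, h⟩) (ae_iff.1 (ae_tendsto_osc hf))

theorem measurable_osc (hf : StronglyMeasurable f) (c : ℝ) {r : ℝ} (hr : 0 < r) :
    Measurable fun x => osc f c x r := by
  have h1 : StronglyMeasurable fun p : Eu n × Eu n =>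
      {p : Eu n × Eu n | dist p.2 p.1 < r}.indicator (fun p => |f p.2 - c|) p := by
    refine StronglyMeasurable.indicator ?_ ?_
    · have := hf.measurable
      exact Measurable.stronglyMeasurable (by fun_prop)
    · exact measurableSet_lt (by fun_prop) measurable_const
  have h2 := (h1.integral_prod_right' (ν := (volume : Measure (Eu n)))).measurable
  have e : (fun x => osc f c x r) = fun x => (r ^ n * ballVol n)⁻¹ * ∫ y,
      {p : Eu n × Eu n | dist p.2 p.1 < r}.indicator (fun p => |f p.2 - c|) (x, y) := by
    ext x
    rw [osc_eq f c x hr, ← integral_indicator measurableSet_ball]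
    rfl
  rw [e]
  exact measurable_const.mul h2

theorem notMem_approxDiscontSet_iff (hf : Integrable f) (x : Eu n) :
    x ∉ approxDiscontSet n f ↔ ∀ m : ℕ, ∃ q : ℚ, ∃ k₀ : ℕ, ∀ k ≥ k₀,
      osc f q x ((1 / 2) ^ k) ≤ 1 / (m + 1) := by
  have hp : ∀ k : ℕ, (0:ℝ) < (1 / 2) ^ k := fun k => by positivity
  have hk : Tendsto (fun k : ℕ => ((1:ℝ) / 2) ^ k) atTop (𝓝[>] 0) :=
    tendsto_nhdsWithin_iff.2 ⟨tendsto_pow_atTop_nhds_zero_of_lt_one (by norm_num) (by norm_num),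
      Eventually.of_forall hp⟩
  have : x ∉ approxDiscontSet n f ↔ ∃ c : ℝ, Tendsto (fun r => osc f c x r) (𝓝[>] 0) (𝓝 0) := by
    simp only [approxDiscontSet, Set.mem_ofPred_eq, not_not]; rfl
  rw [this]
  constructor
  · rintro ⟨c, hc⟩ m
    have hm : (0:ℝ) < 1 / (m + 1) := by positivity
    obtain ⟨q, hq1, hq2⟩ := exists_rat_btwn (show c < c + 1 / (m + 1) / 2 by linarith)
    obtain ⟨k₀, hk₀⟩ := eventually_atTop.1 ((hc.comp hk).eventually_lt_const (half_pos hm))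
    refine ⟨q, k₀, fun k hk => ?_⟩
    have h1 := osc_le_add hf q c x (hp k)
    have h2 := hk₀ k hk
    have h3 : |c - q| ≤ 1 / (m + 1) / 2 := abs_le.2 ⟨by linarith, by linarith⟩
    simp only [Function.comp] at h2
    linarith
  · intro h
    choose q k₀ hq using h
    have hd : ∀ m l, |(q m : ℝ) - q l| ≤ 1 / (m + 1) + 1 / (l + 1) := fun m l => by
      have h := abs_sub_le_osc hf (q m) (q l) x (hp (max (k₀ m) (k₀ l)))
      have := hq m _ (le_max_left (k₀ m) (k₀ l))
      have := hq l _ (le_max_right (k₀ m) (k₀ l))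
      linarith
    have hC : CauchySeq fun m => (q m : ℝ) := by
      refine cauchySeq_of_le_tendsto_0 (fun N : ℕ => (1:ℝ) / (N + 1) + 1 / (N + 1))
        (fun m l N hm hl => ?_) ?_
      · rw [Real.dist_eq]
        refine (hd m l).trans ?_
        gcongr
      · simpa using tendsto_one_div_add_atTop_nhds_zero_nat.add
          (tendsto_one_div_add_atTop_nhds_zero_nat (𝕜 := ℝ))
    obtain ⟨c, hc⟩ := cauchySeq_tendsto_of_complete hC
    have hqc : ∀ m, |(q m : ℝ) - c| ≤ 1 / (m + 1) := fun m => by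
      have h1 : Tendsto (fun l => |(q m : ℝ) - q l|) atTop (𝓝 |(q m : ℝ) - c|) :=
        (tendsto_const_nhds.sub hc).abs
      have h2 : Tendsto (fun l : ℕ => (1:ℝ) / (m + 1) + 1 / (l + 1)) atTop (𝓝 (1 / (m + 1) + 0)) :=
        tendsto_const_nhds.add tendsto_one_div_add_atTop_nhds_zero_nat
      rw [add_zero] at h2
      exact le_of_tendsto_of_tendsto' h1 h2 (hd m)
    refine ⟨c, ?_⟩
    rw [Metric.tendsto_nhdsWithin_nhds]
    intro ε hε
    have hlim : Tendsto (fun m : ℕ => 2 ^ n * (2 * ((1:ℝ) / (m + 1)))) atTop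
        (𝓝 (2 ^ n * (2 * 0))) :=
      tendsto_const_nhds.mul (tendsto_const_nhds.mul tendsto_one_div_add_atTop_nhds_zero_nat)
    rw [mul_zero, mul_zero] at hlim
    obtain ⟨m, hm⟩ := (hlim.eventually_lt_const hε).exists
    refine ⟨(1 / 2) ^ (k₀ m + 1), hp _, fun {r} hr hr' => ?_⟩
    have hr : 0 < r := hr
    rw [Real.dist_eq, sub_zero, abs_of_pos hr] at hr'
    obtain ⟨k, hk1, hk2⟩ := exists_nat_pow_near_of_lt_one hr
      (hr'.le.trans (pow_le_one₀ (by norm_num) (by norm_num))) (by norm_num : (0:ℝ) < 1 / 2)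
      (by norm_num)
    have hkk : k₀ m ≤ k := by
      have := (pow_lt_pow_iff_right_of_lt_one₀ (by norm_num : (0:ℝ) < 1 / 2) (by norm_num)).1
        (hk1.trans hr')
      omega
    have h1 := osc_le_of_ball_subset hf c hr (ball_subset_ball hk2 : ball x r ⊆ _) (hp k)
      (K := 2) (by rw [pow_succ] at hk1; linarith)
    have h2 := osc_le_add hf c (q m) x (hp k)
    have h3 := hq m k hkk
    have h4 := hqc m
    rw [Real.dist_eq, sub_zero, abs_of_nonneg (osc_nonneg f c x hr)]
    refine (h1.trans (mul_le_mul_of_nonneg_left ?_ (by positivity))).trans_lt hm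
    linarith

theorem measurableSet_approxDiscontSet (hf : Integrable f) (hm : StronglyMeasurable f) :
    MeasurableSet (approxDiscontSet n f) := by
  rw [← MeasurableSet.compl_iff]
  have : (approxDiscontSet n f)ᶜ = ⋂ m : ℕ, ⋃ q : ℚ, ⋃ k₀ : ℕ, ⋂ k : ℕ, ⋂ _ : k ≥ k₀,
      {x | osc f q x ((1 / 2) ^ k) ≤ 1 / (m + 1)} := by
    ext x
    rw [Set.mem_compl_iff, notMem_approxDiscontSet_iff hf]
    simp only [Set.mem_iInter, Set.mem_iUnion, Set.mem_ofPred_eq]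
  rw [this]
  refine MeasurableSet.iInter fun m => MeasurableSet.iUnion fun q => MeasurableSet.iUnion fun k₀ =>
    MeasurableSet.iInter fun k => MeasurableSet.iInter fun _ => ?_
  exact measurableSet_le (measurable_osc hm q (by positivity)) measurable_const

end Oscillation

section MolOsc

variable {n : ℕ} {f d : Eu n → ℝ} {Ω : Set (Eu n)}

theorem mol_sub_eq (hf : Integrable f) (c : ℝ) (x : Eu n) {r : ℝ} (hr : 0 < r) :
    mol f x r - c = ∫ y, (f y - c) * molKer n x r y := by
  simp_rw [sub_mul]
  rw [integral_sub (integrable_mul_molKer hf x hr) ((integrable_molKer x hr _).const_mul c),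
    integral_const_mul, integral_molKer _ hr, mul_one, mol]

theorem integrable_abs_sub_mul_molKer (hf : Integrable f) (c : ℝ) (x : Eu n) {r : ℝ} (hr : 0 < r) :
    Integrable fun y => |f y - c| * molKer n x r y := by
  have h : Integrable fun y => (f y - c) * molKer n x r y := by
    simp_rw [sub_mul]
    exact (integrable_mul_molKer hf x hr).sub ((integrable_molKer x hr _).const_mul c)
  refine h.abs.congr (Eventually.of_forall fun y => ?_)
  simp only [abs_mul, abs_of_nonneg (molKer_nonneg hr.le)]

theorem abs_mol_sub_le_integral (hf : Integrable f) (c : ℝ) (x : Eu n) {r : ℝ} (hr : 0 < r) :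
    |mol f x r - c| ≤ ∫ y, |f y - c| * molKer n x r y := by
  rw [mol_sub_eq hf c x hr]
  refine abs_integral_le_integral_abs.trans_eq
    (integral_congr_ae (Eventually.of_forall fun y => ?_))
  simp only [abs_mul, abs_of_nonneg (molKer_nonneg hr.le)]

theorem abs_mol_sub_le (hf : Integrable f) (c : ℝ) {x y : Eu n} {r R K : ℝ} (hr : 0 < r)
    (hb : ball x r ⊆ ball y R) (hR : 0 < R) (hK : R ≤ K * r) :
    |mol f x r - c| ≤ bumpConst n * ballVol n * K ^ n * osc f c y R := by
  have hc := bumpConst_pos (n := n)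
  have hV := ballVol_pos (n := n)
  have h1 : ∫ y, |f y - c| * molKer n x r y ≤ bumpConst n * ballVol n * osc f c x r := by
    rw [osc_eq f c x hr]
    calc ∫ y, |f y - c| * molKer n x r y
        = ∫ y in ball x r, |f y - c| * molKer n x r y := by
          refine (setIntegral_eq_integral_of_forall_compl_eq_zero fun z hz => ?_).symm
          rw [mem_ball, not_lt, dist_comm, dist_eq_norm] at hz
          rw [molKer_eq_zero hr hz, mul_zero]
      _ ≤ ∫ y in ball x r, |f y - c| * (bumpConst n * (r ^ n)⁻¹) := by
          refine integral_mono (integrable_abs_sub_mul_molKer hf c x hr).integrableOn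
            ((integrableOn_abs_sub hf c x r).mul_const _) fun z => ?_
          exact mul_le_mul_of_nonneg_left (molKer_le hr.le) (abs_nonneg _)
      _ = _ := by
          rw [integral_mul_const]
          field_simp
  refine (abs_mol_sub_le_integral hf c x hr).trans (h1.trans ?_)
  have h2 := mul_le_mul_of_nonneg_left (osc_le_of_ball_subset hf c hr hb hR hK)
    (mul_pos hc hV).le
  linarith

theorem abs_scaleMol_sub_le (h : IsScale n d Ω) (hf : Integrable f) (c : ℝ) {ε : ℝ} (hε : 0 < ε)
    (hε1 : ε ≤ 1 / 2) {x y : Eu n} (hx : x ∈ Ω) (hxy : ‖x - y‖ ≤ ε * d x) :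
    |scaleMol f d ε x - c| ≤ bumpConst n * ballVol n * 8 ^ n * osc f c y (4 * ε * d y) := by
  have hd := (h.pos_iff x).2 hx
  obtain ⟨h1, h2⟩ := h.le_of_norm_le hxy
  have hdy : 0 < d y := by nlinarith
  refine abs_mol_sub_le hf c (mul_pos hε hd) ?_ (by positivity) ?_
  · refine ball_subset_ball' ?_
    rw [dist_eq_norm]
    nlinarith [mul_le_mul_of_nonneg_left h1 hε.le, mul_pos hε hd]
  · nlinarith [mul_le_mul_of_nonneg_left h2 hε.le, mul_pos hε hd]

theorem scaleKer_eq_zero (h : IsScale n d Ω) {ε : ℝ} (hε : 0 < ε) {x y : Eu n} (hx : x ∈ Ω)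
    (hxy : ε * d x ≤ ‖x - y‖) : scaleKer d ε x y = 0 := by
  rw [scaleKer, molKer_eq_zero (mul_pos hε ((h.pos_iff x).2 hx)) hxy, ENNReal.ofReal_zero]

theorem setLIntegral_scaleKer_le_three (h : IsScale n d Ω) {ε : ℝ} (hε : 0 < ε) (hε1 : ε ≤ 1 / 2)
    (y : Eu n) : ∫⁻ x in Ω, scaleKer d ε x y ≤ ENNReal.ofReal (3 ^ n) := by
  by_cases hy : y ∈ Ω
  · refine (lintegral_scaleKer_le h hε (by linarith) hy).trans (ENNReal.ofReal_le_ofReal ?_)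
    have : 0 < 1 - ε := by linarith
    refine pow_le_pow_left₀ (by positivity) ?_ n
    rw [div_le_iff₀ this]; linarith
  · rw [setLIntegral_eq_zero h.measurableSet fun x hx => ?_]
    · exact zero_le
    · refine scaleKer_eq_zero h hε hx ?_
      by_contra! hlt
      refine hy (h.closedBall_subset (by linarith : ε < 1) hx ?_)
      rw [mem_closedBall, dist_comm, dist_eq_norm]; exact hlt.le

theorem enorm_scaleMol_sub_le (h : IsScale n d Ω) (hf : Integrable f) (c : ℝ) {ε : ℝ} (hε : 0 < ε)
    {x : Eu n} (hx : x ∈ Ω) : ENNReal.ofReal |scaleMol f d ε x - c| ≤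
      ∫⁻ z, scaleKer d ε x z * ENNReal.ofReal |f z - c| := by
  have hr := mul_pos hε ((h.pos_iff x).2 hx)
  refine (ENNReal.ofReal_le_ofReal (abs_mol_sub_le_integral hf c x hr)).trans_eq ?_
  rw [ofReal_integral_eq_lintegral_ofReal (integrable_abs_sub_mul_molKer hf c x hr)
    (Eventually.of_forall fun z => mul_nonneg (abs_nonneg _) (molKer_nonneg hr.le))]
  refine lintegral_congr fun z => ?_
  rw [mul_comm, ENNReal.ofReal_mul (molKer_nonneg hr.le), scaleKer]

theorem setLIntegral_scaleKer_mul_le (h : IsScale n d Ω) (hf : Integrable f)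
    (c : ℝ) {ε ε' : ℝ} (hε' : 0 < ε') (hεε : ε' ≤ ε) (hε1 : ε ≤ 1 / 2) {y : Eu n} (hy : y ∈ Ω) :
    ∫⁻ x in Ω, scaleKer d ε x y * ENNReal.ofReal |scaleMol f d ε' x - c| ≤
      ENNReal.ofReal (bumpConst n * ballVol n * 24 ^ n * osc f c y (4 * ε * d y)) := by
  have hε : 0 < ε := hε'.trans_le hεε
  have hdy := (h.pos_iff y).2 hy
  have hc := bumpConst_pos (n := n)
  have hV := ballVol_pos (n := n)
  set B := ball y (4 * ε * d y) with hB
  set g : Eu n → ℝ≥0∞ := fun z => ENNReal.ofReal |f z - c| with hg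
  have hgm : AEMeasurable g := by
    have := hf.1.aemeasurable
    simp only [hg]
    exact (continuous_abs.measurable.comp_aemeasurable (this.sub_const c)).ennreal_ofReal
  have hgB : AEMeasurable (B.indicator g) := hgm.indicator measurableSet_ball
  have hkm : Measurable fun p : Eu n × Eu n => scaleKer d ε' p.1 p.2 :=
    (measurable_scaleKer h.continuous).comp measurable_prodMk_left
  set M : ℝ := bumpConst n * (2 / (ε * d y)) ^ n with hM
  have hM0 : 0 < M := by positivity
  have key : ∀ x ∈ Ω, scaleKer d ε x y * ENNReal.ofReal |scaleMol f d ε' x - c| ≤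
      ENNReal.ofReal M * ∫⁻ z, scaleKer d ε' x z * B.indicator g z := by
    intro x hx
    have hdx := (h.pos_iff x).2 hx
    by_cases hxy : ε * d x ≤ ‖x - y‖
    · rw [scaleKer_eq_zero h hε hx hxy, zero_mul]; exact zero_le
    push Not at hxy
    obtain ⟨h1, h2⟩ := h.le_of_norm_le hxy.le
    have hdd : d y ≤ 2 * d x := by nlinarith
    have hdd' : d x ≤ 2 * d y := by nlinarith
    refine mul_le_mul' (ENNReal.ofReal_le_ofReal ((molKer_le (by positivity)).trans ?_))
      ((enorm_scaleMol_sub_le h hf c hε' hx).trans (lintegral_mono fun z => ?_))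
    · rw [hM, ← inv_pow]
      refine mul_le_mul_of_nonneg_left (pow_le_pow_left₀ (by positivity) ?_ n) hc.le
      rw [inv_eq_one_div, div_le_div_iff₀ (by positivity) (by positivity)]
      nlinarith
    · by_cases hz : z ∈ B
      · simp only [Set.indicator_of_mem hz]; exact le_rfl
      · rw [scaleKer_eq_zero h hε' hx, zero_mul]
        · exact zero_le
        rw [hB, mem_ball, not_lt, dist_eq_norm] at hz
        have h3 : ‖z - y‖ ≤ ‖x - z‖ + ‖x - y‖ := by
          have := norm_sub_le_norm_sub_add_norm_sub z x y
          rwa [norm_sub_rev z x] at this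
        nlinarith [mul_le_mul_of_nonneg_left hdd' hε.le, mul_le_mul_of_nonneg_right hεε hdx.le]
  calc ∫⁻ x in Ω, scaleKer d ε x y * ENNReal.ofReal |scaleMol f d ε' x - c|
      ≤ ∫⁻ x in Ω, ENNReal.ofReal M * ∫⁻ z, scaleKer d ε' x z * B.indicator g z :=
        setLIntegral_mono' h.measurableSet key
    _ = ENNReal.ofReal M * ∫⁻ z, (∫⁻ x in Ω, scaleKer d ε' x z * B.indicator g z) := by
        rw [lintegral_const_mul' _ _ ENNReal.ofReal_ne_top, lintegral_lintegral_swap]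
        exact hkm.aemeasurable.mul (hgB.comp_snd)
    _ ≤ ENNReal.ofReal M * ∫⁻ z, ENNReal.ofReal (3 ^ n) * B.indicator g z := by
        gcongr with z
        have hk : Measurable fun x => scaleKer d ε' x z := hkm.comp measurable_prodMk_right
        rw [lintegral_mul_const'' _ hk.aemeasurable]
        gcongr
        exact setLIntegral_scaleKer_le_three h hε' (by linarith) z
    _ = ENNReal.ofReal (M * 3 ^ n * ∫ z in B, |f z - c|) := by
        rw [lintegral_const_mul' _ _ ENNReal.ofReal_ne_top, lintegral_indicator measurableSet_ball,
          ENNReal.ofReal_mul (p := M * 3 ^ n) (by positivity), ENNReal.ofReal_mul (p := M) hM0.le,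
          mul_assoc (ENNReal.ofReal M), ofReal_integral_eq_lintegral_ofReal
            (integrableOn_abs_sub hf c y _)
            (Eventually.of_forall fun z => abs_nonneg _)]
    _ = _ := by
        congr 1
        rw [setIntegral_ball_eq f c y (by positivity), hM, div_pow, mul_pow (4 * ε), mul_pow 4,
          mul_pow ε, show (24:ℝ) = 2 * 3 * 4 by norm_num, mul_pow (2 * 3 : ℝ), mul_pow (2:ℝ)]
        field_simp

theorem tendsto_osc_scale (h : IsScale n d Ω) {c : ℝ} {y : Eu n} (hy : y ∈ Ω)
    (hc : Tendsto (fun r => osc f c y r) (𝓝[>] 0) (𝓝 0)) {ι : Type*} {l : Filter ι} {a : ι → ℝ}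
    (ha : Tendsto a l (𝓝 0)) (ha0 : ∀ k, 0 < a k) :
    Tendsto (fun k => osc f c y (4 * a k * d y)) l (𝓝 0) := by
  have hdy := (h.pos_iff y).2 hy
  refine hc.comp (tendsto_nhdsWithin_iff.2 ⟨?_, Eventually.of_forall fun k => ?_⟩)
  · have := (ha.const_mul 4).mul_const (d y)
    simpa using this
  · have := ha0 k
    show 0 < 4 * a k * d y
    positivity

theorem ae_tendsto_scaleMol (h : IsScale n d Ω) (hf : Integrable f) {a : ℕ → ℝ}
    (ha : Tendsto a atTop (𝓝 0)) (ha0 : ∀ k, 0 < a k) (ha1 : ∀ k, a k ≤ 1 / 2) :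
    ∀ᵐ y, y ∈ Ω → Tendsto (fun k => scaleMol f d (a k) y) atTop (𝓝 (f y)) := by
  filter_upwards [ae_tendsto_osc hf] with y hy hyΩ
  have h1 := (tendsto_osc_scale h hyΩ hy ha ha0).const_mul (bumpConst n * ballVol n * 8 ^ n)
  rw [mul_zero] at h1
  rw [tendsto_iff_dist_tendsto_zero]
  refine squeeze_zero (fun _ => dist_nonneg) (fun k => ?_) h1
  rw [Real.dist_eq]
  refine abs_scaleMol_sub_le h hf _ (ha0 k) (ha1 k) hyΩ ?_
  rw [sub_self, norm_zero]
  exact mul_nonneg (ha0 k).le (h.nonneg y)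

end MolOsc

section ScaleEstimates

variable {n : ℕ} {f d : Eu n → ℝ} {Ω : Set (Eu n)} {μ : Measure (Eu n)} {σ : Eu n → Eu n}

theorem measurable_lintegral_scaleKer (hd : Continuous d) [SFinite μ] :
    Measurable fun p : ℝ × Eu n => ∫⁻ y, scaleKer d p.1 p.2 y ∂μ := by
  have h : Measurable fun p : (ℝ × Eu n) × Eu n => scaleKer d p.1.1 p.1.2 p.2 :=
    (measurable_scaleKer hd).comp (f := fun p : (ℝ × Eu n) × Eu n => (p.1.1, p.1.2, p.2))
      (by fun_prop)
  exact h.lintegral_prod_right'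

theorem scaleMol_hasDerivAt_scale (h : IsScale n d Ω) (hf : Integrable f) {s : ℝ} (hs : 0 < s)
    {x : Eu n} (hx : x ∈ Ω) : HasDerivAt (fun s => scaleMol f d s x)
      ((∫ y, f y • molKerDeriv n x (s * d x) y) (0, d x)) s := by
  have hx := (h.pos_iff x).2 hx
  have h1 : HasDerivAt (fun s : ℝ => (x, s * d x)) ((0 : Eu n), d x) s := by
    refine (hasDerivAt_const s x).prodMk ?_
    simpa using (hasDerivAt_id s).mul_const (d x)
  exact (hasFDerivAt_mol hf x (mul_pos hs hx)).comp_hasDerivAt s h1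

theorem enorm_scaleMol_sub_scaleMol_le (h : IsScale n d Ω) (hf : Integrable f)
    (hv : IsVariationPair n f Ω μ σ) {η ε : ℝ} (hη : 0 < η) (hηε : η ≤ ε) (hε1 : ε ≤ 1 / 2)
    {x : Eu n} (hx : x ∈ Ω) : ‖scaleMol f d ε x - scaleMol f d η x‖ₑ ≤
      ENNReal.ofReal (d x) * ∫⁻ s in Set.Ioc 0 ε, ∫⁻ y, scaleKer d s x y ∂μ := by
  have := hv.1
  have hd := (h.pos_iff x).2 hx
  have hc := bumpConst_pos (n := n)
  set φ : ℝ → ℝ := fun s => scaleMol f d s x with hφ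
  have hD : ∀ s, 0 < s → HasDerivAt φ (deriv φ s) s := fun s hs =>
    (scaleMol_hasDerivAt_scale h hf hs hx).differentiableAt.hasDerivAt
  have hB : ∀ s, 0 < s → s ≤ ε → |deriv φ s| ≤ d x * ∫ y, molKer n x (s * d x) y ∂μ := by
    intro s hs hsε
    rw [(scaleMol_hasDerivAt_scale h hf hs hx).deriv]
    have := integral_smul_molKerDeriv_le hf hv (mul_pos hs hd)
      (h.closedBall_subset (by linarith : s < 1) hx) 0 (d x)
    rwa [norm_zero, zero_add, abs_of_pos hd] at this
  have hi : IntervalIntegrable (deriv φ) volume η ε := by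
    rw [intervalIntegrable_iff, Set.uIoc_of_le hηε]
    refine Measure.integrableOn_of_bounded measure_Ioc_lt_top.ne
      (measurable_deriv φ).aestronglyMeasurable
      (M := d x * (bumpConst n * ((η * d x) ^ n)⁻¹ * μ.real Set.univ)) ?_
    refine (ae_restrict_iff' measurableSet_Ioc).2 (Eventually.of_forall fun s hs => ?_)
    have hs0 : 0 < s := hη.trans hs.1
    refine (hB s hs0 hs.2).trans (mul_le_mul_of_nonneg_left ?_ hd.le)
    calc ∫ y, molKer n x (s * d x) y ∂μ ≤ ∫ _, bumpConst n * ((η * d x) ^ n)⁻¹ ∂μ := by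
          refine integral_mono (integrable_molKer x (by positivity) μ) (integrable_const _)
            fun y => (molKer_le (by positivity)).trans ?_
          have := hs.1.le
          gcongr
      _ = _ := by rw [integral_const, smul_eq_mul, mul_comm]
  have e := intervalIntegral.integral_eq_sub_of_hasDerivAt (a := η) (b := ε) (f := φ)
    (fun s hs => hD s (by rw [Set.uIcc_of_le hηε] at hs; linarith [hs.1])) hi
  rw [intervalIntegral.integral_of_le hηε] at e
  rw [show scaleMol f d ε x - scaleMol f d η x = φ ε - φ η from rfl, ← e]
  refine (enorm_integral_le_lintegral_enorm _).trans ?_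
  rw [← lintegral_const_mul' _ _ ENNReal.ofReal_ne_top]
  refine (setLIntegral_mono' measurableSet_Ioc fun s hs => ?_).trans
    (lintegral_mono_set (Set.Ioc_subset_Ioc_left hη.le))
  have hs0 : 0 < s := hη.trans hs.1
  unfold scaleKer
  rw [← ofReal_norm, Real.norm_eq_abs, ← ofReal_integral_molKer x (mul_pos hs0 hd),
    ← ENNReal.ofReal_mul hd.le]
  exact ENNReal.ofReal_le_ofReal (hB s hs0 hs.2)

/-- The scales `2⁻²⁻ᵏ`. -/
def dyadicScale (k : ℕ) : ℝ := (1 / 2) ^ (k + 2)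

theorem dyadicScale_pos (k : ℕ) : 0 < dyadicScale k := by unfold dyadicScale; positivity

theorem dyadicScale_anti : Antitone dyadicScale := fun a b hab =>
  pow_le_pow_of_le_one (by norm_num) (by norm_num) (by omega)

theorem dyadicScale_le (k : ℕ) : dyadicScale k ≤ 1 / 2 :=
  (dyadicScale_anti (Nat.zero_le k)).trans (by norm_num [dyadicScale])

theorem tendsto_dyadicScale : Tendsto dyadicScale atTop (𝓝 0) :=
  (tendsto_pow_atTop_nhds_zero_of_lt_one (by norm_num) (by norm_num)).comp
    (tendsto_add_atTop_nat 2)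

theorem ae_enorm_scaleMol_sub_le (h : IsScale n d Ω) (hf : Integrable f)
    (hv : IsVariationPair n f Ω μ σ) {ε : ℝ} (hε : 0 < ε) (hε1 : ε ≤ 1 / 2) :
    ∀ᵐ x, x ∈ Ω → ‖f x - scaleMol f d ε x‖ₑ ≤
      ENNReal.ofReal (d x) * ∫⁻ s in Set.Ioc 0 ε, ∫⁻ y, scaleKer d s x y ∂μ := by
  filter_upwards [ae_tendsto_scaleMol h hf tendsto_dyadicScale dyadicScale_pos dyadicScale_le]
    with x hx hxΩ
  have h1 : Tendsto (fun k => ‖scaleMol f d ε x - scaleMol f d (dyadicScale k) x‖ₑ) atTop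
      (𝓝 ‖scaleMol f d ε x - f x‖ₑ) := (tendsto_const_nhds.sub (hx hxΩ)).enorm
  rw [← enorm_neg, neg_sub]
  refine le_of_tendsto h1 ?_
  filter_upwards [tendsto_dyadicScale.eventually_lt_const hε] with k hk
  exact enorm_scaleMol_sub_scaleMol_le h hf hv (dyadicScale_pos k) hk.le hε1 hxΩ

theorem setLIntegral_scaleMol_sub_div_le (h : IsScale n d Ω) (hf : Integrable f)
    (hv : IsVariationPair n f Ω μ σ) {ε : ℝ} (hε : 0 < ε) (hε1 : ε ≤ 1 / 2) :
    ∫⁻ x in Ω, ‖f x - scaleMol f d ε x‖ₑ / ENNReal.ofReal (d x) ≤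
      ENNReal.ofReal (3 ^ n * ε) * μ Set.univ := by
  have := hv.1
  have hm := measurable_lintegral_scaleKer (μ := μ) h.continuous
  calc ∫⁻ x in Ω, ‖f x - scaleMol f d ε x‖ₑ / ENNReal.ofReal (d x)
      ≤ ∫⁻ x in Ω, ∫⁻ s in Set.Ioc 0 ε, ∫⁻ y, scaleKer d s x y ∂μ := by
        refine lintegral_mono_ae ((ae_restrict_iff' h.measurableSet).2 ?_)
        filter_upwards [ae_enorm_scaleMol_sub_le h hf hv hε hε1] with x hx hxΩ
        refine ENNReal.div_le_of_le_mul ?_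
        rw [mul_comm]
        exact hx hxΩ
    _ = ∫⁻ s in Set.Ioc 0 ε, ∫⁻ x in Ω, ∫⁻ y, scaleKer d s x y ∂μ := by
        refine lintegral_lintegral_swap ?_
        exact (hm.comp measurable_swap).aemeasurable
    _ ≤ ∫⁻ s in Set.Ioc 0 ε, ENNReal.ofReal (3 ^ n) * μ Set.univ := by
        refine setLIntegral_mono' measurableSet_Ioc fun s hs => ?_
        rw [lintegral_lintegral_scaleKer_swap h, ← lintegral_const]
        exact lintegral_mono fun y => setLIntegral_scaleKer_le_three h hs.1 (hs.2.trans hε1) y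
    _ = _ := by
        rw [setLIntegral_const, Real.volume_Ioc, sub_zero, ENNReal.ofReal_mul (by positivity)]
        ring

theorem setLIntegral_scaleMol_sub_le (h : IsScale n d Ω) (hf : Integrable f)
    (hv : IsVariationPair n f Ω μ σ) {ε : ℝ} (hε : 0 < ε) (hε1 : ε ≤ 1 / 2) :
    ∫⁻ x in Ω, ‖f x - scaleMol f d ε x‖ₑ ≤ ENNReal.ofReal (3 ^ n * ε) * μ Set.univ := by
  refine le_trans (lintegral_mono fun x => ?_) (setLIntegral_scaleMol_sub_div_le h hf hv hε hε1)
  rw [div_eq_mul_inv]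
  refine le_mul_of_one_le_right' (ENNReal.one_le_inv.2 ?_)
  exact ENNReal.ofReal_le_one.2 (h.le_one x)

theorem scaleMol_aestronglyMeasurable (h : IsScale n d Ω) (hf : Integrable f) {ε : ℝ}
    (hε : 0 < ε) : AEStronglyMeasurable (scaleMol f d ε) (volume.restrict Ω) :=
  ContinuousOn.aestronglyMeasurable (fun _ hx =>
    (scaleMol_differentiableAt h hf hε hx).continuousAt.continuousWithinAt) h.measurableSet

theorem scaleMol_integrableOn (h : IsScale n d Ω) (hf : Integrable f)
    (hv : IsVariationPair n f Ω μ σ) {ε : ℝ} (hε : 0 < ε) (hε1 : ε ≤ 1 / 2) :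
    IntegrableOn (scaleMol f d ε) Ω := by
  have := hv.1
  have h1 : IntegrableOn (fun x => f x - scaleMol f d ε x) Ω :=
    ⟨hf.1.restrict.sub (scaleMol_aestronglyMeasurable h hf hε),
      (setLIntegral_scaleMol_sub_le h hf hv hε hε1).trans_lt
        (ENNReal.mul_lt_top ENNReal.ofReal_lt_top (measure_lt_top _ _))⟩
  refine (hf.integrableOn.sub h1).congr (Eventually.of_forall fun x => ?_)
  simp

theorem tendsto_setLIntegral_scaleMol_sub (h : IsScale n d Ω) (hf : Integrable f)
    (hv : IsVariationPair n f Ω μ σ) {a : ℕ → ℝ} (ha : Tendsto a atTop (𝓝 0))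
    (ha0 : ∀ k, 0 < a k) (ha1 : ∀ k, a k ≤ 1 / 2) :
    Tendsto (fun k => ∫⁻ x in Ω, ‖f x - scaleMol f d (a k) x‖ₑ) atTop (𝓝 0) := by
  have := hv.1
  have h1 : Tendsto (fun k => ENNReal.ofReal (3 ^ n * a k) * μ Set.univ) atTop (𝓝 0) := by
    have h2 : Tendsto (fun k => ENNReal.ofReal (3 ^ n * a k)) atTop (𝓝 0) := by
      have := ENNReal.tendsto_ofReal (ha.const_mul (3 ^ n))
      simpa using this
    simpa using ENNReal.Tendsto.mul_const h2 (Or.inr (measure_ne_top μ Set.univ))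
  exact tendsto_of_tendsto_of_tendsto_of_le_of_le tendsto_const_nhds h1 (fun _ => zero_le)
    fun k => setLIntegral_scaleMol_sub_le h hf hv (ha0 k) (ha1 k)

theorem eventually_setLIntegral_fderiv_le (h : IsScale n d Ω) (hf : Integrable f)
    (hv : IsVariationPair n f Ω μ σ) {S : Set (Eu n)} (hS : MeasurableSet S) {a : ℕ → ℝ}
    (ha0 : ∀ k, 0 < a k) (ha1 : ∀ k, a k ≤ 1 / 2) {A : ℕ → Set (Eu n)}
    (hA : ∀ k, MeasurableSet (A k)) (hAΩ : ∀ k, A k ⊆ Ω)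
    (hN : ∀ y ∈ Ω \ S, Tendsto (fun k => ∫⁻ x in A k, scaleKer d (a k) x y) atTop (𝓝 0))
    {η : ℝ≥0∞} (hη : 0 < η) : ∀ᶠ k in atTop, ∫⁻ x in A k, ‖fderiv ℝ (scaleMol f d (a k)) x‖ₑ ≤
      ENNReal.ofReal (2 * 3 ^ n) * μ S + η := by
  have := hv.1
  have hm : ∀ k, Measurable fun y => ∫⁻ x in A k, scaleKer d (a k) x y := fun k => by
    have : Measurable fun p : Eu n × Eu n => scaleKer d (a k) p.2 p.1 :=
      (measurable_scaleKer h.continuous).comp (f := fun p : Eu n × Eu n => (a k, p.2, p.1))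
        (by fun_prop)
    exact this.lintegral_prod_right'
  have hb : ∀ k y, ∫⁻ x in A k, scaleKer d (a k) x y ≤ ENNReal.ofReal (3 ^ n) := fun k y =>
    (lintegral_mono_set (hAΩ k)).trans (setLIntegral_scaleKer_le_three h (ha0 k) (ha1 k) y)
  have hlim : Tendsto (fun k => ∫⁻ y in Sᶜ, (∫⁻ x in A k, scaleKer d (a k) x y) ∂μ) atTop
      (𝓝 (∫⁻ _ in Sᶜ, 0 ∂μ)) := by
    refine tendsto_lintegral_of_dominated_convergence (fun _ => ENNReal.ofReal (3 ^ n)) hm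
      (fun k => Eventually.of_forall (hb k)) ?_ ?_
    · rw [lintegral_const]
      exact (ENNReal.mul_lt_top ENNReal.ofReal_lt_top (measure_lt_top _ _)).ne
    · refine (ae_restrict_iff' hS.compl).2 ?_
      filter_upwards [measure_eq_zero_iff_ae_notMem.1 hv.2.1] with y hy hyS
      exact hN y ⟨by simpa using hy, hyS⟩
  rw [lintegral_zero] at hlim
  have hlim2 := ENNReal.Tendsto.const_mul (a := ENNReal.ofReal 2) hlim
    (Or.inr ENNReal.ofReal_ne_top)
  rw [mul_zero] at hlim2
  filter_upwards [hlim2.eventually_le_const hη] with k hk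
  refine (setLIntegral_enorm_fderiv_scaleMol_le h hf hv (ha0 k) (by linarith [ha1 k]) (hA k)
    (hAΩ k)).trans ?_
  calc ENNReal.ofReal (1 + a k) * ∫⁻ y, (∫⁻ x in A k, scaleKer d (a k) x y) ∂μ
      ≤ ENNReal.ofReal 2 * ((∫⁻ y in S, ENNReal.ofReal (3 ^ n) ∂μ) +
          ∫⁻ y in Sᶜ, (∫⁻ x in A k, scaleKer d (a k) x y) ∂μ) := by
        rw [← lintegral_add_compl _ hS]
        gcongr
        · linarith [ha1 k]
        · exact hb k _
    _ ≤ _ := by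
        rw [mul_add, setLIntegral_const, ← mul_assoc, ← ENNReal.ofReal_mul (by norm_num)]
        gcongr

end ScaleEstimates

section IntegrationByParts

variable {n : ℕ} {Ω : Set (Eu n)} {u : Eu n → ℝ}

theorem norm_gradient (u : Eu n → ℝ) (x : Eu n) : ‖gradient u x‖ = ‖fderiv ℝ u x‖ := by
  rw [← toDual_gradient, LinearIsometryEquiv.norm_map]

theorem enorm_gradient (u : Eu n → ℝ) (x : Eu n) : ‖gradient u x‖ₑ = ‖fderiv ℝ u x‖ₑ := by
  rw [← ofReal_norm, norm_gradient, ofReal_norm]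

theorem measurable_gradient (u : Eu n → ℝ) : Measurable (gradient u) :=
  (InnerProductSpace.toDual ℝ (Eu n)).symm.continuous.measurable.comp (measurable_fderiv ℝ u)

theorem integrableOn_gradient (hu : ∫⁻ x in Ω, ‖fderiv ℝ u x‖ₑ < ⊤) :
    IntegrableOn (gradient u) Ω := by
  refine ⟨(measurable_gradient u).aestronglyMeasurable, ?_⟩
  simpa only [HasFiniteIntegral, enorm_gradient] using hu

theorem hasGradMeasure_gradient (hu : IntegrableOn u Ω) (hd : ∀ x ∈ Ω, DifferentiableAt ℝ u x)
    (hg : IntegrableOn (gradient u) Ω) :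
    HasGradMeasure n u Ω (volume.restrict Ω) (gradient u) := by
  intro Φ h1 h2 h3
  have hΦd : Differentiable ℝ Φ := h1.differentiable one_ne_zero
  have p1 : ∀ i, ContDiff ℝ 1 fun y => Φ y i := fun i => contDiff_euclidean.1 h1 i
  have p2 : ∀ i, tsupport (fun y => Φ y i) ⊆ tsupport Φ := fun i =>
    closure_mono fun y hy h0 => hy (by simp [h0])
  have p3 : ∀ i, HasCompactSupport fun y => Φ y i := fun i =>
    h2.of_isClosed_subset (isClosed_tsupport _) (p2 i)
  have hgi : ∀ i, IntegrableOn (fun x => fderiv ℝ u x (EuclideanSpace.single i 1)) Ω := fun i => by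
    have := hg.inner_const (𝕜 := ℝ) (EuclideanSpace.single i (1:ℝ))
    simp only [inner_gradient_left] at this
    exact this
  have a1 : ∀ i, IntegrableOn (fun x => fderiv ℝ u x (EuclideanSpace.single i 1) * Φ x i) Ω := by
    intro i
    obtain ⟨C, hC⟩ := (p1 i).continuous.bounded_above_of_compact_support (p3 i)
    exact (hgi i).mul_bdd (p1 i).continuous.aestronglyMeasurable (Eventually.of_forall hC)
  have a2 : ∀ i, IntegrableOn (fun x => u x * Φ x i) Ω := by
    intro i
    obtain ⟨C, hC⟩ := (p1 i).continuous.bounded_above_of_compact_support (p3 i)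
    exact Integrable.mul_bdd hu (p1 i).continuous.aestronglyMeasurable (Eventually.of_forall hC)
  have a3 : ∀ i, IntegrableOn
      (fun x => u x * fderiv ℝ (fun y => Φ y i) x (EuclideanSpace.single i 1)) Ω := fun i =>
    integrableOn_mul_fderiv hu (p1 i) (p3 i) _
  have z1 : ∀ i, ∀ x ∉ Ω, Φ x i = 0 := fun i x hx =>
    image_eq_zero_of_notMem_tsupport (f := fun y => Φ y i) fun h => hx (h3 (p2 i h))
  have z2 : ∀ i, ∀ x ∉ Ω, fderiv ℝ (fun y => Φ y i) x = 0 := fun i x hx =>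
    fderiv_of_notMem_tsupport ℝ fun h => hx (h3 (p2 i h))
  have key : ∀ i, ∫ x in Ω, u x * fderiv ℝ (fun y => Φ y i) x (EuclideanSpace.single i 1) =
      - ∫ x in Ω, fderiv ℝ u x (EuclideanSpace.single i 1) * Φ x i := fun i => by
    have b1 : ∀ x ∉ Ω, fderiv ℝ u x (EuclideanSpace.single i 1) * Φ x i = 0 := fun x hx => by
      rw [z1 i x hx, mul_zero]
    have b2 : ∀ x ∉ Ω, u x * Φ x i = 0 := fun x hx => by rw [z1 i x hx, mul_zero]
    have b3 : ∀ x ∉ Ω, u x * fderiv ℝ (fun y => Φ y i) x (EuclideanSpace.single i 1) = 0 :=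
      fun x hx => by rw [z2 i x hx]; simp
    rw [setIntegral_eq_integral_of_forall_compl_eq_zero b1,
      setIntegral_eq_integral_of_forall_compl_eq_zero b3]
    exact integral_mul_fderiv_eq_neg_fderiv_mul_of_integrable
      ((integrableOn_iff_integrable_of_support_subset fun x hx => by
        by_contra h; exact hx (b1 x h)).1 (a1 i))
      ((integrableOn_iff_integrable_of_support_subset fun x hx => by
        by_contra h; exact hx (b3 x h)).1 (a3 i))
      ((integrableOn_iff_integrable_of_support_subset fun x hx => by
        by_contra h; exact hx (b2 x h)).1 (a2 i))
      (fun x hx => hd x (h3 (p2 i hx))) fun x _ => (p1 i).differentiable one_ne_zero x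
  calc ∫ x in Ω, u x * vdiv n Φ x
      = ∫ x in Ω, ∑ i, u x * fderiv ℝ (fun y => Φ y i) x (EuclideanSpace.single i 1) := by
        refine integral_congr_ae (Eventually.of_forall fun x => ?_)
        simp only [vdiv_eq_sum (hΦd x), Finset.mul_sum]
    _ = - ∫ x in Ω, ∑ i, fderiv ℝ u x (EuclideanSpace.single i 1) * Φ x i := by
        rw [integral_finsetSum (f := fun i x =>
            u x * fderiv ℝ (fun y => Φ y i) x (EuclideanSpace.single i 1)) _ fun i _ => a3 i,
          integral_finsetSum (f := fun i x => fderiv ℝ u x (EuclideanSpace.single i 1) * Φ x i) _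
            fun i _ => a1 i, ← Finset.sum_neg_distrib]
        exact Finset.sum_congr rfl fun i _ => key i
    _ = _ := by
        congr 1
        refine integral_congr_ae (Eventually.of_forall fun x => ?_)
        simp only [PiLp.inner_apply]
        refine Finset.sum_congr rfl fun i _ => ?_
        have : gradient u x i = fderiv ℝ u x (EuclideanSpace.single i 1) := by
          rw [← inner_gradient_left, EuclideanSpace.inner_single_right]
          simp
        simp [this]

end IntegrationByParts

section LowerSemicontinuity

variable {n : ℕ} {Ω : Set (Eu n)}

theorem continuous_vdiv {Φ : Eu n → Eu n} (h1 : ContDiff ℝ 1 Φ) : Continuous (vdiv n Φ) := by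
  have h : Continuous (fderiv ℝ Φ) := h1.continuous_fderiv one_ne_zero
  unfold vdiv
  fun_prop

theorem tsupport_vdiv_subset (Φ : Eu n → Eu n) : tsupport (vdiv n Φ) ⊆ tsupport Φ := by
  refine closure_minimal (fun x hx => ?_) (isClosed_tsupport _)
  by_contra h
  refine hx ?_
  simp [vdiv, fderiv_of_notMem_tsupport ℝ h]

theorem hasCompactSupport_vdiv {Φ : Eu n → Eu n} (h2 : HasCompactSupport Φ) :
    HasCompactSupport (vdiv n Φ) :=
  h2.of_isClosed_subset (isClosed_tsupport _) (tsupport_vdiv_subset Φ)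

theorem exists_abs_vdiv_le {Φ : Eu n → Eu n} (h1 : ContDiff ℝ 1 Φ) (h2 : HasCompactSupport Φ) :
    ∃ C, ∀ x, ‖vdiv n Φ x‖ ≤ C :=
  (continuous_vdiv h1).bounded_above_of_compact_support (hasCompactSupport_vdiv h2)

theorem integrableOn_mul_vdiv {f : Eu n → ℝ} (hf : IntegrableOn f Ω) {Φ : Eu n → Eu n}
    (h1 : ContDiff ℝ 1 Φ) (h2 : HasCompactSupport Φ) :
    IntegrableOn (fun x => f x * vdiv n Φ x) Ω := by
  obtain ⟨C, hC⟩ := exists_abs_vdiv_le h1 h2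
  exact Integrable.mul_bdd hf (continuous_vdiv h1).aestronglyMeasurable (Eventually.of_forall hC)

theorem tendsto_integral_mul_vdiv {w : ℕ → Eu n → ℝ} {w₀ : Eu n → ℝ}
    (hw : ∀ j, IntegrableOn (w j) Ω) (hw₀ : IntegrableOn w₀ Ω)
    (hlim : Tendsto (fun j => ∫⁻ x in Ω, ‖w j x - w₀ x‖ₑ) atTop (𝓝 0)) {Φ : Eu n → Eu n}
    (h1 : ContDiff ℝ 1 Φ) (h2 : HasCompactSupport Φ) :
    Tendsto (fun j => ∫ x in Ω, w j x * vdiv n Φ x) atTop (𝓝 (∫ x in Ω, w₀ x * vdiv n Φ x)) := by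
  obtain ⟨C, hC⟩ := exists_abs_vdiv_le h1 h2
  refine tendsto_integral_of_L1 _ (integrableOn_mul_vdiv hw₀ h1 h2).1
    (Eventually.of_forall fun j => integrableOn_mul_vdiv (hw j) h1 h2) ?_
  have hl := ENNReal.Tendsto.const_mul (a := ENNReal.ofReal C) hlim (Or.inr ENNReal.ofReal_ne_top)
  rw [mul_zero] at hl
  refine tendsto_of_tendsto_of_tendsto_of_le_of_le tendsto_const_nhds hl (fun _ => zero_le)
    fun j => ?_
  simp only
  rw [← lintegral_const_mul' _ _ ENNReal.ofReal_ne_top]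
  refine lintegral_mono fun x => ?_
  simp only
  rw [← sub_mul, enorm_mul, mul_comm]
  gcongr
  rw [← ofReal_norm]
  exact ENNReal.ofReal_le_ofReal (hC x)

theorem integral_mul_vdiv_le {v : Eu n → ℝ} (hv : IntegrableOn v Ω)
    (hd : ∀ x ∈ Ω, DifferentiableAt ℝ v x) {V : ℝ} (hV : 0 ≤ V)
    (hg : ∫⁻ x in Ω, ‖fderiv ℝ v x‖ₑ ≤ ENNReal.ofReal V) {Φ : Eu n → Eu n} (h1 : ContDiff ℝ 1 Φ)
    (h2 : HasCompactSupport Φ) (h3 : tsupport Φ ⊆ Ω) (h4 : ∀ x, ‖Φ x‖ ≤ 1) :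
    ∫ x in Ω, v x * vdiv n Φ x ≤ V := by
  have hgi := integrableOn_gradient (hg.trans_lt ENNReal.ofReal_lt_top)
  rw [hasGradMeasure_gradient hv hd hgi Φ h1 h2 h3]
  refine (neg_le_abs _).trans ?_
  refine (norm_integral_le_of_norm_le (f := fun x => ⟪Φ x, gradient v x⟫)
    (g := fun x => ‖gradient v x‖)
    hgi.norm
    (Eventually.of_forall fun x => ?_)).trans ?_
  · exact (norm_inner_le_norm _ _).trans (mul_le_of_le_one_left (norm_nonneg _) (h4 x))
  · rw [integral_norm_eq_lintegral_enorm hgi.1]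
    refine ENNReal.toReal_le_of_le_ofReal hV ?_
    simpa only [enorm_gradient] using hg

/-- Lower semicontinuity of the variation along a sequence `v j → q` which stays uniformly close to
an `L¹`-convergent sequence. -/
theorem exists_isVariationPair_of_tendsto (hΩ : IsOpen Ω) {w v : ℕ → Eu n → ℝ} {w₀ q : Eu n → ℝ}
    (hw : ∀ j, IntegrableOn (w j) Ω) (hw₀ : IntegrableOn w₀ Ω)
    (hlim : Tendsto (fun j => ∫⁻ x in Ω, ‖w j x - w₀ x‖ₑ) atTop (𝓝 0))
    (hwt : ∀ᵐ x ∂volume.restrict Ω, Tendsto (fun j => w j x) atTop (𝓝 (w₀ x)))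
    (hv : ∀ j, IntegrableOn (v j) Ω) (hvd : ∀ j, ∀ x ∈ Ω, DifferentiableAt ℝ (v j) x) {C : ℝ}
    (hvw : ∀ j x, |v j x - w j x| ≤ C) (hq : IntegrableOn q Ω)
    (hvq : ∀ᵐ x ∂volume.restrict Ω, Tendsto (fun j => v j x) atTop (𝓝 (q x))) {V : ℝ} (hV : 0 ≤ V)
    (hg : ∃ᶠ j in atTop, ∫⁻ x in Ω, ‖fderiv ℝ (v j) x‖ₑ ≤ ENNReal.ofReal V) :
    ∃ μ σ, IsVariationPair n q Ω μ σ ∧ μ Set.univ ≤ n * ENNReal.ofReal (3 * V) := by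
  refine exists_isVariationPair_of_le hΩ hq hV fun Φ h1 h2 h3 h4 => ?_
  have t1 := tendsto_integral_mul_vdiv hw hw₀ hlim h1 h2
  have hdi : Integrable (fun x => C * ‖vdiv n Φ x‖) (volume.restrict Ω) :=
    (((continuous_vdiv h1).integrable_of_hasCompactSupport
      (hasCompactSupport_vdiv h2)).norm.const_mul C).integrableOn
  have t2 : Tendsto (fun j => ∫ x in Ω, (v j x - w j x) * vdiv n Φ x) atTop
      (𝓝 (∫ x in Ω, (q x - w₀ x) * vdiv n Φ x)) := by
    refine tendsto_integral_of_dominated_convergence (fun x => C * ‖vdiv n Φ x‖)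
      (fun j => (integrableOn_mul_vdiv ((hv j).sub (hw j)) h1 h2).1) hdi
      (fun j => Eventually.of_forall fun x => ?_) ?_
    · rw [norm_mul]
      exact mul_le_mul_of_nonneg_right (hvw j x) (norm_nonneg _)
    · filter_upwards [hwt, hvq] with x a1 a2
      exact (a2.sub a1).mul_const _
  have t3 := t1.add t2
  have hadd : ∀ {a b : Eu n → ℝ}, IntegrableOn a Ω → IntegrableOn b Ω →
      (∫ x in Ω, a x * vdiv n Φ x) + ∫ x in Ω, (b x - a x) * vdiv n Φ x =
        ∫ x in Ω, b x * vdiv n Φ x := fun {a b} ha hb => by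
    have hba : IntegrableOn (fun x => (b x - a x) * vdiv n Φ x) Ω :=
      integrableOn_mul_vdiv (hb.sub ha) h1 h2
    rw [← integral_add (integrableOn_mul_vdiv ha h1 h2) hba]
    congr 1; ext x; ring
  rw [hadd hw₀ hq] at t3
  simp only [hadd (hw _) (hv _)] at t3
  exact le_of_tendsto_of_frequently t3 (hg.mono fun j hj =>
    integral_mul_vdiv_le (hv j) (hvd j) hV hj h1 h2 h3 h4)

end LowerSemicontinuity

section Staircase

/-- An unnormalized periodic bump, supported in the `h`-neighbourhood of the integers. -/
def periodicBump (h s : ℝ) : ℝ :=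
  max 0 (Real.cos (2 * Real.pi * s) - Real.cos (2 * Real.pi * h))

theorem continuous_periodicBump (h : ℝ) : Continuous (periodicBump h) := by
  unfold periodicBump; fun_prop

theorem periodicBump_nonneg (h s : ℝ) : 0 ≤ periodicBump h s := le_max_left _ _

theorem periodicBump_periodic (h : ℝ) : Function.Periodic (periodicBump h) 1 := fun s => by
  unfold periodicBump
  rw [mul_add, mul_one, Real.cos_add_two_pi]

theorem periodicBump_le (h s : ℝ) : periodicBump h s ≤ 2 := by
  have a := Real.cos_le_one (2 * Real.pi * s)
  have b := Real.neg_one_le_cos (2 * Real.pi * h)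
  exact max_le (by norm_num) (by linarith)

theorem periodicBump_eq_zero {h s : ℝ} (hh : 0 < h) (h1 : h ≤ s) (h2 : s ≤ 1 - h) :
    periodicBump h s = 0 := by
  have hpi := Real.pi_pos
  have key : ∀ t, h ≤ t → t ≤ 1 / 2 → Real.cos (2 * Real.pi * t) ≤ Real.cos (2 * Real.pi * h) :=
    fun t h1 h2 => Real.cos_le_cos_of_nonneg_of_le_pi (by positivity) (by nlinarith) (by nlinarith)
  refine max_eq_left ?_
  rw [sub_nonpos]
  rcases le_total s (1 / 2) with hs | hs
  · exact key s h1 hs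
  · have := key (1 - s) (by linarith) (by linarith)
    rwa [mul_sub, mul_one, Real.cos_two_pi_sub] at this

theorem integral_periodicBump_pos {h : ℝ} (hh : 0 < h) (h1 : h ≤ 1 / 2) :
    0 < ∫ s in (0:ℝ)..1, periodicBump h s := by
  have hpi := Real.pi_pos
  refine intervalIntegral.integral_pos (by norm_num) (continuous_periodicBump h).continuousOn
    (fun s _ => periodicBump_nonneg h s) ⟨0, by simp, ?_⟩
  refine lt_max_of_lt_right (sub_pos.2 ?_)
  exact Real.cos_lt_cos_of_nonneg_of_le_pi (by simp) (by nlinarith) (by nlinarith)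

/-- The periodic bump, normalized to have integral one on a period. -/
def stairDensity (h s : ℝ) : ℝ := (∫ s in (0:ℝ)..1, periodicBump h s)⁻¹ * periodicBump h s

variable {h : ℝ}

theorem continuous_stairDensity (h : ℝ) : Continuous (stairDensity h) :=
  continuous_const.mul (continuous_periodicBump h)

theorem stairDensity_nonneg (hh : 0 < h) (h1 : h ≤ 1 / 2) (s : ℝ) : 0 ≤ stairDensity h s :=
  mul_nonneg (inv_nonneg.2 (integral_periodicBump_pos hh h1).le) (periodicBump_nonneg h s)

theorem stairDensity_periodic (h : ℝ) : Function.Periodic (stairDensity h) 1 := fun s => by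
  unfold stairDensity; rw [periodicBump_periodic h s]

theorem exists_stairDensity_le (h : ℝ) : ∃ B, ∀ s, |stairDensity h s| ≤ B :=
  ⟨|(∫ s in (0:ℝ)..1, periodicBump h s)⁻¹| * 2, fun s => by
    unfold stairDensity
    rw [abs_mul, abs_of_nonneg (periodicBump_nonneg h s)]
    exact mul_le_mul_of_nonneg_left (periodicBump_le h s) (abs_nonneg _)⟩

theorem stairDensity_eq_zero (hh : 0 < h) {s : ℝ} {k : ℤ} (h1 : h ≤ s - k) (h2 : s - k ≤ 1 - h) :
    stairDensity h s = 0 := by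
  have := (stairDensity_periodic h).sub_int_mul_eq (x := s) k
  rw [mul_one] at this
  rw [← this, stairDensity, periodicBump_eq_zero hh h1 h2, mul_zero]

theorem integral_stairDensity (hh : 0 < h) (h1 : h ≤ 1 / 2) (a : ℝ) :
    ∫ s in a..(a + 1), stairDensity h s = 1 := by
  rw [(stairDensity_periodic h).intervalIntegral_add_eq a 0, zero_add]
  unfold stairDensity
  rw [intervalIntegral.integral_const_mul, inv_mul_cancel₀ (integral_periodicBump_pos hh h1).ne']

/-- A smoothed staircase, with steps at the integers of width `h`. -/
def stair (h s : ℝ) : ℝ := ∫ r in (-(1 / 2):ℝ)..s, stairDensity h r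

theorem hasDerivAt_stair (h s : ℝ) : HasDerivAt (stair h) (stairDensity h s) s :=
  (continuous_stairDensity h).integral_hasStrictDerivAt _ s |>.hasDerivAt

theorem stair_sub (h a b : ℝ) : stair h b - stair h a = ∫ r in a..b, stairDensity h r := by
  have hi : ∀ a b, IntervalIntegrable (stairDensity h) volume a b :=
    (continuous_stairDensity h).intervalIntegrable
  exact intervalIntegral.integral_interval_sub_left (hi _ _) (hi _ _)

theorem stair_add_one (hh : 0 < h) (h1 : h ≤ 1 / 2) (s : ℝ) : stair h (s + 1) = stair h s + 1 := by
  have := stair_sub h s (s + 1)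
  rw [integral_stairDensity hh h1] at this
  linarith

theorem stair_add_int (hh : 0 < h) (h1 : h ≤ 1 / 2) (s : ℝ) (k : ℤ) :
    stair h (s + k) = stair h s + k := by
  induction k using Int.induction_on with
  | zero => simp
  | succ i hi => push_cast at hi ⊢; rw [← add_assoc, stair_add_one hh h1, hi, add_assoc]
  | pred i hi =>
    have := stair_add_one hh h1 (s + ((-(i:ℤ) - 1 : ℤ) : ℝ))
    push_cast at hi this ⊢
    rw [show s + (-(i:ℝ) - 1) + 1 = s + -(i:ℝ) by ring, hi] at this
    linarith

theorem stair_neg_half (h : ℝ) : stair h (-(1 / 2)) = 0 := intervalIntegral.integral_same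

theorem stair_int_sub_half (hh : 0 < h) (h1 : h ≤ 1 / 2) (k : ℤ) : stair h (k - 1 / 2) = k := by
  have := stair_add_int hh h1 (-(1 / 2)) k
  rwa [stair_neg_half, zero_add, neg_add_eq_sub] at this

theorem stair_mono (hh : 0 < h) (h1 : h ≤ 1 / 2) : Monotone (stair h) := fun a b hab => by
  rw [← sub_nonneg, stair_sub]
  exact intervalIntegral.integral_nonneg hab fun s _ => stairDensity_nonneg hh h1 s

theorem stair_eq (hh : 0 < h) (h1 : h ≤ 1 / 2) {s : ℝ} {k : ℤ} (hs1 : h ≤ s - k)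
    (hs2 : s - k ≤ 1 - h) : stair h s = k + 1 := by
  have e : stair h s - stair h (k + 1 / 2) = 0 := by
    rw [stair_sub, intervalIntegral.integral_congr (g := fun _ => 0),
      intervalIntegral.integral_zero]
    intro r hr
    rw [Set.mem_uIcc] at hr
    refine stairDensity_eq_zero (k := k) hh ?_ ?_ <;> rcases hr with hr | hr <;>
      linarith [hr.1, hr.2]
  have := stair_int_sub_half hh h1 (k + 1)
  push_cast at this
  rw [show (k:ℝ) + 1 - 1 / 2 = k + 1 / 2 by ring] at this
  linarith

theorem abs_stair_sub_le (hh : 0 < h) (h1 : h ≤ 1 / 2) (s : ℝ) : |stair h s - s| ≤ 2 := by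
  have a1 := stair_int_sub_half hh h1 ⌊s⌋
  have a2 := stair_int_sub_half hh h1 (⌊s⌋ + 2)
  have a3 := stair_mono hh h1 (show (⌊s⌋:ℝ) - 1 / 2 ≤ s by linarith [Int.floor_le s])
  have a4 := stair_mono hh h1 (show s ≤ ((⌊s⌋ + 2 : ℤ):ℝ) - 1 / 2 by
    push_cast; linarith [Int.lt_floor_add_one s])
  push_cast at a2 a4
  exact abs_le.2 ⟨by linarith [Int.lt_floor_add_one s], by linarith [Int.floor_le s]⟩

theorem lintegral_stairDensity_le (hh : 0 < h) (h1 : h ≤ 1 / 2) (r : ℝ) :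
    ∫⁻ t in Set.Icc (1 / 4 : ℝ) (3 / 4), ENNReal.ofReal (stairDensity h (r - t)) ≤ 1 := by
  have hc : Continuous fun t => stairDensity h (r - t) :=
    (continuous_stairDensity h).comp (by fun_prop)
  calc ∫⁻ t in Set.Icc (1 / 4 : ℝ) (3 / 4), ENNReal.ofReal (stairDensity h (r - t))
      ≤ ∫⁻ t in Set.Ioc (0 : ℝ) 1, ENNReal.ofReal (stairDensity h (r - t)) :=
        lintegral_mono_set fun t ht => ⟨by linarith [ht.1], by linarith [ht.2]⟩
    _ = ENNReal.ofReal (∫ t in (0:ℝ)..1, stairDensity h (r - t)) := by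
        rw [intervalIntegral.integral_of_le zero_le_one, ofReal_integral_eq_lintegral_ofReal
          (hc.integrableOn_Ioc) (Eventually.of_forall fun t => stairDensity_nonneg hh h1 _)]
    _ = 1 := by
        rw [intervalIntegral.integral_comp_sub_left, sub_zero]
        have := integral_stairDensity hh h1 (r - 1)
        rw [sub_add_cancel] at this
        rw [this, ENNReal.ofReal_one]

/-- The smoothed staircase with steps of height `δ` at the points `δ (k + t)`. -/
def stairMap (δ t h s : ℝ) : ℝ := δ * stair h (s / δ - t)

/-- The staircase with steps of height `δ` at the points `δ (k + t)`. -/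
def roundMap (δ t s : ℝ) : ℝ := δ * (⌊s / δ - t⌋ + 1)

variable {δ t : ℝ}

theorem hasDerivAt_stairMap (hδ : 0 < δ) (s : ℝ) :
    HasDerivAt (stairMap δ t h) (stairDensity h (s / δ - t)) s := by
  have h1 : HasDerivAt (fun s => s / δ - t) (1 / δ) s :=
    ((hasDerivAt_id s).div_const δ).sub_const t
  have h2 := ((hasDerivAt_stair h (s / δ - t)).comp s h1).const_mul δ
  have e : δ * (stairDensity h (s / δ - t) * (1 / δ)) = stairDensity h (s / δ - t) := by field_simp
  rw [e] at h2
  exact h2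

theorem abs_stairMap_sub_le (hδ : 0 < δ) (hh : 0 < h) (h1 : h ≤ 1 / 2) (ht : 0 ≤ t) (ht1 : t ≤ 1)
    (s : ℝ) : |stairMap δ t h s - s| ≤ 3 * δ := by
  have e : stairMap δ t h s - s = δ * (stair h (s / δ - t) - (s / δ - t) - t) := by
    unfold stairMap; field_simp; ring
  rw [e, abs_mul, abs_of_pos hδ, mul_comm]
  refine mul_le_mul_of_nonneg_right ?_ hδ.le
  have := abs_le.1 (abs_stair_sub_le hh h1 (s / δ - t))
  exact abs_le.2 ⟨by linarith [this.1], by linarith [this.2]⟩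

theorem stairMap_eq_zero (hδ : 0 < δ) (hh : 0 < h) (h1 : h ≤ 1 / 2) (ht : h + 1 / 8 ≤ t)
    (ht1 : t ≤ 1 - h - 1 / 8) {s : ℝ} (hs : |s| ≤ δ / 8) :
    stairMap δ t h s = 0 ∧ stairDensity h (s / δ - t) = 0 := by
  have hs := abs_le.1 hs
  have a1 : -(1 / 8) ≤ s / δ := by rw [le_div_iff₀ hδ]; linarith
  have a2 : s / δ ≤ 1 / 8 := by rw [div_le_iff₀ hδ]; linarith
  have b1 : h ≤ s / δ - t - ((-1 : ℤ) : ℝ) := by push_cast; linarith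
  have b2 : s / δ - t - ((-1 : ℤ) : ℝ) ≤ 1 - h := by push_cast; linarith
  refine ⟨?_, stairDensity_eq_zero hh b1 b2⟩
  rw [stairMap, stair_eq hh h1 b1 b2]
  simp

theorem abs_stairMap_le (hδ : 0 < δ) (hh : 0 < h) (h1 : h ≤ 1 / 2) (ht : h + 1 / 8 ≤ t)
    (ht1 : t ≤ 1 - h - 1 / 8) (s : ℝ) : |stairMap δ t h s| ≤ 25 * |s| := by
  rcases le_total |s| (δ / 8) with hs | hs
  · rw [(stairMap_eq_zero hδ hh h1 ht ht1 hs).1, abs_zero]; positivity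
  · have a := abs_stairMap_sub_le hδ hh h1 (t := t) (by linarith) (by linarith) s
    have b := abs_add_le (stairMap δ t h s - s) s
    rw [sub_add_cancel] at b
    linarith

theorem stairMap_mul_int (hδ : 0 < δ) (hh : 0 < h) (h1 : h ≤ 1 / 2) (k : ℤ) :
    stairMap δ (1 / 2) h (δ * k) = δ * k := by
  rw [stairMap, mul_div_cancel_left₀ _ hδ.ne', stair_int_sub_half hh h1]

theorem stairDensity_eq_zero_of_near_int (hδ : 0 < δ) {s : ℝ} {k : ℤ} (hs : |s - δ * k| ≤ δ / 4) :
    stairDensity (1 / 4) (s / δ - 1 / 2) = 0 := by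
  have hs := abs_le.1 hs
  have e : s / δ - k = (s - δ * k) / δ := by field_simp
  have a1 : -(1 / 4) ≤ s / δ - k := by rw [e, le_div_iff₀ hδ]; linarith
  have a2 : s / δ - k ≤ 1 / 4 := by rw [e, div_le_iff₀ hδ]; linarith
  refine stairDensity_eq_zero (k := k - 1) (by norm_num) ?_ ?_ <;> push_cast <;> linarith

theorem abs_roundMap_sub_le (hδ : 0 < δ) (ht : 0 ≤ t) (ht1 : t ≤ 1) (s : ℝ) :
    |roundMap δ t s - s| ≤ δ := by
  have e : roundMap δ t s - s = δ * (⌊s / δ - t⌋ + 1 - (s / δ - t) - t) := by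
    unfold roundMap; field_simp; ring
  rw [e, abs_mul, abs_of_pos hδ]
  refine mul_le_of_le_one_right hδ.le ?_
  exact abs_le.2 ⟨by linarith [Int.lt_floor_add_one (s / δ - t)],
    by linarith [Int.floor_le (s / δ - t)]⟩

theorem abs_roundMap_le (hδ : 0 < δ) (ht : 1 / 4 ≤ t) (ht1 : t ≤ 3 / 4) (s : ℝ) :
    |roundMap δ t s| ≤ 5 * |s| := by
  rcases lt_or_ge |s| (δ / 4) with hs | hs
  · have hs := abs_lt.1 hs
    have a1 : -(1 / 4) < s / δ := by rw [lt_div_iff₀ hδ]; linarith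
    have a2 : s / δ < 1 / 4 := by rw [div_lt_iff₀ hδ]; linarith
    have : ⌊s / δ - t⌋ = -1 := by
      rw [Int.floor_eq_iff]; push_cast; constructor <;> linarith
    rw [roundMap, this]
    simp
  · have a := abs_roundMap_sub_le hδ (t := t) (by linarith) (by linarith) s
    have b := abs_add_le (roundMap δ t s - s) s
    rw [sub_add_cancel] at b
    linarith

theorem measurable_roundMap : Measurable (roundMap δ t) := by
  unfold roundMap
  have : Measurable fun s : ℝ => (⌊s / δ - t⌋ : ℝ) :=
    (measurable_from_top (f := fun z : ℤ => (z : ℝ))).comp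
      (Int.measurable_floor.comp (by fun_prop))
  fun_prop

theorem tendsto_stairMap {a h : ℕ → ℝ} {s : ℝ} (ha : Tendsto a atTop (𝓝 s))
    (hs : ∀ k : ℤ, s / δ - t ≠ k) (hh : ∀ j, 0 < h j) (hh1 : ∀ j, h j ≤ 1 / 2)
    (hlim : Tendsto h atTop (𝓝 0)) :
    Tendsto (fun j => stairMap δ t (h j) (a j)) atTop (𝓝 (roundMap δ t s)) := by
  set k := ⌊s / δ - t⌋ with hk
  have a1 : 0 < s / δ - t - k := by
    rcases (Int.floor_le (s / δ - t)).lt_or_eq with h | h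
    · linarith
    · exact absurd h.symm (hs _)
  have a2 : s / δ - t - k < 1 := by linarith [Int.lt_floor_add_one (s / δ - t)]
  have l1 : Tendsto (fun j => a j / δ - t - k) atTop (𝓝 (s / δ - t - k)) :=
    ((ha.div_const δ).sub_const t).sub_const _
  have l2 : Tendsto (fun j => a j / δ - t - k - h j) atTop (𝓝 (s / δ - t - k - 0)) := l1.sub hlim
  have l3 : Tendsto (fun j => a j / δ - t - k + h j) atTop (𝓝 (s / δ - t - k + 0)) := l1.add hlim
  refine tendsto_const_nhds.congr' ?_
  filter_upwards [l2.eventually_const_lt (show 0 < s / δ - t - k - 0 by linarith),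
    l3.eventually_lt_const (show s / δ - t - k + 0 < 1 by linarith)] with j b1 b2
  rw [stairMap, stair_eq (hh j) (hh1 j) (k := k) (by linarith) (by linarith), roundMap, hk]

end Staircase

section Quantized

variable {n : ℕ} {f d q : Eu n → ℝ} {Ω U : Set (Eu n)} {μ : Measure (Eu n)} {σ : Eu n → Eu n}
  {δ : ℝ}

theorem IsVariationPair.restrict (h : IsVariationPair n f Ω μ σ) (hΩ : MeasurableSet Ω)
    (hU : IsOpen U) (hUΩ : U ⊆ Ω) : IsVariationPair n f U (μ.restrict U) σ := by
  have := h.1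
  refine ⟨inferInstance, ?_, h.2.2.1.restrict, ae_restrict_of_ae h.2.2.2.1, ?_⟩
  · rw [Measure.restrict_apply hU.measurableSet.compl, Set.compl_inter_self, measure_empty]
  · intro Φ h1 h2 h3
    have hΦ : ∀ x ∉ U, x ∉ tsupport Φ := fun x hx hx' => hx (h3 hx')
    have e1 : ∫ x in U, f x * vdiv n Φ x = ∫ x in Ω, f x * vdiv n Φ x :=
      (setIntegral_eq_of_subset_of_forall_sdiff_eq_zero hΩ hUΩ fun x hx => by
        rw [image_eq_zero_of_notMem_tsupport fun hx' => hΦ x hx.2 (tsupport_vdiv_subset Φ hx'),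
          mul_zero]).symm
    have e2 : ∫ x in U, ⟪Φ x, σ x⟫ ∂μ = ∫ x, ⟪Φ x, σ x⟫ ∂μ :=
      setIntegral_eq_integral_of_forall_compl_eq_zero fun x hx => by
        rw [image_eq_zero_of_notMem_tsupport (hΦ x hx), inner_zero_left]
    rw [e1, e2]
    exact h.2.2.2.2 Φ h1 h2 (h3.trans hUΩ)

theorem scaleMol_continuousOn (h : IsScale n d Ω) (hf : Integrable f) {ε : ℝ} (hε : 0 < ε) :
    ContinuousOn (scaleMol f d ε) Ω := fun _ hx =>
  (scaleMol_differentiableAt h hf hε hx).continuousAt.continuousWithinAt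

theorem hasFDerivAt_stairMap_comp {u : Eu n → ℝ} {t s : ℝ} (hδ : 0 < δ) {x : Eu n}
    (hu : DifferentiableAt ℝ u x) : HasFDerivAt (fun x => stairMap δ t s (u x))
      (stairDensity s (u x / δ - t) • fderiv ℝ u x) x :=
  (hasDerivAt_stairMap hδ (u x)).comp_hasFDerivAt x hu.hasFDerivAt

theorem enorm_fderiv_stairMap_comp {u : Eu n → ℝ} {t s : ℝ} (hδ : 0 < δ) {x : Eu n}
    (hu : DifferentiableAt ℝ u x) : ‖fderiv ℝ (fun x => stairMap δ t s (u x)) x‖ₑ =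
      ‖stairDensity s (u x / δ - t)‖ₑ * ‖fderiv ℝ u x‖ₑ := by
  rw [(hasFDerivAt_stairMap_comp hδ hu).fderiv, enorm_smul]

theorem continuous_stairMap {t s : ℝ} (hδ : 0 < δ) : Continuous (stairMap δ t s) :=
  continuous_iff_continuousAt.2 fun r => (hasDerivAt_stairMap hδ r).continuousAt

theorem integrableOn_stairMap_comp {u : Eu n → ℝ} {t s : ℝ} (hδ : 0 < δ) (hs : 0 < s)
    (h1 : s ≤ 1 / 2) (ht : s + 1 / 8 ≤ t) (ht1 : t ≤ 1 - s - 1 / 8) (hu : IntegrableOn u Ω) :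
    IntegrableOn (fun x => stairMap δ t s (u x)) Ω := by
  refine (hu.norm.const_mul 25).mono'
    ((continuous_stairMap hδ).comp_aestronglyMeasurable hu.aestronglyMeasurable)
    (Eventually.of_forall fun x => ?_)
  exact abs_stairMap_le hδ hs h1 ht ht1 (u x)

theorem eq_mul_int_of_tendsto_osc (hq : Integrable q) (hδ : 0 < δ) (hqδ : ∀ x, ∃ k : ℤ, q x = δ * k)
    {c : ℝ} {y : Eu n} (hc : Tendsto (fun r => osc q c y r) (𝓝[>] 0) (𝓝 0)) :
    ∃ k : ℤ, c = δ * k := by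
  refine ⟨round (c / δ), ?_⟩
  have key : ∀ z, |c - δ * round (c / δ)| ≤ |q z - c| := fun z => by
    obtain ⟨k, hk⟩ := hqδ z
    have e : ∀ k : ℤ, |c - δ * k| = δ * |c / δ - k| := fun k => by
      rw [← abs_of_pos hδ, ← abs_mul, abs_of_pos hδ]; congr 1; field_simp
    rw [abs_sub_comm (q z), hk, e, e]
    exact mul_le_mul_of_nonneg_left (round_le _ _) hδ.le
  have : |c - δ * round (c / δ)| ≤ 0 := by
    refine ge_of_tendsto hc ?_
    filter_upwards [self_mem_nhdsWithin] with r hr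
    have hr : 0 < r := hr
    rw [← osc_const (n := n) c _ y hr, osc_eq _ _ _ hr]
    have := ballVol_pos (n := n)
    refine mul_le_mul_of_nonneg_left (setIntegral_mono ?_ (integrableOn_abs_sub hq c y r) key)
      (by positivity)
    exact integrableOn_const measure_ball_lt_top.ne
  have := abs_nonpos_iff.1 this
  linarith

theorem exists_measure_le_of_quantized (hΩ : IsOpen Ω) (hq : Integrable q)
    (hm : StronglyMeasurable q) (hδ : 0 < δ)
    (hqδ : ∀ x, ∃ k : ℤ, q x = δ * k) (hv : IsVariationPair n q Ω μ σ) :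
    ∃ C : ℝ≥0∞, C ≠ ⊤ ∧ ∀ U, IsOpen U → U ⊆ Ω → ∀ η : ℝ≥0∞, 0 < η → η ≠ ⊤ →
      μ U ≤ C * (ENNReal.ofReal (2 * 3 ^ n) * μ (U ∩ approxDiscontSet n q) + η) := by
  have := hv.1
  obtain ⟨B, hB⟩ := exists_stairDensity_le (1 / 4)
  refine ⟨n * (3 * ENNReal.ofReal B), by finiteness, fun U hU hUΩ η hη hη' => ?_⟩
  obtain ⟨d, hd⟩ := exists_isScale hU
  have hvU := hv.restrict hΩ.measurableSet hU hUΩ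
  set a := dyadicScale
  set w : ℕ → Eu n → ℝ := fun k => scaleMol q d (a k) with hw
  set A : ℕ → Set (Eu n) := fun k =>
    U ∩ w k ⁻¹' {s | stairDensity (1 / 4) (s / δ - 1 / 2) ≠ 0} with hA
  have hwd : ∀ k, ∀ x ∈ U, DifferentiableAt ℝ (w k) x := fun k x hx =>
    scaleMol_differentiableAt hd hq (dyadicScale_pos k) hx
  have hAm : ∀ k, MeasurableSet (A k) := fun k => by
    refine ((scaleMol_continuousOn hd hq (dyadicScale_pos k)).isOpen_inter_preimage hU
      (isOpen_ne_fun ?_ continuous_const)).measurableSet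
    exact (continuous_stairDensity _).comp (by fun_prop)
  have hSm := measurableSet_approxDiscontSet hq hm
  have hcon := eventually_setLIntegral_fderiv_le hd hq hvU hSm dyadicScale_pos dyadicScale_le hAm
    (fun k => Set.inter_subset_left) (by
      intro y hy
      obtain ⟨c, hc⟩ := not_not.1 hy.2
      change Tendsto (fun r => osc q c y r) (𝓝[>] 0) (𝓝 0) at hc
      obtain ⟨k, rfl⟩ := eq_mul_int_of_tendsto_osc hq hδ hqδ hc
      have h1 := (tendsto_osc_scale hd hy.1 hc tendsto_dyadicScale dyadicScale_pos).const_mul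
        (bumpConst n * ballVol n * 8 ^ n)
      rw [mul_zero] at h1
      refine tendsto_const_nhds.congr' ?_
      filter_upwards [h1.eventually_le_const (show 0 < δ / 4 by positivity)] with j hj
      symm
      rw [setLIntegral_congr_fun (g := fun _ => 0) (hAm j), lintegral_zero]
      intro x hx
      refine scaleKer_eq_zero hd (dyadicScale_pos j) hx.1 ?_
      by_contra! hlt
      refine hx.2 (stairDensity_eq_zero_of_near_int hδ (k := k) ?_)
      exact (abs_scaleMol_sub_le hd hq _ (dyadicScale_pos j) (dyadicScale_le j) hx.1 hlt.le).trans
        hj) hη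
  rw [Measure.restrict_apply hSm, Set.inter_comm] at hcon
  set X := ENNReal.ofReal (2 * 3 ^ n) * μ (U ∩ approxDiscontSet n q) + η with hX
  have hXt : ENNReal.ofReal B * X ≠ ⊤ := by finiteness
  obtain ⟨ν, τ, hν, hνX⟩ := exists_isVariationPair_of_tendsto hU
    (w := w) (v := fun k x => stairMap δ (1 / 2) (1 / 4) (w k x)) (w₀ := q) (q := q)
    (C := 3 * δ) (V := (ENNReal.ofReal B * X).toReal)
    (fun k => scaleMol_integrableOn hd hq hvU (dyadicScale_pos k) (dyadicScale_le k))
    hq.integrableOn (by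
      have := tendsto_setLIntegral_scaleMol_sub hd hq hvU tendsto_dyadicScale dyadicScale_pos
        dyadicScale_le
      refine this.congr fun k => lintegral_congr fun x => ?_
      rw [← enorm_neg, neg_sub])
    (by
      rw [ae_restrict_iff' hU.measurableSet]
      exact ae_tendsto_scaleMol hd hq tendsto_dyadicScale dyadicScale_pos dyadicScale_le)
    (fun k => integrableOn_stairMap_comp hδ (by norm_num) (by norm_num) (by norm_num) (by norm_num)
      (scaleMol_integrableOn hd hq hvU (dyadicScale_pos k) (dyadicScale_le k)))
    (fun k x hx => (hasFDerivAt_stairMap_comp hδ (hwd k x hx)).differentiableAt)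
    (fun k x => abs_stairMap_sub_le hδ (by norm_num) (by norm_num) (by norm_num) (by norm_num) _)
    hq.integrableOn (by
      rw [ae_restrict_iff' hU.measurableSet]
      filter_upwards [ae_tendsto_scaleMol hd hq tendsto_dyadicScale dyadicScale_pos
        dyadicScale_le] with x hx hxU
      have := ((continuous_stairMap (t := 1 / 2) (s := 1 / 4) hδ).tendsto (q x)).comp (hx hxU)
      obtain ⟨k, hk⟩ := hqδ x
      rw [hk, stairMap_mul_int hδ (by norm_num) (by norm_num), ← hk] at this
      exact this)
    ENNReal.toReal_nonneg (by
      refine (hcon.mono fun k hk => ?_).frequently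
      rw [ENNReal.ofReal_toReal hXt]
      calc ∫⁻ x in U, ‖fderiv ℝ (fun x => stairMap δ (1 / 2) (1 / 4) (w k x)) x‖ₑ
          = ∫⁻ x in U, ‖stairDensity (1 / 4) (w k x / δ - 1 / 2)‖ₑ * ‖fderiv ℝ (w k) x‖ₑ :=
            setLIntegral_congr_fun hU.measurableSet fun x hx =>
              enorm_fderiv_stairMap_comp hδ (hwd k x hx)
        _ ≤ ∫⁻ x in A k, ENNReal.ofReal B * ‖fderiv ℝ (w k) x‖ₑ := by
            rw [← lintegral_indicator hU.measurableSet, ← lintegral_indicator (hAm k)]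
            refine lintegral_mono fun x => ?_
            by_cases hxU : x ∈ U
            · rw [Set.indicator_of_mem hxU]
              by_cases hxA : stairDensity (1 / 4) (w k x / δ - 1 / 2) = 0
              · rw [hxA, enorm_zero, zero_mul]; exact zero_le
              · rw [Set.indicator_of_mem (show x ∈ A k from ⟨hxU, hxA⟩)]
                gcongr
                rw [← ofReal_norm]
                exact ENNReal.ofReal_le_ofReal (hB _)
            · rw [Set.indicator_of_notMem hxU]; exact zero_le
        _ ≤ ENNReal.ofReal B * X := by
            rw [lintegral_const_mul' _ _ ENNReal.ofReal_ne_top]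
            gcongr)
  rw [← hvU.measure_eq hU hν, Measure.restrict_apply_univ, ENNReal.ofReal_mul (by norm_num),
    ENNReal.ofReal_toReal hXt, ENNReal.ofReal_ofNat] at hνX
  simpa only [mul_assoc] using hνX

theorem measure_diff_approxDiscontSet_of_quantized (hΩ : IsOpen Ω) (hq : Integrable q)
    (hm : StronglyMeasurable q) (hδ : 0 < δ)
    (hqδ : ∀ x, ∃ k : ℤ, q x = δ * k) (hv : IsVariationPair n q Ω μ σ) :
    μ (Ω \ approxDiscontSet n q) = 0 := by
  have := hv.1
  obtain ⟨C, hC, H⟩ := exists_measure_le_of_quantized hΩ hq hm hδ hqδ hv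
  have hSm := measurableSet_approxDiscontSet hq hm
  set S := approxDiscontSet n q
  set D := ENNReal.ofReal (2 * 3 ^ n) with hD
  have key : ∀ ε : ℝ≥0∞, 0 < ε → ε ≠ ⊤ → μ (Ω \ S) ≤ C * (D * ε + ε) := by
    intro ε hε hε'
    obtain ⟨V, hV1, hV2, hV3⟩ := (Ω \ S).exists_isOpen_lt_add (measure_ne_top μ _) hε.ne'
    have h1 : Ω \ S ⊆ V ∩ Ω := fun x hx => ⟨hV1 hx, hx.1⟩
    have h2 : μ (Ω \ S) + μ ((V ∩ Ω) ∩ S) ≤ μ (Ω \ S) + ε := by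
      rw [← measure_union (Set.disjoint_left.2 fun x hx hx' => hx.2 hx'.2)
        ((hV2.inter hΩ).measurableSet.inter hSm)]
      refine (measure_mono ?_).trans hV3.le
      exact Set.union_subset hV1 fun x hx => hx.1.1
    have h3 := (ENNReal.add_le_add_iff_left (measure_ne_top μ _)).1 h2
    calc μ (Ω \ S) ≤ μ (V ∩ Ω) := measure_mono h1
      _ ≤ C * (D * μ ((V ∩ Ω) ∩ S) + ε) :=
          H _ (hV2.inter hΩ) Set.inter_subset_right ε hε hε'
      _ ≤ C * (D * ε + ε) := by gcongr
  have hlim : Tendsto (fun ε : ℝ≥0∞ => C * (D * ε + ε)) (𝓝[>] 0) (𝓝 (C * (D * 0 + 0))) := by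
    refine ENNReal.Tendsto.const_mul ?_ (Or.inr hC)
    exact (ENNReal.Tendsto.const_mul tendsto_id (Or.inr ENNReal.ofReal_ne_top)).add tendsto_id
      |>.mono_left nhdsWithin_le_nhds
  rw [mul_zero, add_zero, mul_zero] at hlim
  refine le_antisymm (ge_of_tendsto hlim ?_) zero_le
  filter_upwards [self_mem_nhdsWithin, nhdsWithin_le_nhds (gt_mem_nhds (zero_lt_one (α := ℝ≥0∞)))]
    with ε h1 h2
  exact key ε h1 (h2.trans ENNReal.one_lt_top).ne

end Quantized

section Rounding

variable {n : ℕ} {f d : Eu n → ℝ} {Ω : Set (Eu n)} {μ : Measure (Eu n)} {σ : Eu n → Eu n}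
  {δ : ℝ}

/-- The difference of two mollifications at different scales. -/
def scaleDiff (f d : Eu n → ℝ) (ε ε' : ℝ) (x : Eu n) : ℝ := scaleMol f d ε' x - scaleMol f d ε x

theorem scaleDiff_differentiableAt (h : IsScale n d Ω) (hf : Integrable f) {ε ε' : ℝ} (hε : 0 < ε)
    (hε' : 0 < ε') {x : Eu n} (hx : x ∈ Ω) : DifferentiableAt ℝ (scaleDiff f d ε ε') x :=
  (scaleMol_differentiableAt h hf hε' hx).sub (scaleMol_differentiableAt h hf hε hx)

theorem enorm_fderiv_scaleDiff_le (h : IsScale n d Ω) (hf : Integrable f) {ε ε' : ℝ} (hε : 0 < ε)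
    (hε' : 0 < ε') {x : Eu n} (hx : x ∈ Ω) : ‖fderiv ℝ (scaleDiff f d ε ε') x‖ₑ ≤
      ‖fderiv ℝ (scaleMol f d ε') x‖ₑ + ‖fderiv ℝ (scaleMol f d ε) x‖ₑ := by
  have e : fderiv ℝ (scaleDiff f d ε ε') x =
      fderiv ℝ (scaleMol f d ε') x - fderiv ℝ (scaleMol f d ε) x :=
    fderiv_fun_sub (scaleMol_differentiableAt h hf hε' hx) (scaleMol_differentiableAt h hf hε hx)
  rw [e]
  exact enorm_sub_le

/-- The set where two mollifications differ by more than `δ / 8`. -/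
def farSet (f d : Eu n → ℝ) (Ω : Set (Eu n)) (δ ε ε' : ℝ) : Set (Eu n) :=
  Ω ∩ scaleDiff f d ε ε' ⁻¹' {s | δ / 8 < |s|}

theorem measurableSet_farSet (h : IsScale n d Ω) (hf : Integrable f) {ε ε' : ℝ} (hε : 0 < ε)
    (hε' : 0 < ε') : MeasurableSet (farSet f d Ω δ ε ε') := by
  have hc : ContinuousOn (scaleDiff f d ε ε') Ω := fun x hx =>
    (scaleDiff_differentiableAt h hf hε hε' hx).continuousAt.continuousWithinAt
  exact (hc.isOpen_inter_preimage h.isOpen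
    (isOpen_lt continuous_const continuous_abs)).measurableSet

theorem eventually_setLIntegral_farSet_le (h : IsScale n d Ω) (hf : Integrable f)
    (hv : IsVariationPair n f Ω μ σ) (hS : MeasurableSet (approxDiscontSet n f)) (hδ : 0 < δ)
    {a b : ℕ → ℝ} (ha : Tendsto a atTop (𝓝 0)) (ha1 : ∀ k, a k ≤ 1 / 2) (hb0 : ∀ k, 0 < b k)
    (hba : ∀ k, b k ≤ a k) {η : ℝ≥0∞} (hη : 0 < η) : ∀ᶠ k in atTop,
      ∫⁻ x in farSet f d Ω δ (a k) (b k), ‖fderiv ℝ (scaleDiff f d (a k) (b k)) x‖ₑ ≤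
        2 * (ENNReal.ofReal (2 * 3 ^ n) * μ (approxDiscontSet n f) + η) := by
  have ha0 : ∀ k, 0 < a k := fun k => (hb0 k).trans_le (hba k)
  have hb1 : ∀ k, b k ≤ 1 / 2 := fun k => (hba k).trans (ha1 k)
  have hb : Tendsto b atTop (𝓝 0) := squeeze_zero (fun k => (hb0 k).le) hba ha
  have hAm : ∀ k, MeasurableSet (farSet f d Ω δ (a k) (b k)) := fun k =>
    measurableSet_farSet h hf (ha0 k) (hb0 k)
  have hAΩ : ∀ k, farSet f d Ω δ (a k) (b k) ⊆ Ω := fun k => Set.inter_subset_left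
  have c1 := eventually_setLIntegral_fderiv_le h hf hv hS hb0 hb1 hAm hAΩ (by
    intro y hy
    obtain ⟨c, hc⟩ := not_not.1 hy.2
    change Tendsto (fun r => osc f c y r) (𝓝[>] 0) (𝓝 0) at hc
    have h1 := (tendsto_osc_scale h hy.1 hc ha ha0).const_mul (bumpConst n * ballVol n * 8 ^ n)
    have h2 := (tendsto_osc_scale h hy.1 hc hb hb0).const_mul (bumpConst n * ballVol n * 8 ^ n)
    rw [mul_zero] at h1 h2
    refine tendsto_const_nhds.congr' ?_
    filter_upwards [h1.eventually_le_const (show 0 < δ / 16 by positivity),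
      h2.eventually_le_const (show 0 < δ / 16 by positivity)] with k hk1 hk2
    symm
    rw [setLIntegral_congr_fun (g := fun _ => 0) (hAm k), lintegral_zero]
    intro x hx
    refine scaleKer_eq_zero h (hb0 k) hx.1 ?_
    by_contra! hlt
    have hdx := (h.pos_iff x).2 hx.1
    have e1 := (abs_scaleMol_sub_le h hf c (hb0 k) (hb1 k) hx.1 hlt.le).trans hk2
    have e2 := (abs_scaleMol_sub_le h hf c (ha0 k) (ha1 k) hx.1
      (hlt.le.trans (mul_le_mul_of_nonneg_right (hba k) hdx.le))).trans hk1
    have e3 : δ / 8 < |scaleDiff f d (a k) (b k) x| := hx.2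
    have e4 := abs_sub_le (scaleMol f d (b k) x) c (scaleMol f d (a k) x)
    rw [abs_sub_comm c] at e4
    unfold scaleDiff at e3
    linarith) hη
  have c2 := eventually_setLIntegral_fderiv_le h hf hv hS ha0 ha1 hAm hAΩ (by
    intro y hy
    obtain ⟨c, hc⟩ := not_not.1 hy.2
    change Tendsto (fun r => osc f c y r) (𝓝[>] 0) (𝓝 0) at hc
    have h1 := (tendsto_osc_scale h hy.1 hc ha ha0).const_mul (bumpConst n * ballVol n * 24 ^ n)
    have h2 := ENNReal.Tendsto.const_mul (a := ENNReal.ofReal (8 / δ))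
      ((ENNReal.tendsto_ofReal h1).add (ENNReal.tendsto_ofReal h1))
      (Or.inr ENNReal.ofReal_ne_top)
    rw [mul_zero, ENNReal.ofReal_zero, add_zero, mul_zero] at h2
    refine tendsto_of_tendsto_of_tendsto_of_le_of_le tendsto_const_nhds h2 (fun _ => zero_le)
      fun k => ?_
    have hmk : Measurable fun x => scaleKer d (a k) x y :=
      (measurable_scaleKer h.continuous).comp (f := fun x => (a k, x, y)) (by fun_prop)
    have hmu : AEMeasurable (fun x => ENNReal.ofReal |scaleMol f d (a k) x - c|)
        (volume.restrict Ω) :=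
      ((scaleMol_aestronglyMeasurable h hf (ha0 k)).aemeasurable.sub_const c).norm.ennreal_ofReal
    have hp : AEMeasurable (fun x => scaleKer d (a k) x y *
        ENNReal.ofReal |scaleMol f d (a k) x - c|) (volume.restrict Ω) := hmk.aemeasurable.mul hmu
    calc ∫⁻ x in farSet f d Ω δ (a k) (b k), scaleKer d (a k) x y
        ≤ ∫⁻ x in farSet f d Ω δ (a k) (b k), ENNReal.ofReal (8 / δ) *
            (scaleKer d (a k) x y * ENNReal.ofReal |scaleMol f d (b k) x - c| +
             scaleKer d (a k) x y * ENNReal.ofReal |scaleMol f d (a k) x - c|) := by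
          refine setLIntegral_mono_ae' (hAm k) (Eventually.of_forall fun x hx => ?_)
          rw [← mul_add, mul_left_comm, ← ENNReal.ofReal_add (abs_nonneg _) (abs_nonneg _),
            ← ENNReal.ofReal_mul (by positivity)]
          refine le_mul_of_one_le_right zero_le (ENNReal.one_le_ofReal.2 ?_)
          have e3 : δ / 8 < |scaleDiff f d (a k) (b k) x| := hx.2
          have e4 := abs_sub_le (scaleMol f d (b k) x) c (scaleMol f d (a k) x)
          rw [abs_sub_comm c] at e4
          unfold scaleDiff at e3
          rw [div_mul_eq_mul_div, one_le_div hδ]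
          linarith
      _ ≤ ∫⁻ x in Ω, ENNReal.ofReal (8 / δ) *
            (scaleKer d (a k) x y * ENNReal.ofReal |scaleMol f d (b k) x - c| +
             scaleKer d (a k) x y * ENNReal.ofReal |scaleMol f d (a k) x - c|) :=
          lintegral_mono_set (hAΩ k)
      _ = ENNReal.ofReal (8 / δ) *
            ((∫⁻ x in Ω, scaleKer d (a k) x y * ENNReal.ofReal |scaleMol f d (b k) x - c|) +
             ∫⁻ x in Ω, scaleKer d (a k) x y * ENNReal.ofReal |scaleMol f d (a k) x - c|) := by
          rw [lintegral_const_mul' _ _ ENNReal.ofReal_ne_top,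
            lintegral_add_right' _ hp]
      _ ≤ _ := by
          gcongr
          · exact setLIntegral_scaleKer_mul_le h hf c (hb0 k) (hba k) (ha1 k) hy.1
          · exact setLIntegral_scaleKer_mul_le h hf c (ha0 k) le_rfl (ha1 k) hy.1) hη
  filter_upwards [c1, c2] with k h1 h2
  calc ∫⁻ x in farSet f d Ω δ (a k) (b k), ‖fderiv ℝ (scaleDiff f d (a k) (b k)) x‖ₑ
      ≤ ∫⁻ x in farSet f d Ω δ (a k) (b k), (‖fderiv ℝ (scaleMol f d (b k)) x‖ₑ +
          ‖fderiv ℝ (scaleMol f d (a k)) x‖ₑ) :=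
        setLIntegral_mono_ae' (hAm k) (Eventually.of_forall fun x hx =>
          enorm_fderiv_scaleDiff_le h hf (ha0 k) (hb0 k) hx.1)
    _ = _ := lintegral_add_right _ (measurable_fderiv ℝ _).enorm
    _ ≤ _ := by rw [two_mul]; exact add_le_add h1 h2

theorem exists_forall_setLIntegral_farSet_le (h : IsScale n d Ω) (hf : Integrable f)
    (hv : IsVariationPair n f Ω μ σ) (hS : MeasurableSet (approxDiscontSet n f)) (hδ : 0 < δ)
    {η : ℝ≥0∞} (hη : 0 < η) : ∃ i₀, ∀ i ≥ i₀, ∀ j ≥ i,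
      ∫⁻ x in farSet f d Ω δ (dyadicScale i) (dyadicScale j),
        ‖fderiv ℝ (scaleDiff f d (dyadicScale i) (dyadicScale j)) x‖ₑ ≤
          2 * (ENNReal.ofReal (2 * 3 ^ n) * μ (approxDiscontSet n f) + η) := by
  by_contra! H
  choose I hI J hJ H using H
  have hIlim : Tendsto I atTop atTop := tendsto_atTop_mono hI tendsto_id
  obtain ⟨k, hk⟩ := (eventually_setLIntegral_farSet_le h hf hv hS hδ
    (a := fun k => dyadicScale (I k)) (b := fun k => dyadicScale (J k))
    (tendsto_dyadicScale.comp hIlim) (fun k => dyadicScale_le _) (fun k => dyadicScale_pos _)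
    (fun k => dyadicScale_anti (hJ k)) hη).exists
  exact (H k).not_ge hk

theorem exists_liminf_stairDensity_le {X : Type*} [MeasurableSpace X] {ν : Measure X} [SFinite ν]
    {W : ℕ → X → ℝ} (hW : ∀ j, Measurable (W j)) {G : ℕ → X → ℝ≥0∞} (hG : ∀ j, Measurable (G j))
    {h : ℕ → ℝ} (hh : ∀ j, 0 < h j) (h1 : ∀ j, h j ≤ 1 / 8) (hδ : 0 < δ) {M : ℝ≥0∞}
    (hM : ∀ j, ∫⁻ x in {x | δ / 8 < |W j x|}, G j x ∂ν ≤ M) {N : Set ℝ} (hN : volume N = 0) :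
    ∃ t, t ∉ N ∧ 1 / 4 ≤ t ∧ t ≤ 3 / 4 ∧
      liminf (fun j => ∫⁻ x, ENNReal.ofReal (stairDensity (h j) (W j x / δ - t)) * G j x ∂ν) atTop
        ≤ 2 * M := by
  set m := volume.restrict (Set.Icc (1 / 4 : ℝ) (3 / 4)) with hm
  have hmu : m Set.univ = 1 / 2 := by
    rw [hm, Measure.restrict_apply_univ, Real.volume_Icc,
      show (3 / 4 : ℝ) - 1 / 4 = 2⁻¹ by norm_num, ENNReal.ofReal_inv_of_pos two_pos,
      ENNReal.ofReal_ofNat, one_div]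
  have hm0 : m ≠ 0 := by
    intro h0
    rw [h0, Measure.coe_zero, Pi.zero_apply] at hmu
    exact absurd hmu.symm (by simp)
  have hjoint : ∀ j, Measurable fun p : ℝ × X =>
      ENNReal.ofReal (stairDensity (h j) (W j p.2 / δ - p.1)) * G j p.2 := fun j => by
    have a1 : Measurable fun p : ℝ × X => W j p.2 / δ - p.1 :=
      (((hW j).comp measurable_snd).div_const δ).sub measurable_fst
    exact (((continuous_stairDensity (h j)).measurable.comp a1).ennreal_ofReal).mul
      ((hG j).comp measurable_snd)
  set F : ℕ → ℝ → ℝ≥0∞ := fun j t =>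
    ∫⁻ x, ENNReal.ofReal (stairDensity (h j) (W j x / δ - t)) * G j x ∂ν with hF
  have hFm : ∀ j, Measurable (F j) := fun j => (hjoint j).lintegral_prod_right'
  have hFM : ∀ j, ∫⁻ t, F j t ∂m ≤ M := fun j => by
    have hset : MeasurableSet {x | δ / 8 < |W j x|} :=
      measurableSet_lt measurable_const (hW j).norm
    calc ∫⁻ t, F j t ∂m
        = ∫⁻ x, ∫⁻ t, ENNReal.ofReal (stairDensity (h j) (W j x / δ - t)) * G j x ∂m ∂ν :=
          lintegral_lintegral_swap (hjoint j).aemeasurable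
      _ ≤ ∫⁻ x, {x | δ / 8 < |W j x|}.indicator (G j) x ∂ν := by
          refine lintegral_mono fun x => ?_
          by_cases hx : δ / 8 < |W j x|
          · rw [Set.indicator_of_mem (show x ∈ {x | δ / 8 < |W j x|} from hx)]
            rw [lintegral_mul_const'' _ (by
              have : Continuous fun t => stairDensity (h j) (W j x / δ - t) :=
                (continuous_stairDensity _).comp (by fun_prop)
              exact this.measurable.ennreal_ofReal.aemeasurable)]
            exact mul_le_of_le_one_left zero_le
              (lintegral_stairDensity_le (hh j) ((h1 j).trans (by norm_num)) _)
          · refine le_of_eq_of_le ?_ zero_le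
            rw [setLIntegral_congr_fun (g := fun _ => 0) measurableSet_Icc, lintegral_zero]
            intro t ht
            have := (stairMap_eq_zero hδ (hh j) ((h1 j).trans (by norm_num)) (t := t)
              (by linarith [ht.1, h1 j]) (by linarith [ht.2, h1 j]) (not_lt.1 hx)).2
            simp only [this, ENNReal.ofReal_zero, zero_mul]
      _ ≤ M := by rw [lintegral_indicator hset]; exact hM j
  have hL : ∫⁻ t, liminf (fun j => F j t) atTop ∂m ≤ M :=
    (lintegral_liminf_le hFm).trans
      (liminf_le_of_le (by isBoundedDefault) fun b hb => by
        obtain ⟨j, hj⟩ := hb.exists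
        exact hj.trans (hFM j))
  have hN' : m (N ∪ (Set.Icc (1 / 4 : ℝ) (3 / 4))ᶜ) = 0 := by
    refine measure_union_null (Measure.absolutelyContinuous_of_le Measure.restrict_le_self hN) ?_
    rw [hm, Measure.restrict_apply measurableSet_Icc.compl, Set.compl_inter_self, measure_empty]
  have hmeas : AEMeasurable (fun t => liminf (fun j => F j t) atTop) m :=
    (Measurable.liminf hFm).aemeasurable
  have : IsFiniteMeasure m := ⟨by rw [hmu]; simp⟩
  obtain ⟨t, ht, htle⟩ := exists_notMem_null_le_laverage hm0 hmeas hN'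
  have ht' : t ∈ Set.Icc (1 / 4 : ℝ) (3 / 4) := by
    by_contra hc
    exact ht (Or.inr hc)
  refine ⟨t, fun h => ht (Or.inl h), ht'.1, ht'.2, htle.trans ?_⟩
  rw [laverage_eq, hmu, one_div, div_eq_mul_inv, inv_inv, mul_comm]
  gcongr

end Rounding

section RoundedPair

variable {n : ℕ} {f d : Eu n → ℝ} {Ω : Set (Eu n)} {μ : Measure (Eu n)} {σ : Eu n → Eu n}
  {δ : ℝ}

theorem measurable_indicator_of_continuousOn {u : Eu n → ℝ} (hu : ContinuousOn u Ω)
    (hΩ : MeasurableSet Ω) : Measurable (Ω.indicator u) := by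
  rw [← Set.piecewise_eq_indicator]
  exact hu.measurable_piecewise continuousOn_const hΩ

theorem ae_forall_div_sub_ne_int {ν : Measure (Eu n)} [SFinite ν] {W : Eu n → ℝ}
    (hW : Measurable W) (δ : ℝ) : ∀ᵐ t : ℝ, ∀ᵐ x ∂ν, ∀ k : ℤ, W x / δ - t ≠ k := by
  have hs : MeasurableSet {p : ℝ × Eu n | ∀ k : ℤ, W p.2 / δ - p.1 ≠ k} := by
    have e : {p : ℝ × Eu n | ∀ k : ℤ, W p.2 / δ - p.1 ≠ k} =
        ⋂ k : ℤ, {p : ℝ × Eu n | W p.2 / δ - p.1 = k}ᶜ := by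
      ext p; simp
    rw [e]
    refine MeasurableSet.iInter fun k => (measurableSet_eq_fun ?_ measurable_const).compl
    exact ((hW.comp measurable_snd).div_const δ).sub measurable_fst
  refine (Measure.ae_ae_comm hs).2 (Eventually.of_forall fun x => ?_)
  have hc : (Set.range fun k : ℤ => W x / δ - k).Countable := Set.countable_range _
  filter_upwards [hc.ae_notMem volume] with t ht k hk
  exact ht ⟨k, by simp only; linarith⟩

theorem scaleDiff_integrableOn (h : IsScale n d Ω) (hf : Integrable f)
    (hv : IsVariationPair n f Ω μ σ) {ε ε' : ℝ} (hε : 0 < ε) (hε1 : ε ≤ 1 / 2) (hε' : 0 < ε')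
    (hε1' : ε' ≤ 1 / 2) : IntegrableOn (scaleDiff f d ε ε') Ω :=
  (scaleMol_integrableOn h hf hv hε' hε1').sub (scaleMol_integrableOn h hf hv hε hε1)

theorem integrableOn_roundMap_comp {t : ℝ} (hδ : 0 < δ) (ht : 1 / 4 ≤ t) (ht1 : t ≤ 3 / 4)
    {u : Eu n → ℝ} (hu : IntegrableOn u Ω) : IntegrableOn (fun x => roundMap δ t (u x)) Ω := by
  refine (hu.norm.const_mul 5).mono' ?_ (Eventually.of_forall fun x => abs_roundMap_le hδ ht ht1 _)
  exact (measurable_roundMap.comp_aemeasurable hu.aemeasurable).aestronglyMeasurable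

theorem exists_isVariationPair_roundMap (h : IsScale n d Ω) (hf : Integrable f)
    (hm : StronglyMeasurable f) (hv : IsVariationPair n f Ω μ σ) (hδ : 0 < δ) {η : ℝ≥0∞}
    (hη : 0 < η) (hη' : η ≠ ⊤) {ε : ℝ} (hε : 0 < ε) : ∃ ρ t, 0 < ρ ∧ ρ ≤ 1 / 2 ∧ ρ ≤ ε ∧
      1 / 4 ≤ t ∧ t ≤ 3 / 4 ∧ ∃ ν τ,
      IsVariationPair n (Ω.indicator fun x => roundMap δ t (f x - scaleMol f d ρ x)) Ω ν τ ∧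
      ν Set.univ ≤
        n * (3 * (5 * (ENNReal.ofReal (2 * 3 ^ n) * μ (approxDiscontSet n f) + η))) := by
  have := hv.1
  have hΩ := h.measurableSet
  have hS := measurableSet_approxDiscontSet hf hm
  obtain ⟨i₀, hi₀⟩ := exists_forall_setLIntegral_farSet_le h hf hv hS hδ hη
  obtain ⟨i, hi, hiε⟩ := ((eventually_ge_atTop i₀).and
    (tendsto_dyadicScale.eventually_le_const hε)).exists
  set M := 2 * (ENNReal.ofReal (2 * 3 ^ n) * μ (approxDiscontSet n f) + η) with hM
  have hMt : M ≠ ⊤ := by finiteness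
  set ρ := dyadicScale i with hρ
  have hρ0 : 0 < ρ := dyadicScale_pos i
  have hρ1 : ρ ≤ 1 / 2 := dyadicScale_le i
  set b : ℕ → ℝ := fun j => dyadicScale (i + j) with hb
  have hb0 : ∀ j, 0 < b j := fun j => dyadicScale_pos _
  have hb1 : ∀ j, b j ≤ 1 / 2 := fun j => dyadicScale_le _
  have hblim : Tendsto b atTop (𝓝 0) :=
    tendsto_dyadicScale.comp (tendsto_atTop_mono (fun j => Nat.le_add_left j i) tendsto_id)
  set w : ℕ → Eu n → ℝ := fun j => scaleDiff f d ρ (b j) with hw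
  have hwd : ∀ j, ∀ x ∈ Ω, DifferentiableAt ℝ (w j) x := fun j x hx =>
    scaleDiff_differentiableAt h hf hρ0 (hb0 j) hx
  set W : ℕ → Eu n → ℝ := fun j => Ω.indicator (w j) with hWdef
  have hWm : ∀ j, Measurable (W j) := fun j => measurable_indicator_of_continuousOn
    (fun x hx => (hwd j x hx).continuousAt.continuousWithinAt) hΩ
  set hs : ℕ → ℝ := fun j => 1 / ((j : ℝ) + 1) * (1 / 8) with hhs
  have hs0 : ∀ j, 0 < hs j := fun j => by positivity
  have hs1 : ∀ j, hs j ≤ 1 / 8 := fun j => by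
    refine mul_le_of_le_one_left (by norm_num) ?_
    rw [div_le_one (by positivity)]
    linarith [Nat.cast_nonneg (α := ℝ) j]
  have hs2 : ∀ j, hs j ≤ 1 / 2 := fun j => (hs1 j).trans (by norm_num)
  have hslim : Tendsto hs atTop (𝓝 0) := by
    have := (tendsto_one_div_add_atTop_nhds_zero_nat (𝕜 := ℝ)).mul_const (1 / 8)
    rwa [zero_mul] at this
  set w₀ : Eu n → ℝ := fun x => f x - scaleMol f d ρ x with hw₀
  have hum := measurable_indicator_of_continuousOn (scaleMol_continuousOn h hf hρ0) hΩ
  have hN := ae_forall_div_sub_ne_int (ν := volume.restrict Ω)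
    (hm.measurable.sub hum) δ
  obtain ⟨t, ht, ht1, ht2, htM⟩ := exists_liminf_stairDensity_le (ν := volume.restrict Ω) hWm
    (G := fun j x => ‖fderiv ℝ (w j) x‖ₑ) (fun j => (measurable_fderiv ℝ _).enorm) hs0 hs1 hδ
    (M := M) (fun j => by
      have hset : MeasurableSet {x | δ / 8 < |W j x|} :=
        measurableSet_lt measurable_const (hWm j).norm
      rw [Measure.restrict_restrict hset]
      refine le_of_eq_of_le ?_ (hi₀ i hi (i + j) (Nat.le_add_right i j))
      congr 2
      ext x
      refine ⟨fun hx => ⟨hx.2, ?_⟩, fun hx => ⟨?_, hx.1⟩⟩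
      · have := hx.1
        simp only [Set.mem_ofPred_eq, hWdef, Set.indicator_of_mem hx.2] at this
        exact this
      · simp only [Set.mem_ofPred_eq, hWdef, Set.indicator_of_mem hx.1]
        exact hx.2) hN
  have ht := not_not.1 ht
  refine ⟨ρ, t, hρ0, hρ1, hiε, ht1, ht2, ?_⟩
  have hw₀i : IntegrableOn w₀ Ω := hf.integrableOn.sub (scaleMol_integrableOn h hf hv hρ0 hρ1)
  have haelim := ae_tendsto_scaleMol h hf hblim hb0 hb1
  have hae : ∀ᵐ x ∂volume.restrict Ω, Tendsto (fun j => w j x) atTop (𝓝 (w₀ x)) := by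
    rw [ae_restrict_iff' hΩ]
    filter_upwards [haelim] with x hx hxΩ
    exact (hx hxΩ).sub_const _
  set V := 2 * M + η with hV
  have hVt : V ≠ ⊤ := by finiteness
  obtain ⟨ν, τ, hν, hνV⟩ := exists_isVariationPair_of_tendsto h.isOpen
    (w := w) (v := fun j x => stairMap δ t (hs j) (w j x)) (w₀ := w₀)
    (q := Ω.indicator fun x => roundMap δ t (w₀ x)) (C := 3 * δ) (V := V.toReal)
    (fun j => scaleDiff_integrableOn h hf hv hρ0 hρ1 (hb0 j) (hb1 j)) hw₀i
    (by
      refine (tendsto_setLIntegral_scaleMol_sub h hf hv hblim hb0 hb1).congr fun j =>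
        lintegral_congr fun x => ?_
      rw [← enorm_neg, neg_sub, hw, hw₀]
      simp only [scaleDiff, sub_sub_sub_cancel_right]) hae
    (fun j => integrableOn_stairMap_comp hδ (hs0 j) (hs2 j) (by linarith [hs1 j])
      (by linarith [hs1 j]) (scaleDiff_integrableOn h hf hv hρ0 hρ1 (hb0 j) (hb1 j)))
    (fun j x hx => (hasFDerivAt_stairMap_comp hδ (hwd j x hx)).differentiableAt)
    (fun j x => abs_stairMap_sub_le hδ (hs0 j) (hs2 j) (by linarith) (by linarith) _)
    ((integrableOn_roundMap_comp hδ ht1 ht2 hw₀i).indicator hΩ)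
    (by
      filter_upwards [hae, ht, ae_restrict_mem hΩ] with x hx1 hx2 hxΩ
      rw [Set.indicator_of_mem hxΩ]
      rw [Pi.sub_apply, Set.indicator_of_mem hxΩ] at hx2
      exact tendsto_stairMap hx1 hx2 hs0 hs2 hslim)
    ENNReal.toReal_nonneg (by
      have hlt : liminf (fun j => ∫⁻ x in Ω, ENNReal.ofReal (stairDensity (hs j) (W j x / δ - t)) *
          ‖fderiv ℝ (w j) x‖ₑ) atTop < V :=
        htM.trans_lt (ENNReal.lt_add_right (by finiteness) hη.ne')
      refine (frequently_lt_of_liminf_lt (by isBoundedDefault) hlt).mono fun j hj => ?_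
      rw [ENNReal.ofReal_toReal hVt]
      refine le_of_eq_of_le ?_ hj.le
      refine setLIntegral_congr_fun hΩ fun x hx => ?_
      rw [enorm_fderiv_stairMap_comp hδ (hwd j x hx), hWdef]
      simp only [Set.indicator_of_mem hx]
      rw [Real.enorm_of_nonneg (stairDensity_nonneg (hs0 j) (hs2 j) _)])
  refine ⟨ν, τ, hν, hνV.trans ?_⟩
  rw [ENNReal.ofReal_mul (by norm_num), ENNReal.ofReal_toReal hVt, ENNReal.ofReal_ofNat]
  gcongr
  rw [hV, hM, ← mul_assoc, show (5 : ℝ≥0∞) = 2 * 2 + 1 by norm_num, add_mul, one_mul]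
  gcongr
  exact le_add_self

end RoundedPair

section Cutoff

/-- A continuously differentiable cutoff, vanishing on `(-∞, 1]` and equal to one on `[2, ∞)`. -/
def cutoff (t : ℝ) : ℝ := 1 - sqPos (1 - sqPos (t - 1))

/-- The derivative of `cutoff`. -/
def cutoffDeriv (t : ℝ) : ℝ := 2 * max 0 (1 - sqPos (t - 1)) * (2 * max 0 (t - 1))

theorem hasDerivAt_cutoff (t : ℝ) : HasDerivAt cutoff (cutoffDeriv t) t := by
  have h1 : HasDerivAt (fun t => 1 - sqPos (t - 1)) (-(2 * max 0 (t - 1))) t := by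
    have := ((hasDerivAt_sqPos (t - 1)).comp_sub_const t 1).const_sub 1
    exact this
  have h2 := ((hasDerivAt_sqPos (1 - sqPos (t - 1))).comp t h1).const_sub 1
  have e : -(2 * max 0 (1 - sqPos (t - 1)) * -(2 * max 0 (t - 1))) = cutoffDeriv t := by
    unfold cutoffDeriv; ring
  rw [e] at h2
  exact h2

theorem contDiff_cutoff : ContDiff ℝ 1 cutoff := by
  unfold cutoff
  exact contDiff_const.sub (contDiff_sqPos.comp
    (contDiff_const.sub (contDiff_sqPos.comp (contDiff_id.sub contDiff_const))))

theorem cutoff_eq_zero {t : ℝ} (ht : t ≤ 1) : cutoff t = 0 := by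
  rw [cutoff, sqPos_of_nonpos (t := t - 1) (by linarith), sqPos]
  norm_num

theorem one_le_sqPos {t : ℝ} (ht : 1 ≤ t) : 1 ≤ sqPos t := by
  rw [sqPos, max_eq_right (by linarith)]
  nlinarith

theorem cutoff_eq_one {t : ℝ} (ht : 2 ≤ t) : cutoff t = 1 := by
  have := one_le_sqPos (t := t - 1) (by linarith)
  rw [cutoff, sqPos_of_nonpos (by linarith), sub_zero]

theorem abs_cutoff_le (t : ℝ) : |cutoff t| ≤ 1 := by
  have h1 := sqPos_nonneg (t - 1)
  have h2 := sqPos_le_one (t := 1 - sqPos (t - 1)) (by linarith)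
  have h3 := sqPos_nonneg (1 - sqPos (t - 1))
  rw [cutoff, abs_le]
  constructor <;> linarith

theorem cutoffDeriv_eq_zero {t : ℝ} (ht : 2 ≤ t) : cutoffDeriv t = 0 := by
  have := one_le_sqPos (t := t - 1) (by linarith)
  rw [cutoffDeriv, max_eq_left (by linarith)]
  simp

theorem abs_cutoffDeriv_mul_le {t : ℝ} (ht : 0 ≤ t) : |cutoffDeriv t| * t ≤ 8 := by
  rcases le_total t 2 with h | h
  · have h1 := sqPos_nonneg (t - 1)
    have a1 : max 0 (1 - sqPos (t - 1)) ≤ 1 := max_le zero_le_one (by linarith)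
    have a2 : max 0 (t - 1) ≤ 1 := max_le zero_le_one (by linarith)
    have a3 : 0 ≤ max 0 (1 - sqPos (t - 1)) := le_max_left _ _
    have a4 : 0 ≤ max 0 (t - 1) := le_max_left _ _
    have a5 : max 0 (1 - sqPos (t - 1)) * max 0 (t - 1) ≤ 1 := mul_le_one₀ a1 a4 a2
    have e : cutoffDeriv t = 4 * (max 0 (1 - sqPos (t - 1)) * max 0 (t - 1)) := by
      unfold cutoffDeriv; ring
    rw [e, abs_of_nonneg (by positivity)]
    nlinarith [mul_nonneg a3 a4]
  · rw [cutoffDeriv_eq_zero h]; simp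

variable {n : ℕ} {d : Eu n → ℝ} {Ω : Set (Eu n)}

theorem vdiv_smul {ζ : Eu n → ℝ} {Φ : Eu n → Eu n} {x : Eu n} (hζ : DifferentiableAt ℝ ζ x)
    (hΦ : DifferentiableAt ℝ Φ x) :
    vdiv n (fun x => ζ x • Φ x) x = ζ x * vdiv n Φ x + fderiv ℝ ζ x (Φ x) := by
  have e : Φ x = ∑ i, Φ x i • EuclideanSpace.single i (1 : ℝ) := by
    have := (EuclideanSpace.basisFun (Fin n) ℝ).sum_repr (Φ x)
    simpa using this.symm
  conv_rhs => rw [e, map_sum]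
  unfold vdiv
  rw [fderiv_fun_smul hζ hΦ, Finset.mul_sum, ← Finset.sum_add_distrib]
  refine Finset.sum_congr rfl fun i _ => ?_
  simp [mul_comm]

/-- Cutoffs exhausting the set where the scale is positive. -/
def scaleCutoff (d : Eu n → ℝ) (k : ℕ) (x : Eu n) : ℝ := cutoff ((k + 1) * d x)

theorem contDiff_scaleCutoff (h : IsScale n d Ω) (k : ℕ) : ContDiff ℝ 1 (scaleCutoff d k) :=
  contDiff_cutoff.comp (contDiff_const.mul h.contDiff)

theorem fderiv_scaleCutoff (h : IsScale n d Ω) (k : ℕ) (x : Eu n) :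
    fderiv ℝ (scaleCutoff d k) x = (cutoffDeriv ((k + 1) * d x) * (k + 1)) • fderiv ℝ d x := by
  have h1 : HasFDerivAt (fun x => ((k : ℝ) + 1) * d x) (((k : ℝ) + 1) • fderiv ℝ d x) x :=
    ((h.contDiff.differentiable one_ne_zero).differentiableAt.hasFDerivAt).const_mul _
  have h2 := (hasDerivAt_cutoff (((k : ℝ) + 1) * d x)).comp_hasFDerivAt x h1
  rw [smul_smul] at h2
  exact h2.fderiv

theorem tendsto_succ_mul_scale (h : IsScale n d Ω) {x : Eu n} (hx : x ∈ Ω) :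
    ∀ᶠ k : ℕ in atTop, 2 ≤ ((k : ℝ) + 1) * d x := by
  have hd := (h.pos_iff x).2 hx
  have : Tendsto (fun k : ℕ => ((k : ℝ) + 1) * d x) atTop atTop :=
    ((tendsto_natCast_atTop_atTop (R := ℝ)).atTop_add tendsto_const_nhds).atTop_mul_const hd
  exact this.eventually_ge_atTop 2

theorem abs_fderiv_scaleCutoff_le (h : IsScale n d Ω) (k : ℕ) {x : Eu n} (hx : x ∈ Ω) (v : Eu n) :
    |fderiv ℝ (scaleCutoff d k) x v| ≤ 8 / d x * ‖v‖ := by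
  have hd := (h.pos_iff x).2 hx
  rw [fderiv_scaleCutoff h, smul_apply, smul_eq_mul, abs_mul, abs_mul]
  have h1 := abs_cutoffDeriv_mul_le (t := ((k : ℝ) + 1) * d x) (by positivity)
  have h2 : |fderiv ℝ d x v| ≤ ‖v‖ := by
    have := (fderiv ℝ d x).le_opNorm v
    rw [Real.norm_eq_abs] at this
    exact this.trans (mul_le_of_le_one_left (norm_nonneg _) (h.norm_fderiv_le x))
  refine mul_le_mul ?_ h2 (abs_nonneg _) (by positivity)
  rw [le_div_iff₀ hd, abs_of_nonneg (by positivity : (0 : ℝ) ≤ (k : ℝ) + 1), mul_assoc]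
  exact h1

end Cutoff

section Gluing

variable {n : ℕ} {f g d : Eu n → ℝ} {Ω : Set (Eu n)} {m m₂ : Measure (Eu n)}
  {τ τ₂ : Eu n → Eu n}

theorem tendsto_integral_scaleCutoff (h : IsScale n d Ω) (hm : m Ωᶜ = 0) (hτ : Integrable τ m)
    {Φ : Eu n → Eu n} (h1 : ContDiff ℝ 1 Φ) (h2 : HasCompactSupport Φ) :
    Tendsto (fun k => ∫ x, ⟪scaleCutoff d k x • Φ x, τ x⟫ ∂m) atTop (𝓝 (∫ x, ⟪Φ x, τ x⟫ ∂m)) := by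
  obtain ⟨C, hC⟩ := h2.exists_bound_of_continuous h1.continuous
  refine tendsto_integral_of_dominated_convergence (fun x => C * ‖τ x‖) (fun k => ?_)
    (hτ.norm.const_mul C) (fun k => Eventually.of_forall fun x => ?_) ?_
  · have : Continuous fun x => scaleCutoff d k x • Φ x :=
      (contDiff_scaleCutoff h k).continuous.smul h1.continuous
    exact this.aestronglyMeasurable.inner hτ.aestronglyMeasurable
  · refine (norm_inner_le_norm _ _).trans (mul_le_mul_of_nonneg_right ?_ (norm_nonneg _))
    rw [norm_smul]
    exact (mul_le_of_le_one_left (norm_nonneg _) (abs_cutoff_le _)).trans (hC x)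
  · have : ∀ᵐ x ∂m, x ∈ Ω := hm
    filter_upwards [this] with x hx
    refine tendsto_const_nhds.congr' ?_
    filter_upwards [tendsto_succ_mul_scale h hx] with k hk
    rw [scaleCutoff, cutoff_eq_one hk, one_smul]

theorem contDiff_scaleCutoff_smul (h : IsScale n d Ω) (k : ℕ) {Φ : Eu n → Eu n}
    (h1 : ContDiff ℝ 1 Φ) : ContDiff ℝ 1 (fun x => scaleCutoff d k x • Φ x) :=
  ContDiff.smul (contDiff_scaleCutoff h k) h1

theorem hasCompactSupport_scaleCutoff_smul (k : ℕ) {Φ : Eu n → Eu n}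
    (h2 : HasCompactSupport Φ) : HasCompactSupport (fun x => scaleCutoff d k x • Φ x) :=
  HasCompactSupport.smul_left (f := scaleCutoff d k) h2

theorem tsupport_scaleCutoff_smul_subset (h : IsScale n d Ω) (k : ℕ) (Φ : Eu n → Eu n) :
    tsupport (fun x => scaleCutoff d k x • Φ x) ⊆ Ω := by
  have hcl : IsClosed {x | 1 ≤ ((k : ℝ) + 1) * d x} :=
    isClosed_le continuous_const (continuous_const.mul h.continuous)
  refine (closure_minimal ?_ hcl).trans fun x hx => ?_
  · intro x hx
    by_contra hlt
    refine hx ?_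
    have : scaleCutoff d k x = 0 := cutoff_eq_zero (not_le.1 hlt).le
    simp only [this, zero_smul]
  · refine (h.pos_iff x).1 (lt_of_not_ge fun h0 => ?_)
    have hx : 1 ≤ ((k : ℝ) + 1) * d x := hx
    nlinarith [h.nonneg x, Nat.cast_nonneg (α := ℝ) k]

theorem HasGradMeasure.integral_sub_mul_vdiv (h : IsScale n d Ω) (hg : HasGradMeasure n g Ω m τ)
    (hf : HasGradMeasure n f Ω m₂ τ₂) (hm : m Ωᶜ = 0) (hm₂ : m₂ Ωᶜ = 0) (hτ : Integrable τ m)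
    (hτ₂ : Integrable τ₂ m₂) (hgi : IntegrableOn g Ω) (hfi : IntegrableOn f Ω)
    (hdi : IntegrableOn (fun x => (g x - f x) / d x) Ω) {Φ : Eu n → Eu n} (h1 : ContDiff ℝ 1 Φ)
    (h2 : HasCompactSupport Φ) : ∫ x in Ω, (g x - f x) * vdiv n Φ x =
      -(∫ x, ⟪Φ x, τ x⟫ ∂m) + ∫ x, ⟪Φ x, τ₂ x⟫ ∂m₂ := by
  have hζ := fun k => contDiff_scaleCutoff_smul h k h1
  have hζc := fun k => hasCompactSupport_scaleCutoff_smul (d := d) k h2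
  have hζs := fun k => tsupport_scaleCutoff_smul_subset h k Φ
  have hident : ∀ k, ∫ x in Ω, (g x - f x) * vdiv n (fun x => scaleCutoff d k x • Φ x) x =
      -(∫ x, ⟪scaleCutoff d k x • Φ x, τ x⟫ ∂m) + ∫ x, ⟪scaleCutoff d k x • Φ x, τ₂ x⟫ ∂m₂ :=
        fun k => by
    have e1 := hg _ (hζ k) (hζc k) (hζs k)
    have e2 := hf _ (hζ k) (hζc k) (hζs k)
    have := integral_sub (integrableOn_mul_vdiv hgi (hζ k) (hζc k))
      (integrableOn_mul_vdiv hfi (hζ k) (hζc k))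
    rw [e1, e2, sub_neg_eq_add] at this
    rw [← this]
    exact integral_congr_ae (Eventually.of_forall fun x => sub_mul _ _ _)
  have hlim := (tendsto_integral_scaleCutoff h hm hτ h1 h2).neg.add
    (tendsto_integral_scaleCutoff h hm₂ hτ₂ h1 h2)
  refine tendsto_nhds_unique ?_ (hlim.congr fun k => (hident k).symm)
  obtain ⟨C, hC⟩ := h2.exists_bound_of_continuous h1.continuous
  obtain ⟨C', hC'⟩ := exists_abs_vdiv_le h1 h2
  refine tendsto_integral_of_dominated_convergence
    (fun x => C' * ‖g x - f x‖ + 8 * C * ‖(g x - f x) / d x‖) (fun k => ?_)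
    (((hgi.sub hfi).norm.const_mul C').add (hdi.norm.const_mul (8 * C))) (fun k => ?_) ?_
  · exact (hgi.sub hfi).aestronglyMeasurable.mul (continuous_vdiv (hζ k)).aestronglyMeasurable
  · filter_upwards [ae_restrict_mem h.measurableSet] with x hx
    have hd := (h.pos_iff x).2 hx
    rw [vdiv_smul ((contDiff_scaleCutoff h k).differentiable one_ne_zero).differentiableAt
      (h1.differentiable one_ne_zero).differentiableAt, norm_mul, norm_div,
      Real.norm_of_nonneg hd.le]
    have b1 : ‖scaleCutoff d k x * vdiv n Φ x + fderiv ℝ (scaleCutoff d k) x (Φ x)‖ ≤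
        C' + 8 / d x * C := by
      refine (norm_add_le _ _).trans (add_le_add ?_ ?_)
      · rw [norm_mul]
        exact (mul_le_of_le_one_left (norm_nonneg _) (abs_cutoff_le _)).trans (hC' x)
      · exact (abs_fderiv_scaleCutoff_le h k hx _).trans
          (mul_le_mul_of_nonneg_left (hC x) (by positivity))
    calc _ ≤ ‖g x - f x‖ * (C' + 8 / d x * C) := mul_le_mul_of_nonneg_left b1 (norm_nonneg _)
      _ = _ := by ring
  · filter_upwards [ae_restrict_mem h.measurableSet] with x hx
    refine tendsto_const_nhds.congr' ?_
    filter_upwards [tendsto_succ_mul_scale h hx] with k hk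
    rw [vdiv_smul ((contDiff_scaleCutoff h k).differentiable one_ne_zero).differentiableAt
      (h1.differentiable one_ne_zero).differentiableAt, fderiv_scaleCutoff h,
      cutoffDeriv_eq_zero hk]
    have : scaleCutoff d k x = 1 := cutoff_eq_one hk
    simp [this]

end Gluing

section PiecewiseMeasure

variable {n : ℕ} {f g : Eu n → ℝ} {Ω A : Set (Eu n)} {m m₁ m₂ : Measure (Eu n)}
  {τ τ₁ τ₂ : Eu n → Eu n}

theorem piecewise_ae_eq_left (h₁ : m₁ A = 0) (τ₁ τ₂ : Eu n → Eu n) :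
    A.piecewise τ₂ τ₁ =ᵐ[m₁] τ₁ := by
  have : ∀ᵐ x ∂m₁, x ∉ A := by simpa [ae_iff] using h₁
  filter_upwards [this] with x hx using Set.piecewise_eq_of_notMem _ _ _ hx

theorem piecewise_ae_eq_right (h₂ : m₂ Aᶜ = 0) (τ₁ τ₂ : Eu n → Eu n) :
    A.piecewise τ₂ τ₁ =ᵐ[m₂] τ₂ := by
  have : ∀ᵐ x ∂m₂, x ∈ A := h₂
  filter_upwards [this] with x hx using Set.piecewise_eq_of_mem _ _ _ hx

theorem integrable_piecewise_add (h₁ : m₁ A = 0) (h₂ : m₂ Aᶜ = 0) (hτ₁ : Integrable τ₁ m₁)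
    (hτ₂ : Integrable τ₂ m₂) : Integrable (A.piecewise τ₂ τ₁) (m₁ + m₂) :=
  integrable_add_measure.2 ⟨hτ₁.congr (piecewise_ae_eq_left h₁ _ _).symm,
    hτ₂.congr (piecewise_ae_eq_right h₂ _ _).symm⟩

theorem integrable_inner_of_hasCompactSupport (hτ : Integrable τ m) {Φ : Eu n → Eu n}
    (h1 : Continuous Φ) (h2 : HasCompactSupport Φ) : Integrable (fun x => ⟪Φ x, τ x⟫) m := by
  obtain ⟨C, hC⟩ := h2.exists_bound_of_continuous h1
  refine (hτ.norm.const_mul C).mono' (h1.aestronglyMeasurable.inner hτ.aestronglyMeasurable)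
    (Eventually.of_forall fun x => ?_)
  exact (norm_inner_le_norm _ _).trans (mul_le_mul_of_nonneg_right (hC x) (norm_nonneg _))

theorem integral_inner_piecewise_add (h₁ : m₁ A = 0) (h₂ : m₂ Aᶜ = 0) (hτ₁ : Integrable τ₁ m₁)
    (hτ₂ : Integrable τ₂ m₂) {Φ : Eu n → Eu n} (h1 : Continuous Φ) (h2 : HasCompactSupport Φ) :
    ∫ x, ⟪Φ x, A.piecewise τ₂ τ₁ x⟫ ∂(m₁ + m₂) =
      (∫ x, ⟪Φ x, τ₁ x⟫ ∂m₁) + ∫ x, ⟪Φ x, τ₂ x⟫ ∂m₂ := by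
  have hi := integrable_inner_of_hasCompactSupport
    (integrable_piecewise_add h₁ h₂ hτ₁ hτ₂) h1 h2
  rw [integrable_add_measure] at hi
  rw [integral_add_measure hi.1 hi.2]
  congr 1
  · refine integral_congr_ae ?_
    filter_upwards [piecewise_ae_eq_left h₁ τ₁ τ₂] with x hx
    rw [hx]
  · refine integral_congr_ae ?_
    filter_upwards [piecewise_ae_eq_right h₂ τ₁ τ₂] with x hx
    rw [hx]

theorem HasGradMeasure.add_piecewise (h₁ : m₁ A = 0) (h₂ : m₂ Aᶜ = 0) (hτ₁ : Integrable τ₁ m₁)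
    (hτ₂ : Integrable τ₂ m₂) (hf : HasGradMeasure n f Ω m₁ τ₁) (hg : HasGradMeasure n g Ω m₂ τ₂)
    (hfi : IntegrableOn f Ω) (hgi : IntegrableOn g Ω) :
    HasGradMeasure n (fun x => f x + g x) Ω (m₁ + m₂) (A.piecewise τ₂ τ₁) := by
  intro Φ h1 h2 h3
  rw [integral_inner_piecewise_add h₁ h₂ hτ₁ hτ₂ h1.continuous h2, neg_add, ← hf Φ h1 h2 h3,
    ← hg Φ h1 h2 h3, ← integral_add (integrableOn_mul_vdiv hfi h1 h2)
    (integrableOn_mul_vdiv hgi h1 h2)]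
  exact integral_congr_ae (Eventually.of_forall fun x => add_mul _ _ _)

theorem normMeasure_congr (h : τ₁ =ᵐ[m] τ₂) : normMeasure m τ₁ = normMeasure m τ₂ := by
  refine withDensity_congr_ae ?_
  filter_upwards [h] with x hx
  rw [hx]

theorem normMeasure_of_norm_eq_one (h : ∀ᵐ x ∂m, ‖τ x‖ = 1) : normMeasure m τ = m := by
  have : (fun x => (‖τ x‖₊ : ℝ≥0∞)) =ᵐ[m] 1 := by
    filter_upwards [h] with x hx
    have : ‖τ x‖₊ = 1 := NNReal.eq hx
    simp [this]
  rw [normMeasure, withDensity_congr_ae this, withDensity_one]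

theorem normMeasure_piecewise_add (h₁ : m₁ A = 0) (h₂ : m₂ Aᶜ = 0) :
    normMeasure (m₁ + m₂) (A.piecewise τ₂ τ₁) = normMeasure m₁ τ₁ + normMeasure m₂ τ₂ := by
  rw [← normMeasure_congr (piecewise_ae_eq_left h₁ τ₁ τ₂),
    ← normMeasure_congr (piecewise_ae_eq_right h₂ τ₁ τ₂)]
  exact withDensity_add_measure _ _ _

end PiecewiseMeasure

section Decomposition

variable {n : ℕ} {g : Eu n → ℝ} {Ω : Set (Eu n)} {μ s : Measure (Eu n)}
  {σ : Eu n → Eu n} {φ : Eu n → ℝ≥0∞}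

theorem IsVariationPair.absVar_eq_of_decomposition (hΩ : IsOpen Ω)
    (h : IsVariationPair n g Ω μ σ) (hφ : Measurable φ)
    (hs : s ⟂ₘ volume) (hμ : μ = s + volume.withDensity φ) : absVar n g Ω = ∫⁻ x in Ω, φ x := by
  rw [h.absVar_eq hΩ, ← Measure.eq_withDensity_rnDeriv hφ hs hμ,
    withDensity_apply _ hΩ.measurableSet]

theorem IsVariationPair.cantorVar_eq_of_decomposition (hΩ : IsOpen Ω)
    (h : IsVariationPair n g Ω μ σ) (hφ : Measurable φ)
    (hs : s ⟂ₘ volume) (hμ : μ = s + volume.withDensity φ) :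
    cantorVar n g Ω = s (Ω \ approxDiscontSet n g) := by
  rw [h.cantorVar_eq hΩ, ← Measure.eq_singularPart hφ hs hμ]

theorem IsVariationPair.jumpVar_eq_of_decomposition (hΩ : IsOpen Ω)
    (h : IsVariationPair n g Ω μ σ) (hφ : Measurable φ)
    (hs : s ⟂ₘ volume) (hμ : μ = s + volume.withDensity φ) :
    jumpVar n g Ω = s (jumpSet n g ∩ Ω) := by
  rw [h.jumpVar_eq hΩ, ← Measure.eq_singularPart hφ hs hμ]

end Decomposition

section Glue

variable {n : ℕ} {f g d : Eu n → ℝ} {Ω K : Set (Eu n)} {m μ : Measure (Eu n)}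
  {τ σ : Eu n → Eu n}

/-- Gluing `g` on `Ω \ K` with `f` on the null set `K`. -/
theorem HasGradMeasure.glue (h : IsScale n d (Ω \ K)) (hΩ : MeasurableSet Ω)
    (hK : MeasurableSet K) (hKΩ : K ⊆ Ω) (hK0 : volume K = 0) (hv : IsVariationPair n f Ω μ σ)
    (hf : IntegrableOn f Ω) (hg : HasGradMeasure n g (Ω \ K) m τ) (hm : m (Ω \ K)ᶜ = 0)
    (hτ : Integrable τ m) (hgi : IntegrableOn g (Ω \ K))
    (hdi : IntegrableOn (fun x => (g x - f x) / d x) (Ω \ K)) :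
    HasGradMeasure n g Ω (m + μ.restrict K) (K.piecewise σ τ) := by
  intro Φ h1 h2 h3
  have hr := hv.restrict hΩ h.isOpen Set.sdiff_subset
  have := hv.1
  have key := hg.integral_sub_mul_vdiv h hr.hasGradMeasure hm hr.2.1 hτ hr.integrable hgi
    (hf.mono_set Set.sdiff_subset) hdi h1 h2
  have hmK : m K = 0 := measure_mono_null (show K ⊆ (Ω \ K)ᶜ from fun x hx hx' => hx'.2 hx) hm
  have hσK : Integrable σ (μ.restrict K) := hv.integrable.restrict
  have hsub := integral_sub (integrableOn_mul_vdiv hgi h1 h2)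
    (integrableOn_mul_vdiv (hf.mono_set (Set.sdiff_subset (t := K))) h1 h2)
  simp only [← sub_mul] at hsub
  have hae : (Ω \ K : Set (Eu n)) =ᵐ[volume] Ω := sdiff_null_ae_eq_self hK0
  have hfΩ := hv.2.2.2.2 Φ h1 h2 h3
  rw [← setIntegral_congr_set hae] at hfΩ
  have hI := integrable_inner_of_hasCompactSupport hv.integrable h1.continuous h2
  have hΩμ : μ.restrict Ω = μ := Measure.restrict_eq_self_of_ae_mem hv.2.1
  have hsplit : (∫ x, ⟪Φ x, σ x⟫ ∂μ) =
      (∫ x in Ω \ K, ⟪Φ x, σ x⟫ ∂μ) + ∫ x in K, ⟪Φ x, σ x⟫ ∂μ := by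
    rw [← setIntegral_union Set.disjoint_sdiff_left hK hI.integrableOn hI.integrableOn,
      Set.sdiff_union_of_subset hKΩ, hΩμ]
  rw [integral_inner_piecewise_add hmK (by simp [Measure.restrict_apply hK.compl]) hτ hσK
    h1.continuous h2, ← setIntegral_congr_set hae]
  linarith

end Glue

section DiscontSets

variable {n : ℕ} {f g w d : Eu n → ℝ} {U : Set (Eu n)} {x : Eu n} {c₀ : ℝ}

theorem notMem_approxDiscontSet_of_tendsto (hf : Integrable f) (hg : Integrable g)
    (hw : Tendsto (fun r => osc (fun y => g y - f y) c₀ x r) (𝓝[>] 0) (𝓝 0))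
    (hx : x ∉ approxDiscontSet n f) : x ∉ approxDiscontSet n g := by
  obtain ⟨c, hc⟩ := not_not.1 hx
  refine not_not.2 ⟨c + c₀, ?_⟩
  have hs := (show Tendsto (fun r => osc f c x r) (𝓝[>] 0) (𝓝 0) from hc).add hw
  rw [add_zero] at hs
  refine tendsto_of_tendsto_of_tendsto_of_le_of_le' tendsto_const_nhds hs ?_ ?_
  · filter_upwards [self_mem_nhdsWithin] with r hr using osc_nonneg g _ x hr
  · filter_upwards [self_mem_nhdsWithin] with r hr
    have hr : 0 < r := hr
    have hpos : 0 < r ^ n * ballVol n := mul_pos (pow_pos hr n) ballVol_pos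
    change osc g (c + c₀) x r ≤ _
    have hib : IntegrableOn (fun z => |g z - f z - c₀|) (ball x r) :=
      integrableOn_abs_sub (hg.sub hf) c₀ x r
    rw [osc_eq _ _ _ hr, osc_eq _ _ _ hr, osc_eq _ _ _ hr, ← mul_add,
      ← integral_add (integrableOn_abs_sub hf c x r) hib]
    refine mul_le_mul_of_nonneg_left ?_ (inv_nonneg.2 hpos.le)
    refine integral_mono (integrableOn_abs_sub hg _ x r)
      ((integrableOn_abs_sub hf c x r).add hib) fun y => ?_
    have := abs_add_le (f y - c) (g y - f y - c₀)
    rwa [show f y - c + (g y - f y - c₀) = g y - (c + c₀) by ring] at this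

theorem ball_subset_halfBall {ν : Eu n} (hν : ‖ν‖ = 1) {r : ℝ} :
    ball (x + (r / 2) • ν) (r / 2) ⊆ {y ∈ ball x r | 0 < ⟪y - x, ν⟫} := by
  intro y hy
  rw [mem_ball, dist_eq_norm] at hy
  have hr : 0 < r / 2 := (norm_nonneg _).trans_lt hy
  set z := y - (x + (r / 2) • ν) with hz
  have hyx : y - x = z + (r / 2) • ν := by rw [hz]; abel
  have hn : ‖(r / 2) • ν‖ = r / 2 := by rw [norm_smul, hν, mul_one, Real.norm_of_nonneg hr.le]
  refine ⟨?_, ?_⟩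
  · rw [mem_ball, dist_eq_norm, hyx]
    have := norm_add_le z ((r / 2) • ν)
    linarith
  · rw [hyx, inner_add_left, inner_smul_left, real_inner_self_eq_norm_sq, hν]
    have h1 := abs_real_inner_le_norm z ν
    rw [hν, mul_one] at h1
    have h2 := neg_abs_le ⟪z, ν⟫
    simp only [conj_trivial, one_pow, mul_one]
    linarith

theorem setAverage_le_of_ball_subset {φ : Eu n → ℝ} (hφ : ∀ y, 0 ≤ φ y) {r : ℝ} (hr : 0 < r)
    (hi : IntegrableOn φ (ball x r)) {H : Set (Eu n)} (hH : H ⊆ ball x r) {z : Eu n}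
    (hz : ball z (r / 2) ⊆ H) : ⨍ y in H, φ y ≤ 2 ^ n * ⨍ y in ball x r, φ y := by
  have hr2 : 0 < r / 2 := by linarith
  have hfin : volume H ≠ ⊤ := ((measure_mono hH).trans_lt measure_ball_lt_top).ne
  have hvol : (r / 2) ^ n * ballVol n ≤ volume.real H := by
    rw [← volume_real_ball_eq z hr2]
    exact measureReal_mono hz hfin
  have hpos : 0 < (r / 2) ^ n * ballVol n := mul_pos (pow_pos hr2 n) ballVol_pos
  rw [setAverage_eq, setAverage_eq, smul_eq_mul, smul_eq_mul, volume_real_ball_eq x hr,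
    ← mul_assoc]
  have h1 : ∫ y in H, φ y ≤ ∫ y in ball x r, φ y :=
    setIntegral_mono_set hi (Eventually.of_forall hφ) (LE.le.eventuallyLE hH)
  have h0 : 0 ≤ ∫ y in ball x r, φ y := integral_nonneg hφ
  have h2 : (volume.real H)⁻¹ ≤ 2 ^ n * (r ^ n * ballVol n)⁻¹ := by
    refine (inv_anti₀ hpos hvol).trans (le_of_eq ?_)
    have : ballVol n ≠ 0 := ballVol_pos.ne'
    rw [div_pow]
    field_simp
  exact mul_le_mul h2 h1 (integral_nonneg hφ) (by positivity [ballVol_pos (n := n)])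

theorem tendsto_setAverage_of_tendsto_osc (hf : Integrable f) (hg : Integrable g)
    (hw : Tendsto (fun r => osc (fun y => f y - g y) c₀ x r) (𝓝[>] 0) (𝓝 0)) {a : ℝ}
    {H : ℝ → Set (Eu n)} (hH : ∀ r, H r ⊆ ball x r) {z : ℝ → Eu n}
    (hz : ∀ r, ball (z r) (r / 2) ⊆ H r)
    (hg0 : Tendsto (fun r => ⨍ y in H r, |g y - a|) (𝓝[>] 0) (𝓝 0)) :
    Tendsto (fun r => ⨍ y in H r, |f y - (a + c₀)|) (𝓝[>] 0) (𝓝 0) := by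
  have hs := hg0.add (hw.const_mul (2 ^ n))
  rw [mul_zero, add_zero] at hs
  refine tendsto_of_tendsto_of_tendsto_of_le_of_le' tendsto_const_nhds hs ?_ ?_
  · refine Eventually.of_forall fun r => ?_
    rw [setAverage_eq]
    exact smul_nonneg (inv_nonneg.2 measureReal_nonneg) (integral_nonneg fun _ => abs_nonneg _)
  · filter_upwards [self_mem_nhdsWithin] with r hr
    have hr : 0 < r := hr
    have hib := integrableOn_abs_sub (hf.sub hg) c₀ x r
    have h1 := setAverage_le_of_ball_subset (fun _ => abs_nonneg _) hr hib (hH r) (hz r)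
    refine le_trans ?_ (add_le_add_right h1 _)
    simp only [setAverage_eq, smul_eq_mul]
    rw [← mul_add, ← integral_add ((integrableOn_abs_sub hg a x r).mono_set (hH r))
      (hib.mono_set (hH r))]
    refine mul_le_mul_of_nonneg_left ?_ (inv_nonneg.2 measureReal_nonneg)
    refine integral_mono ((integrableOn_abs_sub hf _ x r).mono_set (hH r))
      (((integrableOn_abs_sub hg a x r).mono_set (hH r)).add (hib.mono_set (hH r))) fun y => ?_
    have := abs_add_le (g y - a) (f y - g y - c₀)
    rwa [show g y - a + (f y - g y - c₀) = f y - (a + c₀) by ring] at this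

theorem mem_jumpSet_of_tendsto (hf : Integrable f) (hg : Integrable g)
    (hw : Tendsto (fun r => osc (fun y => f y - g y) c₀ x r) (𝓝[>] 0) (𝓝 0))
    (hx : x ∈ jumpSet n g) : x ∈ jumpSet n f := by
  obtain ⟨ν, hν, a, b, hab, ha, hb⟩ := hx
  refine ⟨ν, hν, a + c₀, b + c₀, fun h => hab (add_right_cancel h), ?_, ?_⟩
  · exact tendsto_setAverage_of_tendsto_osc hf hg hw (fun r => Set.sep_subset _ _)
      (fun r => ball_subset_halfBall hν) ha
  · refine tendsto_setAverage_of_tendsto_osc hf hg hw (fun r => Set.sep_subset _ _)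
      (z := fun r => x + (r / 2) • (-ν)) (fun r => ?_) hb
    refine (ball_subset_halfBall (by rwa [norm_neg])).trans fun y hy => ⟨hy.1, ?_⟩
    have := hy.2
    rwa [inner_neg_right, neg_pos] at this

theorem tendsto_osc_of_integrableOn_div (h : IsScale n d U) (hw0 : ∀ y ∉ U, w y = 0)
    (hwi : Integrable w) (hdi : IntegrableOn (fun y => w y / d y) U) (hx : x ∉ U) :
    Tendsto (fun r => osc w 0 x r) (𝓝[>] 0) (𝓝 0) := by
  set I := ∫ y in U, |w y / d y|
  have hlim : Tendsto (fun r : ℝ => r * ((ballVol n)⁻¹ * I)) (𝓝[>] 0) (𝓝 0) := by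
    have : Tendsto (fun r : ℝ => r * ((ballVol n)⁻¹ * I)) (𝓝 0) (𝓝 (0 * ((ballVol n)⁻¹ * I))) :=
      (continuous_id.mul continuous_const).tendsto 0
    rw [zero_mul] at this
    exact this.mono_left nhdsWithin_le_nhds
  refine tendsto_of_tendsto_of_tendsto_of_le_of_le' tendsto_const_nhds hlim ?_ ?_
  · filter_upwards [self_mem_nhdsWithin] with r hr using osc_nonneg w _ x hr
  · filter_upwards [self_mem_nhdsWithin] with r hr
    have hr : 0 < r := hr
    have hV := ballVol_pos (n := n)
    rw [osc_eq _ _ _ hr]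
    have hind : Integrable (U.indicator fun y => |w y / d y|) :=
      (integrable_indicator_iff h.measurableSet).2 hdi.abs
    have h1 : ∫ z in ball x r, |w z - 0| ≤ r ^ (n + 1) * I := by
      have e1 : r ^ (n + 1) * I = ∫ z, r ^ (n + 1) * U.indicator (fun y => |w y / d y|) z := by
        rw [integral_const_mul, integral_indicator h.measurableSet]
      rw [e1]
      refine le_trans ?_ (setIntegral_le_integral (s := ball x r) (hind.const_mul _)
        (Eventually.of_forall fun z => mul_nonneg (pow_nonneg hr.le _)
          (Set.indicator_nonneg (fun _ _ => abs_nonneg _) _)))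
      refine setIntegral_mono_on (integrableOn_abs_sub hwi 0 x r)
        (hind.const_mul _).integrableOn measurableSet_ball fun z hz => ?_
      by_cases hzU : z ∈ U
      · rw [Set.indicator_of_mem hzU, sub_zero, abs_div]
        have hd := (h.pos_iff z).2 hzU
        rw [abs_of_pos hd, mul_div_assoc', le_div_iff₀ hd, mul_comm]
        refine mul_le_mul_of_nonneg_right ((h.le_pow x hx z).trans ?_) (abs_nonneg _)
        exact pow_le_pow_left₀ dist_nonneg (mem_ball.1 hz).le _
      · rw [Set.indicator_of_notMem hzU, hw0 z hzU]
        simp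
    refine (mul_le_mul_of_nonneg_left h1 (by positivity)).trans (le_of_eq ?_)
    rw [pow_succ]
    field_simp

theorem tendsto_osc_of_continuousAt {u : Eu n → ℝ} (hu : ContinuousAt u x)
    (hwu : w =ᶠ[𝓝 x] u) : Tendsto (fun r => osc w (u x) x r) (𝓝[>] 0) (𝓝 0) := by
  rw [Metric.tendsto_nhdsWithin_nhds]
  intro ε hε
  have h1 : ∀ᶠ y in 𝓝 x, |w y - u x| ≤ ε / 2 := by
    filter_upwards [hwu, Metric.continuousAt_iff'.1 hu (ε / 2) (half_pos hε)] with y h1 h2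
    rw [h1, ← Real.dist_eq]
    exact h2.le
  obtain ⟨R, hR, hball⟩ := Metric.eventually_nhds_iff_ball.1 h1
  refine ⟨R, hR, fun r hr hrR => ?_⟩
  have hr : 0 < r := hr
  rw [Real.dist_eq, sub_zero, abs_of_pos hr] at hrR
  rw [Real.dist_eq, sub_zero, abs_of_nonneg (osc_nonneg _ _ _ hr), osc_eq _ _ _ hr]
  have hpos : 0 < r ^ n * ballVol n := mul_pos (pow_pos hr n) ballVol_pos
  have h2 : ‖∫ z in ball x r, |w z - u x|‖ ≤ ε / 2 * volume.real (ball x r) := by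
    refine norm_setIntegral_le_of_norm_le_const measure_ball_lt_top fun z hz => ?_
    rw [Real.norm_of_nonneg (abs_nonneg _)]
    exact hball z (ball_subset_ball hrR.le hz)
  rw [volume_real_ball_eq x hr, Real.norm_of_nonneg (integral_nonneg fun _ => abs_nonneg _)] at h2
  have h3 := mul_le_mul_of_nonneg_left h2 (inv_nonneg.2 hpos.le)
  rw [mul_comm (ε / 2), inv_mul_cancel_left₀ hpos.ne'] at h3
  linarith

end DiscontSets

section GlueSBV

variable {n : ℕ} {f g u q d : Eu n → ℝ} {Ω K : Set (Eu n)} {μ ν : Measure (Eu n)}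
  {σ τ : Eu n → Eu n}

theorem HasGradMeasure.congr {m : Measure (Eu n)} (hf : HasGradMeasure n f Ω m τ)
    (hΩ : MeasurableSet Ω) (hfg : ∀ x ∈ Ω, f x = g x) : HasGradMeasure n g Ω m τ := by
  intro Φ h1 h2 h3
  rw [← hf Φ h1 h2 h3]
  refine setIntegral_congr_fun hΩ fun x hx => ?_
  simp only [hfg x hx]

theorem isSBVOn_glue (h : IsScale n d (Ω \ K)) (hΩ : IsOpen Ω) (hK : MeasurableSet K)
    (hKΩ : K ⊆ Ω) (hKS : K ⊆ approxDiscontSet n f) (hf : Integrable f)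
    (hv : IsVariationPair n f Ω μ σ) (hud : ∀ x ∈ Ω \ K, DifferentiableAt ℝ u x)
    (hui : IntegrableOn u (Ω \ K)) (hug : ∫⁻ x in Ω \ K, ‖fderiv ℝ u x‖ₑ < ⊤)
    (hq : Integrable q) (hqm : StronglyMeasurable q) (hqv : IsVariationPair n q (Ω \ K) ν τ)
    (hqS : ν ((Ω \ K) \ approxDiscontSet n q) = 0) (hg : ∀ x ∈ Ω \ K, g x = u x + q x)
    (hgf : ∀ x ∉ Ω \ K, g x = f x) (hdi : IntegrableOn (fun x => (g x - f x) / d x) (Ω \ K)) :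
    IsSBVOn n g Ω ∧ absVar n g Ω = ∫⁻ x in Ω \ K, ‖fderiv ℝ u x‖ₑ ∧
      jumpVar n g Ω ≤ ν Set.univ + μ (jumpSet n f ∩ K) := by
  have hU := h.measurableSet
  have hfin := hv.1
  have hfin' := hqv.1
  obtain ⟨A, hA⟩ : ∃ A, A = approxDiscontSet n q ∩ (Ω \ K) := ⟨_, rfl⟩
  have hAm : MeasurableSet A := hA ▸ (measurableSet_approxDiscontSet hq hqm).inter hU
  have hA0 : volume A = 0 :=
    hA ▸ measure_mono_null Set.inter_subset_left (volume_approxDiscontSet hq)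
  have hK0 : volume K = 0 := measure_mono_null hKS (volume_approxDiscontSet hf)
  have hνA : ν Aᶜ = 0 := by
    rw [hA]
    refine measure_mono_null (fun x hx => ?_) (measure_union_null hqS hqv.2.1)
    by_cases hxU : x ∈ Ω \ K
    · exact Or.inl ⟨hxU, fun hxS => hx ⟨hxS, hxU⟩⟩
    · exact Or.inr hxU
  have hgi : Integrable g := by
    have h1 : IntegrableOn g (Ω \ K) :=
      (hui.add hq.integrableOn).congr_fun (fun x hx => (hg x hx).symm) hU
    have h2 : IntegrableOn g (Ω \ K)ᶜ :=
      hf.integrableOn.congr_fun (fun x hx => (hgf x hx).symm) hU.compl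
    have := h1.union h2
    rwa [Set.union_compl_self, integrableOn_univ] at this
  have hgradi := integrableOn_gradient hug
  have hvA : (volume.restrict (Ω \ K)) A = 0 := Measure.absolutelyContinuous_restrict hA0
  have hgU : HasGradMeasure n g (Ω \ K) (volume.restrict (Ω \ K) + ν)
      (A.piecewise τ (gradient u)) :=
    ((hasGradMeasure_gradient hui hud hgradi).add_piecewise hvA hνA hgradi hqv.integrable
      hqv.hasGradMeasure hui hq.integrableOn).congr hU fun x hx => (hg x hx).symm
  have hm : (volume.restrict (Ω \ K) + ν) (Ω \ K)ᶜ = 0 := by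
    rw [Measure.add_apply, hqv.2.1, add_zero, Measure.restrict_apply hU.compl,
      Set.compl_inter_self, measure_empty]
  have hmK : (volume.restrict (Ω \ K) + ν) K = 0 :=
    measure_mono_null (show K ⊆ (Ω \ K)ᶜ from fun x hx hx' => hx'.2 hx) hm
  have hKc : (μ.restrict K) Kᶜ = 0 := by
    rw [Measure.restrict_apply hK.compl, Set.compl_inter_self, measure_empty]
  have hτ := integrable_piecewise_add hvA hνA hgradi hqv.integrable
  have hG := hgU.glue h hΩ.measurableSet hK hKΩ hK0 hv hf.integrableOn hm hτ hgi.integrableOn hdi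
  have hmΩ : (volume.restrict (Ω \ K) + ν + μ.restrict K) Ωᶜ = 0 := by
    rw [Measure.add_apply, measure_mono_null (Set.compl_subset_compl.2 Set.sdiff_subset) hm,
      zero_add]
    exact measure_mono_null (Set.compl_subset_compl.2 hKΩ) hKc
  have hpair := hG.isVariationPair hmΩ
    (integrable_piecewise_add hmK hKc hτ hv.integrable.restrict)
  have hφ : Measurable ((Ω \ K).indicator fun x => (‖gradient u x‖₊ : ℝ≥0∞)) :=
    ((measurable_gradient u).nnnorm.coe_nnreal_ennreal).indicator hU
  have hdec : normMeasure (volume.restrict (Ω \ K) + ν + μ.restrict K)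
      (K.piecewise σ (A.piecewise τ (gradient u))) = (ν + μ.restrict K) +
        volume.withDensity ((Ω \ K).indicator fun x => (‖gradient u x‖₊ : ℝ≥0∞)) := by
    rw [normMeasure_piecewise_add hmK hKc, normMeasure_piecewise_add hvA hνA,
      normMeasure_of_norm_eq_one hqv.2.2.2.1,
      normMeasure_of_norm_eq_one (ae_restrict_of_ae hv.2.2.2.1), withDensity_indicator hU,
      add_assoc, add_comm]
    rfl
  have hsing : (ν + μ.restrict K) ⟂ₘ volume := by
    refine ⟨(A ∪ K)ᶜ, (hAm.union hK).compl, ?_, ?_⟩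
    · rw [Measure.add_apply, measure_mono_null
        (Set.compl_subset_compl.2 Set.subset_union_left) hνA, zero_add]
      exact measure_mono_null (Set.compl_subset_compl.2 Set.subset_union_right) hKc
    · rw [compl_compl]
      exact measure_union_null hA0 hK0
  have hoscK : ∀ x ∈ K, Tendsto (fun r => osc (fun y => f y - g y) 0 x r) (𝓝[>] 0) (𝓝 0) := by
    intro x hx
    refine tendsto_osc_of_integrableOn_div h (fun y hy => ?_) (hf.sub hgi) ?_ fun hx' => hx'.2 hx
    · rw [hgf y hy, sub_self]
    · refine hdi.neg.congr (Eventually.of_forall fun y => ?_)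
      change -((g y - f y) / d y) = (f y - g y) / d y
      ring
  have hKg : K ⊆ approxDiscontSet n g := fun x hx => by
    by_contra hxg
    exact notMem_approxDiscontSet_of_tendsto hgi hf (hoscK x hx) hxg (hKS hx)
  have hAg : A ⊆ approxDiscontSet n g := fun x hx => by
    rw [hA] at hx
    by_contra hxg
    refine notMem_approxDiscontSet_of_tendsto (c₀ := -u x) hgi hq ?_ hxg hx.1
    refine tendsto_osc_of_continuousAt (u := fun y => -u y) (hud x hx.2).continuousAt.neg ?_
    filter_upwards [h.isOpen.mem_nhds hx.2] with y hy
    rw [hg y hy]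
    ring
  refine ⟨⟨hpair.isBVOn hgi.integrableOn, ?_⟩, ?_, ?_⟩
  · rw [hpair.cantorVar_eq_of_decomposition hΩ hφ hsing hdec, Measure.add_apply,
      measure_mono_null (fun x hx hxA => hx.2 (hAg hxA)) hνA, zero_add]
    exact measure_mono_null (fun x hx hxK => hx.2 (hKg hxK)) hKc
  · rw [hpair.absVar_eq_of_decomposition hΩ hφ hsing hdec, setLIntegral_indicator hU,
      Set.inter_eq_left.2 Set.sdiff_subset]
    exact lintegral_congr fun x => enorm_gradient u x
  · rw [hpair.jumpVar_eq_of_decomposition hΩ hφ hsing hdec, Measure.add_apply,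
      Measure.restrict_apply' hK]
    refine add_le_add (measure_mono (Set.subset_univ _)) (measure_mono fun x hx => ⟨?_, hx.2⟩)
    exact mem_jumpSet_of_tendsto hf hgi (hoscK x hx.2) hx.1.1

end GlueSBV

section ApproxSBV

variable {n : ℕ} {f d : Eu n → ℝ} {Ω : Set (Eu n)} {μ : Measure (Eu n)} {σ : Eu n → Eu n}

theorem exists_mul_scale_factor_le (n : ℕ) {a b : ℝ≥0∞} (hab : a < b) (ha : a ≠ ⊤) :
    ∃ ε : ℝ, 0 < ε ∧ ∀ ρ, 0 < ρ → ρ ≤ ε →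
      ENNReal.ofReal ((1 + ρ) * ((1 + ρ) / (1 - ρ)) ^ n) * a ≤ b := by
  have h1 : ContinuousAt (fun ρ : ℝ => (1 + ρ) * ((1 + ρ) / (1 - ρ)) ^ n) 0 := by
    have : ContinuousAt (fun ρ : ℝ => (1 + ρ) / (1 - ρ)) 0 :=
      ContinuousAt.div (by fun_prop) (by fun_prop) (by norm_num)
    exact ContinuousAt.mul (by fun_prop) (this.pow n)
  have h2 : Tendsto (fun ρ : ℝ => ENNReal.ofReal ((1 + ρ) * ((1 + ρ) / (1 - ρ)) ^ n) * a)
      (𝓝 0) (𝓝 a) := by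
    have := ENNReal.Tendsto.mul_const (b := a) (ENNReal.tendsto_ofReal h1.tendsto) (Or.inr ha)
    simpa using this
  have h3 : ∀ᶠ ρ : ℝ in 𝓝[>] 0,
      ENNReal.ofReal ((1 + ρ) * ((1 + ρ) / (1 - ρ)) ^ n) * a ≤ b :=
    nhdsWithin_le_nhds ((h2.eventually_lt_const hab).mono fun _ h => h.le)
  obtain ⟨ε, hε, hsub⟩ := mem_nhdsGT_iff_exists_Ioc_subset.1 h3
  exact ⟨ε, hε, fun ρ h0 h1 => hsub ⟨h0, h1⟩⟩

theorem quantized_indicator_roundMap (δ t : ℝ) (U : Set (Eu n)) (w : Eu n → ℝ) (x : Eu n) :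
    ∃ k : ℤ, U.indicator (fun x => roundMap δ t (w x)) x = δ * k := by
  by_cases hx : x ∈ U
  · refine ⟨⌊w x / δ - t⌋ + 1, ?_⟩
    rw [Set.indicator_of_mem hx, roundMap]
    push_cast
    rfl
  · exact ⟨0, by rw [Set.indicator_of_notMem hx, Int.cast_zero, mul_zero]⟩

theorem stronglyMeasurable_indicator_roundMap {δ t : ℝ} {u : Eu n → ℝ} (hΩ : MeasurableSet Ω)
    (hf : StronglyMeasurable f) (hu : ContinuousOn u Ω) :
    StronglyMeasurable (Ω.indicator fun x => roundMap δ t (f x - u x)) := by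
  have h1 : Measurable (Ω.indicator fun x => roundMap δ t (f x - Ω.indicator u x)) :=
    (measurable_roundMap.comp
      (hf.measurable.sub (measurable_indicator_of_continuousOn hu hΩ))).indicator hΩ
  refine Measurable.stronglyMeasurable ?_
  convert h1 using 1
  refine Set.indicator_congr fun x hx => ?_
  rw [Set.indicator_of_mem hx]

theorem integrableOn_scaleMol_sub_div (h : IsScale n d Ω) (hf : Integrable f)
    (hv : IsVariationPair n f Ω μ σ) {ρ : ℝ} (hρ : 0 < ρ) (hρ1 : ρ ≤ 1 / 2) :
    IntegrableOn (fun x => (f x - scaleMol f d ρ x) / d x) Ω := by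
  have := hv.1
  refine ⟨AEMeasurable.aestronglyMeasurable (AEMeasurable.div
    (hf.integrableOn.aestronglyMeasurable.sub
      (scaleMol_aestronglyMeasurable h hf hρ)).aemeasurable h.continuous.measurable.aemeasurable),
    ?_⟩
  have hle := setLIntegral_scaleMol_sub_div_le h hf hv hρ hρ1
  refine lt_of_le_of_lt (le_trans (le_of_eq ?_) hle)
    (ENNReal.mul_lt_top ENNReal.ofReal_lt_top (measure_lt_top μ _))
  refine setLIntegral_congr_fun h.measurableSet fun x hx => ?_
  have hd := (h.pos_iff x).2 hx
  change ‖(f x - scaleMol f d ρ x) / d x‖ₑ = ‖f x - scaleMol f d ρ x‖ₑ / ENNReal.ofReal (d x)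
  rw [← ofReal_norm, norm_div, ENNReal.ofReal_div_of_pos (norm_pos_iff.2 hd.ne'), ofReal_norm,
    Real.norm_of_nonneg hd.le]

theorem measure_sdiff_approxDiscontSet_le (hΩ : IsOpen Ω) (hv : IsVariationPair n f Ω μ σ) :
    μ (Ω \ approxDiscontSet n f) ≤ absVar n f Ω + cantorVar n f Ω := by
  have := hv.1
  have hdec : μ.HaveLebesgueDecomposition volume :=
    Measure.haveLebesgueDecomposition_of_sigmaFinite _ _
  have hadd := μ.haveLebesgueDecomposition_add volume
  rw [hv.absVar_eq hΩ, hv.cantorVar_eq hΩ]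
  conv_lhs => rw [hadd]
  rw [Measure.add_apply, add_comm]
  exact add_le_add (measure_mono Set.sdiff_subset) le_rfl

theorem measure_jumpSet_inter_le (hΩ : IsOpen Ω) (hv : IsVariationPair n f Ω μ σ)
    {K : Set (Eu n)} (hKΩ : K ⊆ Ω) (hK0 : volume K = 0) :
    μ (jumpSet n f ∩ K) ≤ jumpVar n f Ω := by
  have := hv.1
  have hdec : μ.HaveLebesgueDecomposition volume :=
    Measure.haveLebesgueDecomposition_of_sigmaFinite _ _
  have hadd := μ.haveLebesgueDecomposition_add volume
  rw [hv.jumpVar_eq hΩ]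
  conv_lhs => rw [hadd]
  rw [Measure.add_apply, withDensity_absolutelyContinuous volume (μ.rnDeriv volume)
    (measure_mono_null Set.inter_subset_right hK0), add_zero]
  exact measure_mono (Set.inter_subset_inter_right _ hKΩ)

theorem exists_isSBVOn_near (hΩ : IsOpen Ω) (hf : Integrable f) (hm : StronglyMeasurable f)
    (hv : IsVariationPair n f Ω μ σ) {δ : ℝ} (hδ : 0 < δ) {η : ℝ≥0∞} (hη : 0 < η) (hη' : η ≠ ⊤) :
    ∃ g : Eu n → ℝ, IsSBVOn n g Ω ∧ (∀ x, |g x - f x| ≤ δ) ∧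
      absVar n g Ω ≤ absVar n f Ω + cantorVar n f Ω + η ∧
      jumpVar n g Ω ≤ jumpVar n f Ω + η := by
  have hfin := hv.1
  set S := approxDiscontSet n f
  have hSm : MeasurableSet S := measurableSet_approxDiscontSet hf hm
  obtain ⟨C, hC⟩ : ∃ C : ℝ≥0∞, C = n * (3 * (5 * (ENNReal.ofReal (2 * 3 ^ n) + 1))) := ⟨_, rfl⟩
  have hCtop : C ≠ ⊤ := by
    rw [hC]
    finiteness
  obtain ⟨η₁, hη₁⟩ : ∃ η₁, η₁ = η / 2 / (C + 1) := ⟨_, rfl⟩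
  have hη2 : η / 2 ≠ 0 := (ENNReal.half_pos hη.ne').ne'
  have hη₁0 : 0 < η₁ := hη₁ ▸ ENNReal.div_pos hη2 (by finiteness)
  have hη₁le : η₁ ≤ η / 2 := hη₁ ▸ ENNReal.div_le_of_le_mul (le_mul_of_one_le_right' le_add_self)
  have hCη : C * η₁ ≤ η := by
    refine le_trans ?_ (ENNReal.half_le_self (a := η))
    calc C * η₁ ≤ (C + 1) * η₁ := by gcongr; exact le_self_add
      _ = η / 2 := by rw [hη₁, ENNReal.mul_div_cancel (by simp) (by finiteness)]
  have hη₁lt : η₁ < η := hη₁le.trans_lt (ENNReal.half_lt_self hη.ne' hη')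
  obtain ⟨K, hKS, hKc, hKμ⟩ := (hSm.inter hΩ.measurableSet).exists_isCompact_sdiff_lt
    (μ := μ) (measure_ne_top _ _) hη₁0.ne'
  have hKm := hKc.measurableSet
  have hKΩ : K ⊆ Ω := hKS.trans Set.inter_subset_right
  have hKS' : K ⊆ S := hKS.trans Set.inter_subset_left
  have hK0 : volume K = 0 := measure_mono_null hKS' (volume_approxDiscontSet hf)
  have hUo : IsOpen (Ω \ K) := hΩ.sdiff hKc.isClosed
  obtain ⟨d, h⟩ := exists_isScale hUo
  have hr := hv.restrict hΩ.measurableSet hUo Set.sdiff_subset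
  have hμS : (μ.restrict (Ω \ K)) S ≤ η₁ := by
    rw [Measure.restrict_apply hSm]
    exact (measure_mono fun x hx => show x ∈ (S ∩ Ω) \ K from
      ⟨⟨hx.1, hx.2.1⟩, hx.2.2⟩).trans hKμ.le
  have hμU : μ (Ω \ K) ≤ μ (Ω \ S) + η₁ := by
    refine (measure_mono fun x hx => ?_).trans
      ((measure_union_le (Ω \ S) ((S ∩ Ω) \ K)).trans (add_le_add le_rfl hKμ.le))
    by_cases hxS : x ∈ S
    · exact Or.inr ⟨⟨hxS, hx.1⟩, hx.2⟩
    · exact Or.inl ⟨hx.1, hxS⟩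
  obtain ⟨ε, hε, hfac⟩ := exists_mul_scale_factor_le n (a := μ (Ω \ S) + η₁) (b := μ (Ω \ S) + η)
    ((ENNReal.add_lt_add_iff_left (measure_ne_top _ _)).2 hη₁lt)
    (ENNReal.add_ne_top.2 ⟨measure_ne_top _ _, (hη₁lt.trans_le le_top).ne⟩)
  obtain ⟨ρ, t, hρ, hρ1, hρε, ht, ht1, ν, τ, hqv, hν⟩ :=
    exists_isVariationPair_roundMap h hf hm hr hδ hη₁0 (hη₁lt.trans_le le_top).ne hε
  have hrfin := hr.1
  have hui := scaleMol_integrableOn h hf hr hρ hρ1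
  have hqi := (integrable_indicator_iff h.measurableSet).2
    (integrableOn_roundMap_comp hδ ht ht1 (hf.integrableOn.sub hui))
  have hqm := stronglyMeasurable_indicator_roundMap (δ := δ) (t := t) h.measurableSet hm
    (scaleMol_continuousOn h hf hρ)
  obtain ⟨q, hqdef⟩ : ∃ q, q = (Ω \ K).indicator fun x => roundMap δ t (f x - scaleMol f d ρ x) :=
    ⟨_, rfl⟩
  have hqδ : ∀ x, ∃ k : ℤ, q x = δ * k :=
    hqdef ▸ quantized_indicator_roundMap δ t (Ω \ K) (fun x => f x - scaleMol f d ρ x)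
  replace hqi : Integrable q := hqdef ▸ hqi
  replace hqm : StronglyMeasurable q := hqdef ▸ hqm
  replace hqv : IsVariationPair n q (Ω \ K) ν τ := hqdef ▸ hqv
  have hqU : ∀ x ∈ Ω \ K, q x = roundMap δ t (f x - scaleMol f d ρ x) := fun x hx => by
    rw [hqdef, Set.indicator_of_mem hx]
  have hgrad := lintegral_enorm_fderiv_scaleMol_le h hf hr hρ (by linarith)
  rw [Measure.restrict_apply_self] at hgrad
  obtain ⟨g, hgU, hgf⟩ : ∃ g : Eu n → ℝ, (∀ x ∈ Ω \ K, g x = scaleMol f d ρ x + q x) ∧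
      ∀ x ∉ Ω \ K, g x = f x :=
    ⟨fun x => if x ∈ Ω \ K then scaleMol f d ρ x + q x else f x, fun x hx => if_pos hx,
      fun x hx => if_neg hx⟩
  have hdi : IntegrableOn (fun x => (g x - f x) / d x) (Ω \ K) := by
    refine ((integrableOn_scaleMol_sub_div h hf hr hρ hρ1).norm.const_mul 6).mono' ?_ ?_
    · have h1 : IntegrableOn g (Ω \ K) :=
        (hui.add hqi.integrableOn).congr_fun (fun x hx => (hgU x hx).symm) h.measurableSet
      exact AEMeasurable.aestronglyMeasurable (AEMeasurable.div
        (h1.aestronglyMeasurable.sub hf.integrableOn.aestronglyMeasurable).aemeasurable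
        h.continuous.measurable.aemeasurable)
    · filter_upwards [ae_restrict_mem h.measurableSet] with x hx
      rw [norm_div, norm_div, mul_div_assoc']
      refine div_le_div_of_nonneg_right ?_ (norm_nonneg _)
      rw [hgU x hx, hqU x hx, Real.norm_eq_abs, Real.norm_eq_abs]
      have h1 := abs_roundMap_le hδ ht ht1 (f x - scaleMol f d ρ x)
      have h2 := abs_sub (roundMap δ t (f x - scaleMol f d ρ x)) (f x - scaleMol f d ρ x)
      rw [show scaleMol f d ρ x + roundMap δ t (f x - scaleMol f d ρ x) - f x =
        roundMap δ t (f x - scaleMol f d ρ x) - (f x - scaleMol f d ρ x) by ring]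
      linarith
  obtain ⟨h1, h2, h3⟩ := isSBVOn_glue h hΩ hKm hKΩ hKS' hf hv
    (fun x hx => scaleMol_differentiableAt h hf hρ hx) hui
    (hgrad.trans_lt (ENNReal.mul_lt_top ENNReal.ofReal_lt_top (measure_lt_top μ _))) hqi hqm hqv
    (measure_diff_approxDiscontSet_of_quantized hUo hqi hqm hδ hqδ hqv) hgU hgf hdi
  refine ⟨g, h1, fun x => ?_, ?_, ?_⟩
  · by_cases hx : x ∈ Ω \ K
    · rw [hgU x hx, hqU x hx, show scaleMol f d ρ x + roundMap δ t (f x - scaleMol f d ρ x) - f x =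
        roundMap δ t (f x - scaleMol f d ρ x) - (f x - scaleMol f d ρ x) by ring]
      exact abs_roundMap_sub_le hδ (by linarith) (by linarith) _
    · rw [hgf x hx, sub_self, abs_zero]
      exact hδ.le
  · rw [h2]
    calc _ ≤ _ := hgrad
      _ ≤ _ := mul_le_mul_right hμU _
      _ ≤ μ (Ω \ S) + η := hfac ρ hρ hρε
      _ ≤ _ := add_le_add (measure_sdiff_approxDiscontSet_le hΩ hv) le_rfl
  · refine h3.trans ?_
    rw [add_comm]
    refine add_le_add (measure_jumpSet_inter_le hΩ hv hKΩ hK0) (hν.trans (le_trans ?_ hCη))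
    calc _ ≤ (n : ℝ≥0∞) * (3 * (5 * (ENNReal.ofReal (2 * 3 ^ n) * η₁ + η₁))) := by gcongr
      _ = C * η₁ := by rw [hC]; ring

end ApproxSBV

section AECongr

variable {n : ℕ} {f g : Eu n → ℝ} {Ω : Set (Eu n)} {μ : Measure (Eu n)} {σ : Eu n → Eu n}

theorem IsVariationPair.congr_ae (h : IsVariationPair n f Ω μ σ)
    (hfg : f =ᵐ[volume.restrict Ω] g) : IsVariationPair n g Ω μ σ := by
  refine ⟨h.1, h.2.1, h.2.2.1, h.2.2.2.1, fun Φ h1 h2 h3 => ?_⟩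
  rw [← h.2.2.2.2 Φ h1 h2 h3]
  refine integral_congr_ae ?_
  filter_upwards [hfg] with x hx
  rw [hx]

theorem tendsto_setAverage_congr_ae (hΩ : IsOpen Ω) (hfg : f =ᵐ[volume.restrict Ω] g) {x : Eu n}
    (hx : x ∈ Ω) {H : ℝ → Set (Eu n)} (hH : ∀ r, H r ⊆ ball x r) {c : ℝ}
    (hf : Tendsto (fun r => ⨍ y in H r, |f y - c|) (𝓝[>] 0) (𝓝 0)) :
    Tendsto (fun r => ⨍ y in H r, |g y - c|) (𝓝[>] 0) (𝓝 0) := by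
  obtain ⟨R, hR, hball⟩ := Metric.isOpen_iff.1 hΩ x hx
  refine hf.congr' ?_
  filter_upwards [Ioc_mem_nhdsGT hR] with r hr
  refine average_congr ?_
  filter_upwards [ae_restrict_of_ae_restrict_of_subset
    ((hH r).trans ((ball_subset_ball hr.2).trans hball)) hfg] with y hy
  rw [hy]

theorem sdiff_approxDiscontSet_subset_of_ae_eq (hΩ : IsOpen Ω)
    (hfg : f =ᵐ[volume.restrict Ω] g) :
    Ω \ approxDiscontSet n f ⊆ Ω \ approxDiscontSet n g := by
  rintro x ⟨hx, hxf⟩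
  obtain ⟨c, hc⟩ := not_not.1 hxf
  exact ⟨hx, not_not.2 ⟨c, tendsto_setAverage_congr_ae hΩ hfg hx (fun _ => subset_rfl) hc⟩⟩

theorem jumpSet_inter_subset_of_ae_eq (hΩ : IsOpen Ω) (hfg : f =ᵐ[volume.restrict Ω] g) :
    jumpSet n f ∩ Ω ⊆ jumpSet n g ∩ Ω := by
  rintro x ⟨⟨ν, hν, a, b, hab, ha, hb⟩, hx⟩
  exact ⟨⟨ν, hν, a, b, hab,
    tendsto_setAverage_congr_ae hΩ hfg hx (fun _ => Set.sep_subset _ _) ha,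
    tendsto_setAverage_congr_ae hΩ hfg hx (fun _ => Set.sep_subset _ _) hb⟩, hx⟩

theorem IsVariationPair.absVar_congr_ae (hΩ : IsOpen Ω) (h : IsVariationPair n f Ω μ σ)
    (hfg : f =ᵐ[volume.restrict Ω] g) : absVar n f Ω = absVar n g Ω := by
  rw [h.absVar_eq hΩ, (h.congr_ae hfg).absVar_eq hΩ]

theorem IsVariationPair.cantorVar_congr_ae (hΩ : IsOpen Ω) (h : IsVariationPair n f Ω μ σ)
    (hfg : f =ᵐ[volume.restrict Ω] g) : cantorVar n f Ω = cantorVar n g Ω := by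
  rw [h.cantorVar_eq hΩ, (h.congr_ae hfg).cantorVar_eq hΩ,
    (sdiff_approxDiscontSet_subset_of_ae_eq hΩ hfg).antisymm
      (sdiff_approxDiscontSet_subset_of_ae_eq hΩ hfg.symm)]

theorem IsVariationPair.jumpVar_congr_ae (hΩ : IsOpen Ω) (h : IsVariationPair n f Ω μ σ)
    (hfg : f =ᵐ[volume.restrict Ω] g) : jumpVar n f Ω = jumpVar n g Ω := by
  rw [h.jumpVar_eq hΩ, (h.congr_ae hfg).jumpVar_eq hΩ,
    (jumpSet_inter_subset_of_ae_eq hΩ hfg).antisymm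
      (jumpSet_inter_subset_of_ae_eq hΩ hfg.symm)]

theorem limsup_le_of_le_add_ofReal {a : ℕ → ℝ≥0∞} {b : ℝ≥0∞}
    (h : ∀ i, a i ≤ b + ENNReal.ofReal (1 / ((i : ℝ) + 1))) : limsup a atTop ≤ b := by
  have hlim : Tendsto (fun i : ℕ => b + ENNReal.ofReal (1 / ((i : ℝ) + 1))) atTop (𝓝 b) := by
    have := (ENNReal.tendsto_ofReal tendsto_one_div_add_atTop_nhds_zero_nat).const_add b
    rwa [ENNReal.ofReal_zero, add_zero] at this
  exact (limsup_le_limsup (Eventually.of_forall h)).trans hlim.limsup_eq.le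

end AECongr

/-- Approximation of a `BV` function by `SBV` functions in the
`L^∞` norm, with control of the absolutely continuous and jump parts. -/
theorem BV_approximation_SBV_Linfty
    (n : ℕ) (hn : 1 ≤ n)
    (Ω : Set (EuclideanSpace ℝ (Fin n))) (hΩ : IsOpen Ω)
    (f : EuclideanSpace ℝ (Fin n) → ℝ) (hf : IsBVOn n f Ω) :
    ∃ F : ℕ → EuclideanSpace ℝ (Fin n) → ℝ,
      (∀ i, IsSBVOn n (F i) Ω) ∧
      Tendsto (fun i => eLpNorm (fun x => F i x - f x) ⊤ (volume.restrict Ω))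
        atTop (𝓝 0) ∧
      limsup (fun i => absVar n (F i) Ω) atTop ≤
        absVar n f Ω + cantorVar n f Ω ∧
      limsup (fun i => jumpVar n (F i) Ω) atTop ≤ jumpVar n f Ω := by
  obtain ⟨μ, σ, hv⟩ := hf.exists_isVariationPair hΩ
  have hfm := hf.1.aestronglyMeasurable
  obtain ⟨g, hg⟩ : ∃ g, g = Ω.indicator (hfm.mk f) := ⟨_, rfl⟩
  have hfg : f =ᵐ[volume.restrict Ω] g := by
    filter_upwards [hfm.ae_eq_mk, ae_restrict_mem hΩ.measurableSet] with x hx hxΩ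
    rw [hx, hg, Set.indicator_of_mem hxΩ]
  have hgi : Integrable g :=
    hg ▸ (integrable_indicator_iff hΩ.measurableSet).2 (hf.1.congr hfm.ae_eq_mk)
  have hgm : StronglyMeasurable g := hg ▸ hfm.stronglyMeasurable_mk.indicator hΩ.measurableSet
  have hpos : ∀ i : ℕ, 0 < 1 / ((i : ℝ) + 1) := fun i => Nat.one_div_pos_of_nat
  choose F hF hFg hFa hFj using fun i : ℕ => exists_isSBVOn_near hΩ hgi hgm (hv.congr_ae hfg)
    (hpos i) (ENNReal.ofReal_pos.2 (hpos i)) ENNReal.ofReal_ne_top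
  rw [hv.absVar_congr_ae hΩ hfg, hv.cantorVar_congr_ae hΩ hfg, hv.jumpVar_congr_ae hΩ hfg]
  refine ⟨F, hF, ?_, limsup_le_of_le_add_ofReal hFa, limsup_le_of_le_add_ofReal hFj⟩
  have hlim := ENNReal.tendsto_ofReal tendsto_one_div_add_atTop_nhds_zero_nat
  rw [ENNReal.ofReal_zero] at hlim
  refine tendsto_of_tendsto_of_tendsto_of_le_of_le tendsto_const_nhds hlim
    (fun _ => zero_le) fun i => ?_
  rw [eLpNorm_exponent_top]
  refine eLpNormEssSup_le_of_ae_bound ?_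
  filter_upwards [hfg] with x hx
  rw [hx]
  exact hFg i x

end
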